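/- (Theorem 1.2, first identity.) If M is a positive integer with M ≡ 1 (mod 8), then (1,8,8,0,0,0)(M) = (1,14,14,0,0,0)(M) + 2·(2,7,14,0,0,0)(M) + 4·(3,5,14,0,0,2)(M). -/

import Mathlib

/-- The number of representations of `M` by the ternary quadratic form
`a x² + b y² + c z² + d y z + e z x + f x y`. -/
noncomputable def rep (a b c d e f M : ℤ) : ℕ :=
  {p : ℤ × ℤ × ℤ | M = a * p.1 ^ 2 + b * p.2.1 ^ 2 + c * p.2.2 ^ 2
      + d * p.2.1 * p.2.2 + e * p.2.2 * p.1 + f * p.1 * p.2.1}.ncard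

section
open Filter Topology

theorem tsum_split {α β γ : Type*} (f : γ → ℂ) (hf : Summable f) (i : α → γ) (j : β → γ)
    (hi : Function.Injective i) (hj : Function.Injective j)
    (h : IsCompl (Set.range i) (Set.range j)) :
    ∑' c, f c = ∑' a, f (i a) + ∑' b, f (j b) := by
  have h1 : HasSum (f ∘ i) (∑' a, f (i a)) := (hf.comp_injective hi).hasSum
  have h2 : HasSum (f ∘ j) (∑' b, f (j b)) := (hf.comp_injective hj).hasSum
  have h1' := hi.hasSum_range_iff.mpr h1
  have h2' := hj.hasSum_range_iff.mpr h2
  exact (HasSum.add_isCompl h h1' h2').tsum_eq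

theorem two_inj : Function.Injective (fun n : ℤ => 2 * n) := fun a b h => by simp at h; omega
theorem two_inj' : Function.Injective (fun n : ℤ => 2 * n + 1) := fun a b h => by simp at h; omega

theorem tsum_int_split (f : ℤ → ℂ) (hf : Summable f) :
    ∑' c, f c = ∑' a, f (2 * a) + ∑' b, f (2 * b + 1) := by
  refine tsum_split f hf _ _ two_inj two_inj' ?_
  constructor
  · rw [Set.disjoint_left]
    rintro x ⟨a, rfl⟩ ⟨b, hb⟩
    simp at hb; omega
  · rw [codisjoint_iff]
    ext x
    simp only [Set.sup_eq_union, Set.mem_union, Set.mem_range, Set.top_eq_univ, Set.mem_univ, iff_true]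
    rcases Int.even_or_odd' x with ⟨k, hk | hk⟩
    · left; exact ⟨k, hk.symm⟩
    · right; exact ⟨k, hk.symm⟩

/-- same-parity lattice rearrangement -/
theorem tsum_par (f : ℤ × ℤ → ℂ) (hf : Summable f) :
    ∑' c, f c = ∑' a : ℤ × ℤ, f (a.1 + a.2, a.1 - a.2) + ∑' a : ℤ × ℤ, f (a.1 + a.2 + 1, a.1 - a.2) := by
  refine tsum_split f hf (fun a : ℤ × ℤ => (a.1 + a.2, a.1 - a.2))
    (fun a : ℤ × ℤ => (a.1 + a.2 + 1, a.1 - a.2)) ?_ ?_ ?_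
  · rintro ⟨a, b⟩ ⟨c, d⟩ h
    simp only [Prod.mk.injEq] at h ⊢; omega
  · rintro ⟨a, b⟩ ⟨c, d⟩ h
    simp only [Prod.mk.injEq] at h ⊢; omega
  constructor
  · rw [Set.disjoint_left]
    rintro x ⟨a, rfl⟩ ⟨b, hb⟩
    simp only [Prod.mk.injEq] at hb; omega
  · rw [codisjoint_iff]
    ext ⟨x, y⟩
    simp only [Set.sup_eq_union, Set.mem_union, Set.mem_range, Set.top_eq_univ, Set.mem_univ, iff_true, Prod.mk.injEq, Prod.exists]
    rcases Int.even_or_odd' (x + y) with ⟨k, hk | hk⟩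
    · left; exact ⟨k, x - k, by omega, by omega⟩
    · right; exact ⟨k, x - k - 1, by omega, by omega⟩

theorem summable_nat_theta (q c : ℝ) (hq : 0 < q) (hq1 : q < 1) (hc : 0 < c) :
    Summable (fun n : ℕ => q ^ (n ^ 2) * c ^ n) := by
  refine summable_of_ratio_test_tendsto_lt_one (l := 0) one_pos ?_ ?_
  · exact Eventually.of_forall fun n => by positivity
  · have : (fun n : ℕ => ‖q ^ ((n + 1) ^ 2) * c ^ (n + 1)‖ / ‖q ^ (n ^ 2) * c ^ n‖)
        = fun n : ℕ => q * c * (q ^ 2) ^ n := by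
      funext n
      rw [Real.norm_of_nonneg (by positivity), Real.norm_of_nonneg (by positivity)]
      rw [div_eq_iff (by positivity)]
      ring
    rw [this]
    have h := tendsto_pow_atTop_nhds_zero_of_lt_one (r := q ^ 2) (by positivity) (by nlinarith)
    simpa using h.const_mul (q * c)

theorem summable_theta_norm (q X : ℂ) (hq : q ≠ 0) (hq1 : ‖q‖ < 1) (hX : X ≠ 0) :
    Summable (fun n : ℤ => ‖q ^ (n ^ 2) * X ^ n‖) := by
  have hq' : 0 < ‖q‖ := norm_pos_iff.mpr hq
  have hX' : 0 < ‖X‖ := norm_pos_iff.mpr hX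
  refine Summable.of_nat_of_neg ?_ ?_
  · refine (summable_nat_theta ‖q‖ ‖X‖ hq' hq1 hX').congr fun n => ?_
    rw [norm_mul, norm_zpow, norm_zpow, zpow_natCast]
    congr 1
  · refine (summable_nat_theta ‖q‖ ‖X‖⁻¹ hq' hq1 (by positivity)).congr fun n => ?_
    rw [norm_mul, norm_zpow, norm_zpow, zpow_neg, zpow_natCast, inv_pow, neg_sq]
    congr 1

noncomputable def tm (r ξ : ℂ) (m : ℤ) : ℂ := r ^ (m ^ 2) * ξ ^ m
noncomputable def tE (r ξ : ℂ) : ℂ := ∑' n : ℤ, tm r ξ (2 * n)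
noncomputable def tO (r ξ : ℂ) : ℂ := ∑' n : ℤ, tm r ξ (2 * n + 1)
noncomputable def tF (r ξ : ℂ) : ℂ := ∑' n : ℤ, (-1) ^ n * tm r ξ (2 * n)

section
variable {r x y : ℂ} (hr : r ≠ 0) (hr1 : ‖r‖ < 1) (hx : x ≠ 0) (hy : y ≠ 0)

theorem tm_summable_norm (hr : r ≠ 0) (hr1 : ‖r‖ < 1) (hx : x ≠ 0) : Summable (fun m => ‖tm r x m‖) :=
  summable_theta_norm r x hr hr1 hx
theorem tmE_summable_norm (hr : r ≠ 0) (hr1 : ‖r‖ < 1) (hx : x ≠ 0) : Summable (fun m => ‖tm r x (2 * m)‖) :=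
  (tm_summable_norm hr hr1 hx).comp_injective two_inj
theorem tmO_summable_norm (hr : r ≠ 0) (hr1 : ‖r‖ < 1) (hx : x ≠ 0) : Summable (fun m => ‖tm r x (2 * m + 1)‖) :=
  (tm_summable_norm hr hr1 hx).comp_injective two_inj'
theorem tmF_summable_norm (hr : r ≠ 0) (hr1 : ‖r‖ < 1) (hx : x ≠ 0) : Summable (fun m : ℤ => ‖(-1) ^ m * tm r x (2 * m)‖) :=
  (tmE_summable_norm hr hr1 hx).congr (fun m => by simp [norm_zpow])

theorem r2_lt (hr1 : ‖r‖ < 1) : ‖r ^ 2‖ < 1 := by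
  rw [norm_pow]; exact pow_lt_one₀ (norm_nonneg _) hr1 (by norm_num)

theorem tm_key (hr : r ≠ 0) (hx : x ≠ 0) (hy : y ≠ 0) (m n u v : ℤ) (h1 : m = u + v) (h2 : n = u - v) :
    tm r x m * tm r y n = tm (r ^ 2) (x * y) u * tm (r ^ 2) (x / y) v := by
  subst h1 h2
  unfold tm
  rw [mul_zpow, div_zpow, zpow_add₀ hx, zpow_sub₀ hy]
  have : r ^ ((u + v) ^ 2) * r ^ ((u - v) ^ 2) = (r ^ 2) ^ (u ^ 2) * (r ^ 2) ^ (v ^ 2) := by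
    rw [← zpow_add₀ hr, ← zpow_natCast r 2, ← zpow_mul, ← zpow_mul, ← zpow_add₀ hr]
    congr 1; push_cast; ring
  calc _ = (r ^ ((u + v) ^ 2) * r ^ ((u - v) ^ 2)) * (x ^ u * x ^ v * (y ^ u / y ^ v)) := by ring
    _ = _ := by rw [this]; ring

theorem P33 (hr : r ≠ 0) (hr1 : ‖r‖ < 1) (hx : x ≠ 0) (hy : y ≠ 0) :
    tE r x * tE r y = tE (r ^ 2) (x * y) * tE (r ^ 2) (x / y) + tO (r ^ 2) (x * y) * tO (r ^ 2) (x / y) := by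
  have hr2 : r ^ 2 ≠ 0 := pow_ne_zero _ hr
  have hr21 := r2_lt hr1
  have hxy := mul_ne_zero hx hy
  have hxy' := div_ne_zero hx hy
  unfold tE tO
  rw [tsum_mul_tsum_of_summable_norm (tmE_summable_norm hr hr1 hx) (tmE_summable_norm hr hr1 hy),
    tsum_mul_tsum_of_summable_norm (tmE_summable_norm hr2 hr21 hxy) (tmE_summable_norm hr2 hr21 hxy'),
    tsum_mul_tsum_of_summable_norm (tmO_summable_norm hr2 hr21 hxy) (tmO_summable_norm hr2 hr21 hxy'),
    tsum_par _ (summable_mul_of_summable_norm (tmE_summable_norm hr hr1 hx) (tmE_summable_norm hr hr1 hy))]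
  congr 1
  · exact tsum_congr fun a => tm_key hr hx hy _ _ _ _ (by ring) (by ring)
  · exact tsum_congr fun a => tm_key hr hx hy _ _ _ _ (by ring) (by ring)

theorem P44 (hr : r ≠ 0) (hr1 : ‖r‖ < 1) (hx : x ≠ 0) (hy : y ≠ 0) :
    tF r x * tF r y = tE (r ^ 2) (x * y) * tE (r ^ 2) (x / y) - tO (r ^ 2) (x * y) * tO (r ^ 2) (x / y) := by
  have hr2 : r ^ 2 ≠ 0 := pow_ne_zero _ hr
  have hr21 := r2_lt hr1
  have hxy := mul_ne_zero hx hy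
  have hxy' := div_ne_zero hx hy
  unfold tF tE tO
  rw [tsum_mul_tsum_of_summable_norm (tmF_summable_norm hr hr1 hx) (tmF_summable_norm hr hr1 hy),
    tsum_mul_tsum_of_summable_norm (tmE_summable_norm hr2 hr21 hxy) (tmE_summable_norm hr2 hr21 hxy'),
    tsum_mul_tsum_of_summable_norm (tmO_summable_norm hr2 hr21 hxy) (tmO_summable_norm hr2 hr21 hxy'),
    tsum_par _ (summable_mul_of_summable_norm (tmF_summable_norm hr hr1 hx) (tmF_summable_norm hr hr1 hy)),
    sub_eq_add_neg, ← tsum_neg]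
  congr 1
  · refine tsum_congr fun a => ?_
    rw [← tm_key hr hx hy (2 * (a.1 + a.2)) (2 * (a.1 - a.2)) _ _ (by ring) (by ring)]
    have : ((-1 : ℂ) ^ (a.1 + a.2)) * (-1) ^ (a.1 - a.2) = 1 := by
      rw [← zpow_add₀ (by norm_num), show a.1 + a.2 + (a.1 - a.2) = 2 * a.1 by ring]
      exact Even.neg_one_zpow (even_two_mul _)
    linear_combination (tm r x (2 * (a.1 + a.2)) * tm r y (2 * (a.1 - a.2))) * this
  · refine tsum_congr fun a => ?_
    rw [← tm_key hr hx hy (2 * (a.1 + a.2 + 1)) (2 * (a.1 - a.2)) _ _ (by ring) (by ring)]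
    have : ((-1 : ℂ) ^ (a.1 + a.2 + 1)) * (-1) ^ (a.1 - a.2) = -1 := by
      rw [← zpow_add₀ (by norm_num), show a.1 + a.2 + 1 + (a.1 - a.2) = 2 * a.1 + 1 by ring]
      exact Odd.neg_one_zpow (odd_two_mul_add_one _)
    linear_combination (tm r x (2 * (a.1 + a.2 + 1)) * tm r y (2 * (a.1 - a.2))) * this

theorem P22 (hr : r ≠ 0) (hr1 : ‖r‖ < 1) (hx : x ≠ 0) (hy : y ≠ 0) :
    tO r x * tO r y = tO (r ^ 2) (x * y) * tE (r ^ 2) (x / y) + tE (r ^ 2) (x * y) * tO (r ^ 2) (x / y) := by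
  have hr2 : r ^ 2 ≠ 0 := pow_ne_zero _ hr
  have hr21 := r2_lt hr1
  have hxy := mul_ne_zero hx hy
  have hxy' := div_ne_zero hx hy
  unfold tE tO
  rw [tsum_mul_tsum_of_summable_norm (tmO_summable_norm hr hr1 hx) (tmO_summable_norm hr hr1 hy),
    tsum_mul_tsum_of_summable_norm (tmO_summable_norm hr2 hr21 hxy) (tmE_summable_norm hr2 hr21 hxy'),
    tsum_mul_tsum_of_summable_norm (tmE_summable_norm hr2 hr21 hxy) (tmO_summable_norm hr2 hr21 hxy'),
    tsum_par _ (summable_mul_of_summable_norm (tmO_summable_norm hr hr1 hx) (tmO_summable_norm hr hr1 hy))]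
  congr 1
  · exact tsum_congr fun a => tm_key hr hx hy _ _ _ _ (by ring) (by ring)
  · rw [← (Equiv.addRight ((-1 : ℤ), (0:ℤ))).tsum_eq]
    refine tsum_congr fun a => tm_key hr hx hy _ _ _ _ ?_ ?_
    · simp; ring
    · simp; ring
end

theorem tm_inv (r x : ℂ) (m : ℤ) : tm r x⁻¹ m = tm r x (-m) := by
  unfold tm; rw [inv_zpow, zpow_neg, neg_sq]

theorem tE_inv (r x : ℂ) : tE r x⁻¹ = tE r x := by
  unfold tE
  rw [← (Equiv.neg ℤ).tsum_eq]
  exact tsum_congr fun a => by rw [tm_inv]; congr 1; simp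

theorem tF_inv (r x : ℂ) : tF r x⁻¹ = tF r x := by
  unfold tF
  rw [← (Equiv.neg ℤ).tsum_eq]
  refine tsum_congr fun a => ?_
  rw [tm_inv]; congr 1
  · simp only [Equiv.neg_apply, zpow_neg]; rw [← inv_zpow]; norm_num
  · congr 1; simp

theorem tO_inv (r x : ℂ) : tO r x⁻¹ = tO r x := by
  unfold tO
  rw [← (Equiv.subLeft (-1 : ℤ)).tsum_eq]
  refine tsum_congr fun a => ?_
  rw [tm_inv]; congr 1; simp; ring
end

section
open Filter Topology

theorem lambert_conv (q X : ℂ) (hq : q ≠ 0) (hq1 : ‖q‖ < 1) (hX : X ≠ 0) (hX1 : ‖X‖ = 1)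
    (g : ℤ → ℂ) (hgs : Summable fun n => ‖g n‖) (ε C : ℂ) (δ : ℤ) (hε : ε ≠ 0)
    (hg : ∀ n, g n * (1 + ε * q ^ (2 * n + δ)) = C * q ^ n) :
    (∑' n : ℤ, q ^ (n ^ 2) * X ^ n) * (∑' n : ℤ, (-1) ^ n * g n * X ^ n)
      = (∑' n : ℤ, (-1) ^ n * q ^ (n ^ 2) * g n) *
        ∑' N : ℤ, (-ε) ^ N * q ^ (N ^ 2 + δ * N) * X ^ N := by
  have hs1 : ∀ Y : ℂ, Y ≠ 0 → Summable fun n : ℤ => ‖q ^ (n ^ 2) * Y ^ n‖ := fun Y hY =>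
    summable_theta_norm q Y hq hq1 hY
  have hs2 : Summable fun n : ℤ => ‖(-1) ^ n * g n * X ^ n‖ := by
    refine hgs.congr fun n => ?_
    rw [norm_mul, norm_mul, norm_zpow, norm_zpow, hX1]; simp
  set b : ℤ → ℂ := fun N => ∑' n : ℤ, (-1) ^ n * q ^ ((N - n) ^ 2) * g n with hb
  have hbs : ∀ N, Summable fun n : ℤ => (-1) ^ n * q ^ ((N - n) ^ 2) * g n := by
    intro N
    refine Summable.of_norm_bounded hgs fun n => ?_
    rw [norm_mul, norm_mul, norm_zpow, norm_zpow]
    simp only [norm_neg, norm_one, one_zpow, one_mul]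
    refine mul_le_of_le_one_left (norm_nonneg _) ?_
    obtain ⟨k, hk⟩ := Int.eq_ofNat_of_zero_le (sq_nonneg (N - n))
    rw [hk]
    simpa using pow_le_one₀ (norm_nonneg _) hq1.le
  have hrec : ∀ N, b (N + 1) = -ε * q ^ (2 * N + 1 + δ) * b N := by
    intro N
    have h0 : b (N + 1) + ε * q ^ (2 * N + 1 + δ) * b N
        = ∑' n : ℤ, C * ((-1) ^ n * q ^ ((N - n) ^ 2 + 2 * N + 1 - n)) := by
      simp only [hb]
      rw [← tsum_mul_left, ← ((hbs _).tsum_add ((hbs N).mul_left _))]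
      refine tsum_congr fun n => ?_
      have e1 : q ^ ((N + 1 - n) ^ 2) = q ^ ((N - n) ^ 2 + 2 * N + 1 - n) * q ^ (-n) := by
        rw [← zpow_add₀ hq]; congr 1; ring
      have e2 : q ^ (2 * N + 1 + δ) * q ^ ((N - n) ^ 2)
          = q ^ ((N - n) ^ 2 + 2 * N + 1 - n) * q ^ (-n) * q ^ (2 * n + δ) := by
        rw [← zpow_add₀ hq, ← zpow_add₀ hq, ← zpow_add₀ hq]; congr 1; ring
      have e3 : q ^ (-n) * q ^ n = 1 := by rw [← zpow_add₀ hq]; simp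
      have := hg n
      rw [e1]
      linear_combination ((-1) ^ n * g n * ε) * e2 + (-1) ^ n * q ^ ((N - n) ^ 2 + 2 * N + 1 - n) * q ^ (-n) * this + (-1) ^ n * q ^ ((N - n) ^ 2 + 2 * N + 1 - n) * C * e3
    have h1 : ∑' n : ℤ, C * ((-1) ^ n * q ^ ((N - n) ^ 2 + 2 * N + 1 - n)) = 0 := by
      have : ∑' n : ℤ, C * ((-1) ^ n * q ^ ((N - n) ^ 2 + 2 * N + 1 - n))
          = - ∑' n : ℤ, C * ((-1) ^ n * q ^ ((N - n) ^ 2 + 2 * N + 1 - n)) := by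
        rw [← tsum_neg]
        conv_lhs => rw [← (Equiv.subLeft (2 * N + 1)).tsum_eq]
        refine tsum_congr fun n => ?_
        simp only [Equiv.subLeft_apply]
        have e1 : (-1 : ℂ) ^ (2 * N + 1 - n) = -(-1) ^ n := by
          rw [zpow_sub₀ (by norm_num), Odd.neg_one_zpow (odd_two_mul_add_one N)]
          rcases Int.even_or_odd n with h | h
          · rw [h.neg_one_zpow]; norm_num
          · rw [h.neg_one_zpow]; norm_num
        rw [e1, show (N - (2 * N + 1 - n)) ^ 2 + 2 * N + 1 - (2 * N + 1 - n) = (N - n) ^ 2 + 2 * N + 1 - n by ring]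
        ring
      exact self_eq_neg.mp this
    linear_combination h0.trans h1
  have hform : ∀ N, b N = (-ε) ^ N * q ^ (N ^ 2 + δ * N) * b 0 := by
    have hne := neg_ne_zero.mpr hε
    have step : ∀ N : ℤ, (-ε) ^ (N + 1) * q ^ ((N + 1) ^ 2 + δ * (N + 1))
        = -ε * q ^ (2 * N + 1 + δ) * ((-ε) ^ N * q ^ (N ^ 2 + δ * N)) := by
      intro N
      rw [zpow_add_one₀ hne, show (N + 1) ^ 2 + δ * (N + 1) = (2 * N + 1 + δ) + (N ^ 2 + δ * N) by ring,
        zpow_add₀ hq]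
      ring
    intro N
    induction N using Int.induction_on with
    | zero => simp
    | succ i ih => rw [hrec, ih, step]; ring
    | pred i ih =>
      have h1 := hrec (-(i : ℤ) - 1)
      have h2 := step (-(i : ℤ) - 1)
      rw [sub_add_cancel] at h1 h2
      have hc : -ε * q ^ (2 * (-(i : ℤ) - 1) + 1 + δ) ≠ 0 := mul_ne_zero hne (zpow_ne_zero _ hq)
      apply mul_left_cancel₀ hc
      rw [← h1, ih, h2]; ring
  rw [tsum_mul_tsum_of_summable_norm (hs1 X hX) hs2]
  have hps := summable_mul_of_summable_norm (hs1 X hX) hs2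
  let e : ℤ × ℤ ≃ ℤ × ℤ :=
    { toFun := fun a => (a.1 - a.2, a.2)
      invFun := fun a => (a.1 + a.2, a.2)
      left_inv := fun a => by simp
      right_inv := fun a => by simp }
  rw [← e.tsum_eq]
  have hps' := hps.comp_injective e.injective
  rw [Summable.tsum_prod (by exact hps')]
  rw [← tsum_mul_left]
  refine tsum_congr fun N => ?_
  have hb0 : b 0 = ∑' n : ℤ, (-1) ^ n * q ^ (n ^ 2) * g n := by
    simp only [hb]; refine tsum_congr fun n => ?_
    rw [zero_sub, neg_sq]
  rw [← hb0]
  have := hform N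
  calc _ = ∑' n : ℤ, ((-1) ^ n * q ^ ((N - n) ^ 2) * g n) * X ^ N := by
        refine tsum_congr fun n => ?_
        simp only [e, Equiv.coe_fn_mk]
        have : X ^ N = X ^ (N - n) * X ^ n := by rw [← zpow_add₀ hX]; congr 1; ring
        rw [this]; ring
    _ = b N * X ^ N := by rw [tsum_mul_right]
    _ = _ := by rw [this]; ring
end

section
open Filter Topology

noncomputable def th (q X : ℂ) : ℂ := ∑' n : ℤ, q ^ (n ^ 2) * X ^ n
noncomputable def g4 (q : ℂ) (n : ℤ) : ℂ := 2 * q ^ n / (1 + q ^ (2 * n))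
noncomputable def g2 (q : ℂ) (n : ℤ) : ℂ := q ^ n / (1 - q ^ (2 * n + 1))
noncomputable def L4 (q X : ℂ) : ℂ := ∑' n : ℤ, (-1) ^ n * g4 q n * X ^ n
noncomputable def L2 (q X : ℂ) : ℂ := ∑' n : ℤ, (-1) ^ n * g2 q n * X ^ n

theorem tE_th (r x : ℂ) : tE r x = th (r ^ 4) (x ^ 2) := by
  unfold tE th tm
  refine tsum_congr fun n => ?_
  rw [← zpow_natCast r 4, ← zpow_natCast x 2, ← zpow_mul, ← zpow_mul]
  congr 2; push_cast; ring

theorem tF_th (r x : ℂ) : tF r x = th (r ^ 4) (-x ^ 2) := by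
  unfold tF th tm
  refine tsum_congr fun n => ?_
  rw [neg_eq_neg_one_mul (x ^ 2), mul_zpow, ← zpow_natCast r 4, ← zpow_natCast x 2, ← zpow_mul, ← zpow_mul]
  rw [mul_left_comm]
  congr 3; push_cast; ring

theorem tO_th (r x : ℂ) (hr : r ≠ 0) (hx : x ≠ 0) : tO r x = r * x * th (r ^ 4) (r ^ 4 * x ^ 2) := by
  unfold tO th tm
  rw [← tsum_mul_left]
  refine tsum_congr fun n => ?_
  rw [mul_zpow, ← zpow_natCast r 4, ← zpow_natCast x 2, ← zpow_mul, ← zpow_mul, ← zpow_mul]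
  have e1 : r ^ ((2 * n + 1) ^ 2) = r * r ^ (((4 : ℕ) : ℤ) * n ^ 2) * r ^ (((4 : ℕ) : ℤ) * n) := by
    rw [← zpow_one_add₀ hr, ← zpow_add₀ hr]; congr 1; push_cast; ring
  have e2 : x ^ (2 * n + 1) = x * x ^ (((2 : ℕ) : ℤ) * n) := by
    rw [← zpow_one_add₀ hx]; congr 1; push_cast; ring
  rw [e1, e2]; ring

theorem tsum_near_one (f : ℤ → ℂ) (s C : ℝ) (hs : 0 ≤ s) (hs1 : s < 1) (h0 : f 0 = 1)
    (h : ∀ n : ℕ, ‖f (n + 1)‖ ≤ C * s ^ (n + 1)) (h' : ∀ n : ℕ, ‖f (-(n + 1))‖ ≤ C * s ^ (n + 1)) :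
    Summable (fun n => ‖f n‖) ∧ ‖∑' n, f n - 1‖ ≤ 2 * (C * s / (1 - s)) := by
  have hg : HasSum (fun n : ℕ => C * s ^ (n + 1)) (C * s / (1 - s)) := by
    have := (hasSum_geometric_of_lt_one hs hs1).mul_left (C * s)
    rw [← div_eq_mul_inv] at this
    have e : (fun n : ℕ => C * s ^ (n + 1)) = fun i : ℕ => C * s * s ^ i := by funext n; ring
    rw [e]; exact this
  have s1 : Summable (fun n : ℕ => ‖f ((n:ℤ) + 1)‖) :=
    Summable.of_nonneg_of_le (fun _ => norm_nonneg _) h hg.summable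
  have s2 : Summable (fun n : ℕ => ‖f (-((n:ℤ) + 1))‖) :=
    Summable.of_nonneg_of_le (fun _ => norm_nonneg _) h' hg.summable
  have s1' : Summable (fun n : ℕ => ‖f (n : ℤ)‖) :=
    (summable_nat_add_iff 1).mp (by simpa using s1)
  have ss : Summable (fun n => ‖f n‖) := Summable.of_nat_of_neg_add_one s1' s2
  refine ⟨ss, ?_⟩
  rw [tsum_of_nat_of_neg_add_one s1'.of_norm s2.of_norm, s1'.of_norm.tsum_eq_zero_add]
  have b1 : ‖∑' n : ℕ, f ((n:ℤ) + 1)‖ ≤ C * s / (1 - s) := tsum_of_norm_bounded hg h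
  have b2 : ‖∑' n : ℕ, f (-((n:ℤ) + 1))‖ ≤ C * s / (1 - s) := tsum_of_norm_bounded hg h'
  have : f ((0 : ℕ) : ℤ) + ∑' n : ℕ, f (((n + 1 : ℕ) : ℤ)) + ∑' n : ℕ, f (-((n:ℤ) + 1)) - 1
      = ∑' n : ℕ, f ((n:ℤ) + 1) + ∑' n : ℕ, f (-((n:ℤ) + 1)) := by
    push_cast
    rw [h0]; ring
  rw [this]
  exact (norm_add_le _ _).trans (by linarith)

theorem th_near (q X : ℂ) (hq1 : ‖q‖ < 1) (hX1 : ‖X‖ = 1) :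
    ‖th q X - 1‖ ≤ 2 * (1 * ‖q‖ / (1 - ‖q‖)) := by
  have key : ∀ n : ℕ, ‖q‖ ^ (n + 1) ^ 2 ≤ ‖q‖ ^ (n + 1) := fun n =>
    pow_le_pow_of_le_one (norm_nonneg _) hq1.le (by nlinarith)
  refine (tsum_near_one _ ‖q‖ 1 (norm_nonneg _) hq1 (by simp) (fun n => ?_) (fun n => ?_)).2
  · rw [norm_mul, norm_zpow, norm_zpow, hX1, one_zpow, mul_one, one_mul]
    exact_mod_cast key n
  · rw [norm_mul, norm_zpow, norm_zpow, hX1, one_zpow, mul_one, one_mul, neg_sq]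
    exact_mod_cast key n

theorem th_ne (q X : ℂ) (hq1 : ‖q‖ ≤ 1 / 8) (hX1 : ‖X‖ = 1) : th q X ≠ 0 := by
  intro h
  have := th_near q X (by linarith) hX1
  rw [h] at this
  norm_num at this
  have h2 : ‖q‖ / (1 - ‖q‖) ≤ 1 / 7 := by
    rw [div_le_iff₀ (by linarith)]; linarith
  linarith

theorem pow_lt (q : ℂ) (hq1 : ‖q‖ < 1) (k : ℕ) (hk : k ≠ 0) : ‖q ^ k‖ ≤ ‖q‖ := by
  rw [norm_pow]; exact pow_le_of_le_one (norm_nonneg _) hq1.le hk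

theorem one_add_norm (q : ℂ) (hq1 : ‖q‖ < 1) (k : ℕ) : 1 - ‖q‖ ≤ ‖1 + q ^ (2 * k)‖ := by
  rcases Nat.eq_zero_or_pos k with rfl | hk
  · norm_num; linarith [norm_nonneg q]
  · have := pow_lt q hq1 (2 * k) (by omega)
    have h2 := norm_sub_norm_le (1 : ℂ) (-(q ^ (2 * k)))
    rw [norm_neg, norm_one, sub_neg_eq_add] at h2
    linarith

theorem one_sub_norm (q : ℂ) (hq1 : ‖q‖ < 1) (k : ℕ) : 1 - ‖q‖ ≤ ‖1 - q ^ (2 * k + 1)‖ := by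
  have := pow_lt q hq1 (2 * k + 1) (by omega)
  have h2 := norm_sub_norm_le (1 : ℂ) ((q ^ (2 * k + 1)))
  rw [norm_one] at h2
  linarith

theorem g4_neg (q : ℂ) (hq : q ≠ 0) (n : ℤ) : g4 q (-n) = g4 q n := by
  unfold g4
  rw [mul_neg, zpow_neg, zpow_neg, two_mul n, zpow_add₀ hq]
  have := zpow_ne_zero n hq
  generalize q ^ n = x at *
  by_cases h : 1 + x * x = 0
  · have h' : 1 + (x * x)⁻¹ = 0 := by
      field_simp; linear_combination h
    rw [h, h']; simp
  · have h' : 1 + (x * x)⁻¹ ≠ 0 := by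
      intro h2; apply h; field_simp at h2; linear_combination h2
    field_simp
    have h3 : x ^ 2 + 1 ≠ 0 := fun h4 => h (by linear_combination h4)
    have h5 : 1 + x ^ 2 ≠ 0 := fun h4 => h (by linear_combination h4)
    field_simp
    ring

theorem g4_nat (q : ℂ) (hq1 : ‖q‖ < 1) (n : ℕ) : ‖g4 q n‖ ≤ 2 / (1 - ‖q‖) * ‖q‖ ^ n := by
  have h0 : 0 < 1 - ‖q‖ := by linarith
  unfold g4
  have := one_add_norm q hq1 n
  rw [show ((2 : ℤ) * (n : ℤ)) = ((2 * n : ℕ) : ℤ) by push_cast; ring, zpow_natCast, zpow_natCast,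
    norm_div, norm_mul, norm_pow, Complex.norm_ofNat]
  rw [div_mul_eq_mul_div]
  exact div_le_div_of_nonneg_left (by positivity) h0 this

theorem g4_zero (q : ℂ) : g4 q 0 = 1 := by unfold g4; norm_num

theorem g4_near (q : ℂ) (hq : q ≠ 0) (hq1 : ‖q‖ < 1) (X : ℂ) (hX1 : ‖X‖ = 1) :
    Summable (fun n : ℤ => ‖(-1) ^ n * g4 q n * X ^ n‖) ∧ 
    ‖L4 q X - 1‖ ≤ 2 * (2 / (1 - ‖q‖) * ‖q‖ / (1 - ‖q‖)) := by
  refine tsum_near_one _ ‖q‖ (2 / (1 - ‖q‖)) (norm_nonneg _) hq1 (by simp [g4_zero]) (fun n => ?_) (fun n => ?_)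
  · rw [norm_mul, norm_mul, norm_zpow, norm_zpow, hX1, one_zpow, mul_one]
    simp only [norm_neg, norm_one, one_zpow, one_mul]
    exact_mod_cast g4_nat q hq1 (n + 1)
  · rw [norm_mul, norm_mul, norm_zpow, norm_zpow, hX1, one_zpow, mul_one]
    simp only [norm_neg, norm_one, one_zpow, one_mul]
    rw [g4_neg q hq]
    exact_mod_cast g4_nat q hq1 (n + 1)

theorem g4_summable (q : ℂ) (hq : q ≠ 0) (hq1 : ‖q‖ < 1) : Summable (fun n : ℤ => ‖g4 q n‖) := by
  refine (g4_near q hq hq1 1 (by simp)).1.congr fun n => ?_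
  rw [norm_mul, norm_mul, norm_zpow]; simp

theorem zpow_norm_ne_one (q : ℂ) (hq : q ≠ 0) (hq1 : ‖q‖ < 1) (n : ℤ) (hn : n ≠ 0) : ‖q ^ n‖ ≠ 1 := by
  rw [norm_zpow]
  exact fun h => hn ((zpow_eq_one_iff_right₀ (norm_nonneg q) hq1.ne).mp h)

theorem g4_rel (q : ℂ) (hq : q ≠ 0) (hq1 : ‖q‖ < 1) (n : ℤ) :
    g4 q n * (1 + 1 * q ^ (2 * n + 0)) = 2 * q ^ n := by
  unfold g4
  have : 1 + q ^ (2 * n) ≠ 0 := by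
    by_cases hn : n = 0
    · subst hn; norm_num
    · intro h
      apply zpow_norm_ne_one q hq hq1 (2 * n) (by omega)
      rw [show q ^ (2 * n) = -1 by linear_combination h]; simp
  rw [add_zero, one_mul, div_mul_cancel₀ _ this]

theorem g2_rel (q : ℂ) (hq : q ≠ 0) (hq1 : ‖q‖ < 1) (n : ℤ) :
    g2 q n * (1 + (-1) * q ^ (2 * n + 1)) = 1 * q ^ n := by
  unfold g2
  have : 1 - q ^ (2 * n + 1) ≠ 0 := by
    intro h
    apply zpow_norm_ne_one q hq hq1 (2 * n + 1) (by omega)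
    rw [show q ^ (2 * n + 1) = 1 by linear_combination -h]; simp
  rw [neg_one_mul, ← sub_eq_add_neg, div_mul_cancel₀ _ this, one_mul]

theorem g2_neg (q : ℂ) (hq : q ≠ 0) (hq1 : ‖q‖ < 1) (n : ℤ) : g2 q (-(n + 1)) = - g2 q n := by
  have h1 := g2_rel q hq hq1 n
  have h2 := g2_rel q hq hq1 (-(n + 1))
  have hx := zpow_ne_zero n hq
  have hy := zpow_ne_zero (2 * n + 1) hq
  have e1 : q ^ (2 * -(n + 1) + 1) = (q ^ (2 * n + 1))⁻¹ := by rw [← zpow_neg]; congr 1; ring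
  have e2 : q ^ (-(n + 1)) = q ^ n * (q ^ (2 * n + 1))⁻¹ := by
    rw [← zpow_neg, ← zpow_add₀ hq]; congr 1; ring
  have : 1 - q ^ (2 * n + 1) ≠ 0 := by
    intro h
    apply zpow_norm_ne_one q hq hq1 (2 * n + 1) (by omega)
    rw [show q ^ (2 * n + 1) = 1 by linear_combination -h]; simp
  rw [e1, e2] at h2
  field_simp at h2
  apply mul_right_cancel₀ this
  linear_combination -h2 + h1

theorem g2_nat (q : ℂ) (hq1 : ‖q‖ < 1) (n : ℕ) : ‖g2 q n‖ ≤ 1 / (1 - ‖q‖) * ‖q‖ ^ n := by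
  have h0 : 0 < 1 - ‖q‖ := by linarith
  unfold g2
  have := one_sub_norm q hq1 n
  rw [show ((2 : ℤ) * (n : ℤ) + 1) = ((2 * n + 1 : ℕ) : ℤ) by push_cast; ring, zpow_natCast, zpow_natCast,
    norm_div, norm_pow]
  rw [div_mul_eq_mul_div, one_mul]
  exact div_le_div_of_nonneg_left (by positivity) h0 this

theorem g2_summable (q : ℂ) (hq : q ≠ 0) (hq1 : ‖q‖ < 1) : Summable (fun n : ℤ => ‖g2 q n‖) := by
  have h : Summable (fun n : ℕ => ‖g2 q n‖) := by
    refine Summable.of_nonneg_of_le (fun _ => norm_nonneg _) (g2_nat q hq1) ?_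
    exact (summable_geometric_of_lt_one (norm_nonneg _) hq1).mul_left _
  refine Summable.of_nat_of_neg_add_one h (h.congr fun n => ?_)
  rw [g2_neg q hq hq1, norm_neg]

theorem L4_main (q : ℂ) (hq : q ≠ 0) (hq1 : ‖q‖ < 1) : ∃ K : ℂ, ∀ X : ℂ, ‖X‖ = 1 →
    th q X * L4 q X = K * th q (-X) := by
  refine ⟨∑' n : ℤ, (-1) ^ n * q ^ (n ^ 2) * g4 q n, fun X hX => ?_⟩
  have hX0 : X ≠ 0 := by rintro rfl; simp at hX
  have h := lambert_conv q X hq hq1 hX0 hX (g4 q) (g4_summable q hq hq1) 1 2 0 one_ne_zero (g4_rel q hq hq1)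
  unfold th L4
  rw [h]
  congr 1
  refine tsum_congr fun n => ?_
  rw [neg_eq_neg_one_mul X, mul_zpow, zero_mul, add_zero]; ring

theorem L2_main (q : ℂ) (hq : q ≠ 0) (hq1 : ‖q‖ < 1) : ∃ K : ℂ, ∀ X : ℂ, ‖X‖ = 1 →
    th q X * L2 q X = K * th q (q * X) := by
  refine ⟨∑' n : ℤ, (-1) ^ n * q ^ (n ^ 2) * g2 q n, fun X hX => ?_⟩
  have hX0 : X ≠ 0 := by rintro rfl; simp at hX
  have h := lambert_conv q X hq hq1 hX0 hX (g2 q) (g2_summable q hq hq1) (-1) 1 1 (by norm_num) (g2_rel q hq hq1)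
  unfold th L2
  rw [h]
  congr 1
  refine tsum_congr fun n => ?_
  rw [mul_zpow, neg_neg, one_zpow, one_mul, one_mul, zpow_add₀ hq]; ring
end

section
open Filter Topology

noncomputable def gV (q : ℂ) (n : ℤ) : ℂ := q ^ n / (1 + q ^ (2 * n + 1))

theorem neg_one_sq_zpow (n : ℤ) : ((-1 : ℂ) ^ n) * (-1) ^ n = 1 := by
  rw [← mul_zpow]; norm_num

theorem g4_even (t : ℂ) (n : ℤ) : g4 t (2 * n) = g4 (t ^ 2) n := by
  unfold g4
  rw [← zpow_natCast t 2, ← zpow_mul, ← zpow_mul]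
  push_cast; congr 3

theorem g4_odd (t : ℂ) (ht : t ≠ 0) (n : ℤ) : g4 t (2 * n + 1) = 2 * t * gV (t ^ 2) n := by
  unfold g4 gV
  rw [← zpow_natCast t 2, ← zpow_mul, ← zpow_mul, zpow_add_one₀ ht]
  push_cast; ring

theorem L4_split (t : ℂ) (ht : t ≠ 0) (ht1 : ‖t‖ < 1) :
    L4 t (-1) = L4 (t ^ 2) (-1) + 2 * t * ∑' n, gV (t ^ 2) n ∧
    L4 t 1 = L4 (t ^ 2) (-1) - 2 * t * ∑' n, gV (t ^ 2) n := by
  have hs := (g4_summable t ht ht1)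
  have e : ∀ q, L4 q (-1) = ∑' n, g4 q n := fun q => by
    unfold L4
    refine tsum_congr fun n => ?_
    linear_combination g4 q n * neg_one_sq_zpow n
  constructor
  · rw [e, e, tsum_int_split _ hs.of_norm, ← tsum_mul_left]
    congr 1
    · exact tsum_congr fun n => g4_even t n
    · exact tsum_congr fun n => g4_odd t ht n
  · rw [e]
    unfold L4
    have hs' : Summable (fun n : ℤ => (-1) ^ n * g4 t n * 1 ^ n) := (g4_near t ht ht1 1 (by simp)).1.of_norm
    rw [tsum_int_split _ hs', sub_eq_add_neg, ← tsum_mul_left, ← tsum_neg]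
    congr 1
    · refine tsum_congr fun n => ?_
      rw [← g4_even, Even.neg_one_zpow (even_two_mul n)]; simp
    · refine tsum_congr fun n => ?_
      rw [← g4_odd _ ht, Odd.neg_one_zpow (odd_two_mul_add_one n)]; simp

theorem landen (ρ : ℂ) (h : ρ ≠ 0) (h1 : ‖ρ‖ < 1) :
    th (ρ ^ 4) 1 ^ 2 + th (ρ ^ 4) (-1) ^ 2 = 2 * th (ρ ^ 8) 1 ^ 2 ∧
    th (ρ ^ 4) 1 ^ 2 - th (ρ ^ 4) (-1) ^ 2 = 2 * (ρ ^ 4 * th (ρ ^ 8) (ρ ^ 8) ^ 2) := by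
  have a := P33 (x := 1) (y := 1) h h1 one_ne_zero one_ne_zero
  have b := P44 (x := 1) (y := 1) h h1 one_ne_zero one_ne_zero
  have h2 : ρ ^ 2 ≠ 0 := pow_ne_zero _ h
  simp only [tE_th, tF_th, tO_th (ρ ^ 2) _ h2 one_ne_zero, one_pow, mul_one, div_one, ← pow_mul] at a b
  norm_num at a b
  constructor
  · linear_combination a + b
  · linear_combination a - b

theorem pow_seq_tendsto (ρ : ℂ) (h1 : ‖ρ‖ < 1) : Tendsto (fun n : ℕ => ‖(ρ ^ (2 ^ n)) ^ 4‖) atTop (𝓝 0) := by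
  have : Tendsto (fun n : ℕ => ‖ρ‖ ^ n) atTop (𝓝 0) :=
    tendsto_pow_atTop_nhds_zero_of_lt_one (norm_nonneg _) h1
  refine squeeze_zero (fun _ => norm_nonneg _) (fun n => ?_) this
  rw [← pow_mul, norm_pow]
  refine pow_le_pow_of_le_one (norm_nonneg _) h1.le ?_
  have : n < 2 ^ n := Nat.lt_two_pow_self
  omega

theorem L4_const (ρ : ℂ) (h : ρ ≠ 0) (h1 : ‖ρ‖ ^ 4 ≤ 1 / 8) : L4 (ρ ^ 4) (-1) = th (ρ ^ 4) 1 ^ 2 ∧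
    L4 (ρ ^ 4) 1 = th (ρ ^ 4) (-1) ^ 2 := by
  have one_n : ‖(1 : ℂ)‖ = 1 := by simp
  have mone_n : ‖(-1 : ℂ)‖ = 1 := by simp
  have small : ∀ ρ : ℂ, ‖ρ‖ ^ 4 ≤ 1 / 8 → ‖ρ‖ < 1 := by
    intro ρ h
    by_contra hc
    have : 1 ≤ ‖ρ‖ ^ 4 := one_le_pow₀ (not_lt.mp hc)
    linarith
  have stepA : ∀ ρ : ℂ, ρ ≠ 0 → ‖ρ‖ ^ 4 ≤ 1 / 8 → 
      L4 (ρ ^ 4) 1 * th (ρ ^ 4) 1 ^ 2 = L4 (ρ ^ 4) (-1) * th (ρ ^ 4) (-1) ^ 2 := by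
    intro ρ h h1
    have hq : ρ ^ 4 ≠ 0 := pow_ne_zero _ h
    have hq8 : ‖ρ ^ 4‖ ≤ 1 / 8 := by rw [norm_pow]; exact h1
    obtain ⟨K, hK⟩ := L4_main (ρ ^ 4) hq (by linarith)
    have k1 := hK 1 one_n
    have k2 := hK (-1) mone_n
    rw [neg_neg] at k2
    linear_combination th (ρ ^ 4) 1 * k1 - th (ρ ^ 4) (-1) * k2
  have stepB : ∀ ρ : ℂ, ρ ≠ 0 → ‖ρ‖ ^ 4 ≤ 1 / 8 → 
      L4 (ρ ^ 4) (-1) / th (ρ ^ 4) 1 ^ 2 = L4 ((ρ ^ 2) ^ 4) (-1) / th ((ρ ^ 2) ^ 4) 1 ^ 2 := by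
    intro ρ h h1
    have hq : ρ ^ 4 ≠ 0 := pow_ne_zero _ h
    have hq8 : ‖ρ ^ 4‖ ≤ 1 / 8 := by rw [norm_pow]; exact h1
    have hq8' : ‖(ρ ^ 2) ^ 4‖ ≤ 1 / 8 := by
      rw [← pow_mul, show 2 * 4 = 4 * 2 by norm_num, pow_mul, norm_pow]; nlinarith [norm_nonneg (ρ ^ 4)]
    have n1 := th_ne _ 1 hq8 one_n
    have n2 := th_ne _ 1 hq8' one_n
    have n3 := th_ne _ 1 hq8' one_n
    have hs := L4_split (ρ ^ 4) hq (by linarith)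
    have hl := (landen ρ h (small ρ h1)).1
    have hA := stepA ρ h h1
    have e8 : (ρ ^ 4) ^ 2 = (ρ ^ 2) ^ 4 := by ring
    have e8' : ρ ^ 8 = (ρ ^ 2) ^ 4 := by ring
    rw [e8] at hs
    rw [e8'] at hl
    rw [div_eq_div_iff (pow_ne_zero 2 n1) (pow_ne_zero 2 n2)]
    linear_combination (-1/2) * L4 (ρ ^ 4) (-1) * hl - (1/2) * hA + (1/2) * th (ρ ^ 4) 1 ^ 2 * (hs.1 + hs.2)
  have hD : L4 (ρ ^ 4) (-1) / th (ρ ^ 4) 1 ^ 2 = 1 := by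
    have hit : ∀ n : ℕ, L4 ((ρ ^ (2 ^ n)) ^ 4) (-1) / th ((ρ ^ (2 ^ n)) ^ 4) 1 ^ 2
        = L4 (ρ ^ 4) (-1) / th (ρ ^ 4) 1 ^ 2 := by
      intro n
      induction n with
      | zero => simp
      | succ n ih =>
        rw [← ih, stepB (ρ ^ (2 ^ n)) (pow_ne_zero _ h) ?_, show ρ ^ (2 ^ (n + 1)) = (ρ ^ (2 ^ n)) ^ 2 by rw [← pow_mul, pow_succ]]
        rw [norm_pow]
        refine le_trans ?_ h1
        refine pow_le_pow_left₀ (by positivity) ?_ 4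
        exact pow_le_of_le_one (norm_nonneg _) (small ρ h1).le (by positivity)
    have hz := pow_seq_tendsto ρ (small ρ h1)
    have hs1 : ∀ n : ℕ, ‖(ρ ^ (2 ^ n)) ^ 4‖ < 1 := by
      intro n
      rw [← pow_mul, norm_pow]
      exact pow_lt_one₀ (norm_nonneg _) (small ρ h1) (by positivity)
    have hs0 : ∀ n : ℕ, (ρ ^ (2 ^ n)) ^ 4 ≠ 0 := fun n => pow_ne_zero _ (pow_ne_zero _ h)
    obtain ⟨s, hsdef⟩ : ∃ s : ℕ → ℂ, ∀ n, (ρ ^ (2 ^ n)) ^ 4 = s n := ⟨_, fun n => rfl⟩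
    simp only [hsdef] at hs1 hz hit hs0
    have hden : Tendsto (fun n => 1 - ‖s n‖) atTop (𝓝 1) := by
      have := hz.const_sub 1
      rwa [sub_zero] at this
    have t1 : Tendsto (fun n => th (s n) 1) atTop (𝓝 1) := by
      rw [tendsto_iff_norm_sub_tendsto_zero]
      refine squeeze_zero (fun _ => norm_nonneg _) (fun n => th_near (s n) 1 (hs1 n) one_n) ?_
      have := (((hz.const_mul 1).div hden one_ne_zero).const_mul 2)
      norm_num at this ⊢
      exact this
    have t2 : Tendsto (fun n => L4 (s n) (-1)) atTop (𝓝 1) := by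
      rw [tendsto_iff_norm_sub_tendsto_zero]
      refine squeeze_zero (fun _ => norm_nonneg _) (fun n => (g4_near (s n) (hs0 n) (hs1 n) (-1) mone_n).2) ?_
      have := (((((tendsto_const_nhds (x := (2 : ℝ))).div hden one_ne_zero).mul hz).div hden one_ne_zero).const_mul 2)
      norm_num at this ⊢
      exact this
    have t3 := t2.div (t1.pow 2) (by norm_num)
    have t4 : Tendsto (fun _ : ℕ => L4 (ρ ^ 4) (-1) / th (ρ ^ 4) 1 ^ 2) atTop (𝓝 (1 / 1 ^ 2)) :=
      t3.congr hit
    have := tendsto_nhds_unique t4 tendsto_const_nhds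
    rw [← this]; norm_num
  have hq8 : ‖ρ ^ 4‖ ≤ 1 / 8 := by rw [norm_pow]; exact h1
  have n1 := th_ne _ 1 hq8 one_n
  have r1 : L4 (ρ ^ 4) (-1) = th (ρ ^ 4) 1 ^ 2 := by
    rwa [div_eq_one_iff_eq (pow_ne_zero 2 n1)] at hD
  refine ⟨r1, ?_⟩
  have hA := stepA ρ h h1
  rw [r1] at hA
  exact mul_right_cancel₀ (pow_ne_zero 2 n1) (by linear_combination hA)

theorem V_const (ρ : ℂ) (h : ρ ≠ 0) (h1 : ‖ρ‖ ^ 4 ≤ 1 / 8) :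
    ∑' n, gV (ρ ^ 8) n = th (ρ ^ 8) (ρ ^ 8) ^ 2 / 2 := by
  have small : ‖ρ‖ < 1 := by
    by_contra hc
    have : 1 ≤ ‖ρ‖ ^ 4 := one_le_pow₀ (not_lt.mp hc)
    linarith
  have hq : ρ ^ 4 ≠ 0 := pow_ne_zero _ h
  have hq8 : ‖ρ ^ 4‖ ≤ 1 / 8 := by rw [norm_pow]; exact h1
  have hs := L4_split (ρ ^ 4) hq (by linarith)
  have hl := (landen ρ h small).2
  have hc := L4_const ρ h h1
  rw [show (ρ ^ 4) ^ 2 = ρ ^ 8 by ring, hc.1, hc.2] at hs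
  apply mul_left_cancel₀ hq
  linear_combination (1/4) * hs.2 - (1/4) * hs.1 + (1/4) * hl

theorem L2_V (q : ℂ) (hq : q ≠ 0) (hq1 : ‖q‖ < 1) : L2 q 1 = ∑' n, gV q n := by
  have h0 : 0 < 1 - ‖q‖ := by linarith
  -- double sum
  have hpow : ∀ n : ℕ, ‖q ^ (2 * n + 1)‖ < 1 := fun n => by
    rw [norm_pow]; exact pow_lt_one₀ (norm_nonneg _) hq1 (by omega)
  let f : ℕ → ℕ → ℂ := fun n j => (-1) ^ n * q ^ (n + j * (2 * n + 1))
  have hf1 : ∀ n : ℕ, HasSum (fun j => f n j) ((-1) ^ n * g2 q n) := by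
    intro n
    have := (hasSum_geometric_of_norm_lt_one (hpow n)).mul_left ((-1) ^ n * q ^ n)
    have e : (-1 : ℂ) ^ n * q ^ n * (1 - q ^ (2 * n + 1))⁻¹ = (-1) ^ n * g2 q n := by
      unfold g2
      rw [show ((2 : ℤ) * (n : ℤ) + 1) = ((2 * n + 1 : ℕ) : ℤ) by push_cast; ring, zpow_natCast, zpow_natCast]
      ring
    rw [e] at this
    have e' : (fun j => f n j) = fun i => (-1) ^ n * q ^ n * (q ^ (2 * n + 1)) ^ i := by
      funext j; simp only [f]; ring
    rw [e']; exact this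
  have hf2 : ∀ j : ℕ, HasSum (fun n => f n j) (gV q j) := by
    intro j
    have hj : ‖-q ^ (2 * j + 1)‖ < 1 := by rw [norm_neg]; exact hpow j
    have := (hasSum_geometric_of_norm_lt_one hj).mul_left (q ^ j)
    have e : q ^ j * (1 - -q ^ (2 * j + 1))⁻¹ = gV q j := by
      unfold gV
      rw [show ((2 : ℤ) * (j : ℤ) + 1) = ((2 * j + 1 : ℕ) : ℤ) by push_cast; ring, zpow_natCast, zpow_natCast]
      ring
    rw [e] at this
    have e' : (fun n => f n j) = fun i => q ^ j * (-q ^ (2 * j + 1)) ^ i := by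
      funext n; simp only [f]; rw [neg_pow (q ^ (2 * j + 1))]; ring
    rw [e']; exact this
  have hfs : Summable (Function.uncurry f) := by
    have hg := summable_geometric_of_lt_one (norm_nonneg q) hq1
    refine Summable.of_norm_bounded (hg.mul_of_nonneg hg (fun _ => by positivity) (fun _ => by positivity)) ?_
    rintro ⟨n, j⟩
    simp only [Function.uncurry, f]
    rw [norm_mul, norm_pow, norm_pow, norm_neg, norm_one, one_pow, one_mul, ← pow_add]
    exact pow_le_pow_of_le_one (norm_nonneg _) hq1.le (by nlinarith [Nat.zero_le (j * n)])
  have hcomm : ∑' n : ℕ, (-1) ^ n * g2 q n = ∑' j : ℕ, gV q j := by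
    rw [← tsum_congr fun n => (hf1 n).tsum_eq, ← tsum_congr fun n => (hf2 n).tsum_eq]
    exact hfs.tsum_comm.symm
  have s1 : Summable (fun n : ℕ => (-1) ^ n * g2 q n) := by
    refine Summable.of_norm ?_
    refine ((g2_summable q hq hq1).comp_injective Nat.cast_injective).congr fun n => ?_
    simp
  have s2 : Summable (fun n : ℕ => gV q n) := by
    have := hfs.prod_symm.prod
    refine this.congr fun n => ?_
    exact (hf2 n).tsum_eq
  have gVneg : ∀ n : ℕ, gV q (-((n : ℤ) + 1)) = gV q n := by
    intro n
    have hy := zpow_ne_zero (2 * (n : ℤ) + 1) hq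
    have e1 : q ^ (2 * -((n : ℤ) + 1) + 1) = (q ^ (2 * (n : ℤ) + 1))⁻¹ := by rw [← zpow_neg]; congr 1
    have e2 : q ^ (-((n : ℤ) + 1)) = q ^ (n : ℤ) * (q ^ (2 * (n : ℤ) + 1))⁻¹ := by
      rw [← zpow_neg, ← zpow_add₀ hq]; congr 1; ring
    unfold gV
    rw [e1, e2]
    generalize q ^ (2 * (n : ℤ) + 1) = y at *
    rw [show 1 + y⁻¹ = (1 + y) * y⁻¹ by field_simp; ring, mul_div_mul_right _ _ (inv_ne_zero hy)]
  have L : L2 q 1 = ∑' n : ℤ, (-1) ^ n * g2 q n := by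
    unfold L2; simp
  rw [L, tsum_of_nat_of_neg_add_one (f := fun n : ℤ => (-1) ^ n * g2 q n) (by simpa using s1) ?_,
    tsum_of_nat_of_neg_add_one (f := fun n : ℤ => gV q n) s2 (by simpa only [gVneg] using s2)]
  · simp only [gVneg, ← hcomm]
    congr 1
    refine tsum_congr fun n => ?_
    rw [g2_neg q hq hq1, zpow_neg, zpow_add_one₀ (by norm_num), zpow_natCast]
    rcases Nat.even_or_odd n with h | h
    · simp [h.neg_one_pow]
    · simp [h.neg_one_pow]
  · refine s1.congr fun n => ?_
    rw [g2_neg q hq hq1, zpow_neg, zpow_add_one₀ (by norm_num), zpow_natCast]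
    rcases Nat.even_or_odd n with h | h
    · simp [h.neg_one_pow]
    · simp [h.neg_one_pow]
end

section
open Filter Topology

theorem root_sum (ζ : ℂ) (hζ : IsPrimitiveRoot ζ 7) (n : ℤ) :
    ∑ k ∈ Finset.range 7, (ζ ^ k) ^ n = if (7 : ℤ) ∣ n then 7 else 0 := by
  have h0 : ζ ≠ 0 := hζ.ne_zero (by norm_num)
  have e : ∀ k : ℕ, (ζ ^ k) ^ n = (ζ ^ n) ^ k := fun k => by
    rw [← zpow_natCast, ← zpow_natCast, ← zpow_mul, ← zpow_mul, mul_comm]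
  simp only [e]
  have hd := hζ.zpow_eq_one_iff_dvd n
  split_ifs with h
  · rw [hd.mpr (by exact_mod_cast h)]; simp
  · have h1 : ζ ^ n ≠ 1 := fun h' => h (by exact_mod_cast hd.mp h')
    have := mul_geom_sum (ζ ^ n) 7
    have h7 : (ζ ^ n) ^ 7 = 1 := by
      rw [← e, hζ.pow_eq_one, one_zpow]
    rw [h7, sub_self] at this
    exact (mul_eq_zero.mp this).resolve_left (sub_ne_zero.mpr h1)

theorem neg_one_zpow7 (m : ℤ) : (-1 : ℂ) ^ (7 * m) = (-1) ^ m := by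
  rw [zpow_mul]; congr 1; norm_num

theorem zeta_norm (ζ : ℂ) (hζ : IsPrimitiveRoot ζ 7) (k : ℕ) : ‖ζ ^ k‖ = 1 := by
  rw [norm_pow, hζ.norm'_eq_one (by norm_num), one_pow]

theorem L4_sum7 (ζ : ℂ) (hζ : IsPrimitiveRoot ζ 7) (q X : ℂ) (hq : q ≠ 0) (hq1 : ‖q‖ < 1) (hX : ‖X‖ = 1) :
    ∑ k ∈ Finset.range 7, L4 q (ζ ^ k * X) = 7 * L4 (q ^ 7) (X ^ 7) := by
  unfold L4
  rw [← Summable.tsum_finsetSum]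
  · have e : ∀ n : ℤ, ∑ k ∈ Finset.range 7, (-1) ^ n * g4 q n * (ζ ^ k * X) ^ n
        = if (7 : ℤ) ∣ n then 7 * ((-1) ^ n * g4 q n * X ^ n) else 0 := by
      intro n
      have := root_sum ζ hζ n
      have e2 : ∑ k ∈ Finset.range 7, (-1) ^ n * g4 q n * (ζ ^ k * X) ^ n =
        ((-1) ^ n * g4 q n * X ^ n) * ∑ k ∈ Finset.range 7, (ζ ^ k) ^ n := by
        rw [Finset.mul_sum]
        refine Finset.sum_congr rfl fun k _ => ?_
        rw [mul_zpow]; ring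
      rw [e2, this]
      split_ifs <;> ring
    simp only [e]
    have inj : Function.Injective (fun m : ℤ => 7 * m) := fun a b h => by simpa using h
    rw [← inj.tsum_eq, ← tsum_mul_left]
    · refine tsum_congr fun m => ?_
      simp only [dvd_mul_right, if_true]
      rw [neg_one_zpow7]
      congr 2
      · congr 1
        unfold g4
        rw [← zpow_natCast q 7, ← zpow_mul, ← zpow_mul]
        push_cast
        congr 3; ring
      · rw [zpow_mul]; norm_cast
    · intro n hn
      simp only [Function.mem_support, ne_eq, ite_eq_right_iff, Classical.not_imp] at hn
      obtain ⟨m, rfl⟩ := hn.1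
      exact ⟨m, rfl⟩
  · intro k _
    exact (g4_near q hq hq1 _ (by rw [norm_mul, zeta_norm ζ hζ, hX, one_mul])).1.of_norm

theorem L2_sum7 (ζ : ℂ) (hζ : IsPrimitiveRoot ζ 7) (q : ℂ) (hq : q ≠ 0) (hq1 : ‖q‖ < 1) :
    ∑ k ∈ Finset.range 7, ζ ^ k * L2 q ((ζ ^ k) ^ 2) = -7 * q ^ 3 * L2 (q ^ 7) 1 := by
  unfold L2
  simp only [← tsum_mul_left]
  have h0 : ζ ≠ 0 := hζ.ne_zero (by norm_num)
  rw [← Summable.tsum_finsetSum]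
  · have e : ∀ n : ℤ, ∑ k ∈ Finset.range 7, ζ ^ k * ((-1) ^ n * g2 q n * ((ζ ^ k) ^ 2) ^ n)
        = if (7 : ℤ) ∣ 2 * n + 1 then 7 * ((-1) ^ n * g2 q n) else 0 := by
      intro n
      have := root_sum ζ hζ (2 * n + 1)
      have e2 : ∑ k ∈ Finset.range 7, ζ ^ k * ((-1) ^ n * g2 q n * ((ζ ^ k) ^ 2) ^ n) =
        ((-1) ^ n * g2 q n) * ∑ k ∈ Finset.range 7, (ζ ^ k) ^ (2 * n + 1) := by
        rw [Finset.mul_sum]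
        refine Finset.sum_congr rfl fun k _ => ?_
        rw [zpow_add_one₀ (pow_ne_zero _ h0), zpow_mul]; norm_cast; ring
      rw [e2, this]
      split_ifs <;> ring
    simp only [e]
    have inj : Function.Injective (fun m : ℤ => 7 * m + 3) := fun a b h => by simpa using h
    rw [← inj.tsum_eq]
    · refine tsum_congr fun m => ?_
      rw [if_pos ⟨2 * m + 1, by ring⟩]
      rw [zpow_add₀ (by norm_num), neg_one_zpow7]
      have : g2 q (7 * m + 3) = q ^ 3 * g2 (q ^ 7) m := by
        unfold g2
        rw [← zpow_natCast q 7, ← zpow_mul, ← zpow_mul, zpow_add₀ hq]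
        rw [show 2 * (7 * m + 3) + 1 = ((7 : ℕ) : ℤ) * (2 * m + 1) by push_cast; ring]
        push_cast
        norm_cast
        ring
      rw [this]
      norm_num
      ring
    · intro n hn
      simp only [Function.mem_support, ne_eq, ite_eq_right_iff, Classical.not_imp] at hn
      obtain ⟨m, hm⟩ := hn.1
      exact ⟨(n - 3) / 7, by simp only; omega⟩
  · intro k _
    refine Summable.of_norm ?_
    refine (g2_summable q hq hq1).congr fun n => ?_
    have := zeta_norm ζ hζ k
    rw [norm_mul, norm_mul, norm_mul, norm_zpow, norm_zpow, norm_pow (ζ ^ k) 2, this]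
    simp

theorem sum7_sym (ζ : ℂ) (hζ : IsPrimitiveRoot ζ 7) (F : ℂ → ℂ) (hF : ∀ x, F x⁻¹ = F x) :
    ∑ k ∈ Finset.range 7, F (ζ ^ k) = F 1 + 2 * (F ζ + F (ζ ^ 2) + F (ζ ^ 4)) := by
  have h0 : ζ ≠ 0 := hζ.ne_zero (by norm_num)
  have h7 := hζ.pow_eq_one
  have h6 : ζ ^ 6 = ζ⁻¹ := by field_simp; exact h7
  have h5 : ζ ^ 5 = (ζ ^ 2)⁻¹ := by field_simp; exact h7
  have h3 : ζ ^ 3 = (ζ ^ 4)⁻¹ := by field_simp; exact h7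
  simp only [Finset.sum_range_succ, Finset.sum_range_zero, h6, h5, h3, hF, pow_zero, pow_one]
  ring

theorem sum7_sq (ζ : ℂ) (hζ : IsPrimitiveRoot ζ 7) (F : ℂ → ℂ) :
    ∑ k ∈ Finset.range 7, F ((ζ ^ k) ^ 2) = ∑ k ∈ Finset.range 7, F (ζ ^ k) := by
  have h7 := hζ.pow_eq_one
  have e8 : ζ ^ 8 = ζ := by linear_combination ζ * h7
  have e10 : ζ ^ 10 = ζ ^ 3 := by linear_combination ζ ^ 3 * h7
  have e12 : ζ ^ 12 = ζ ^ 5 := by linear_combination ζ ^ 5 * h7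
  simp only [Finset.sum_range_succ, Finset.sum_range_zero, ← pow_mul]
  norm_num [e8, e10, e12]
  ring

theorem th_ne' (p ζ : ℂ) (hp8 : ‖p‖ ^ 4 ≤ 1 / 8) (hz : ‖ζ‖ = 1) :
    tE (p ^ 2) ζ ≠ 0 ∧ tF (p ^ 2) ζ ≠ 0 := by
  have hq : ‖(p ^ 2) ^ 4‖ ≤ 1 / 8 := by
    rw [← pow_mul, norm_pow, show 2 * 4 = 4 + 4 by norm_num, pow_add]
    nlinarith [pow_nonneg (norm_nonneg p) 4]
  rw [tE_th, tF_th]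
  exact ⟨th_ne _ _ hq (by rw [norm_pow, hz, one_pow]), th_ne _ _ hq (by rw [norm_neg, norm_pow, hz, one_pow])⟩

theorem torsion (p ζ : ℂ) (hζ : IsPrimitiveRoot ζ 7) (hp : p ≠ 0) (hp8 : ‖p‖ ^ 4 ≤ 1 / 8)
    (hb : tO (p ^ 2) 1 ≠ 0) :
    2 * tO (p ^ 2) 1 * tE (p ^ 2) 1 * (tO (p ^ 2) ζ / tE (p ^ 2) ζ + tO (p ^ 2) (ζ ^ 2) / tE (p ^ 2) (ζ ^ 2)
      + tO (p ^ 2) (ζ ^ 4) / tE (p ^ 2) (ζ ^ 4)) = -(7 * tO (p ^ 14) 1 ^ 2 + tO (p ^ 2) 1 ^ 2) ∧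
    2 * tE (p ^ 2) 1 * tF (p ^ 2) 1 * (tF (p ^ 2) ζ / tE (p ^ 2) ζ + tF (p ^ 2) (ζ ^ 2) / tE (p ^ 2) (ζ ^ 2)
      + tF (p ^ 2) (ζ ^ 4) / tE (p ^ 2) (ζ ^ 4)) = 7 * tF (p ^ 14) 1 ^ 2 - tF (p ^ 2) 1 ^ 2 ∧
    2 * tE (p ^ 2) 1 * tF (p ^ 2) 1 * (tE (p ^ 2) ζ / tF (p ^ 2) ζ + tE (p ^ 2) (ζ ^ 2) / tF (p ^ 2) (ζ ^ 2)
      + tE (p ^ 2) (ζ ^ 4) / tF (p ^ 2) (ζ ^ 4)) = 7 * tE (p ^ 14) 1 ^ 2 - tE (p ^ 2) 1 ^ 2 := by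
  have h0 : ζ ≠ 0 := hζ.ne_zero (by norm_num)
  have small : ‖p‖ < 1 := by
    by_contra hc
    have : 1 ≤ ‖p‖ ^ 4 := one_le_pow₀ (not_lt.mp hc)
    linarith
  have hz := zeta_norm ζ hζ
  have ne := th_ne' p (hp8 := hp8)
  have hq : p ^ 8 ≠ 0 := pow_ne_zero _ hp
  have hq1 : ‖p ^ 8‖ < 1 := by rw [norm_pow]; exact pow_lt_one₀ (norm_nonneg _) small (by norm_num)
  have hp2 : p ^ 2 ≠ 0 := pow_ne_zero _ hp
  have hp14 : p ^ 14 ≠ 0 := pow_ne_zero _ hp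
  have n0 := ne 1 (by simp)
  -- constants
  have pw : ∀ k : ℕ, k ≠ 0 → ‖p ^ k‖ ^ 4 ≤ 1 / 8 := fun k hk => by
    refine le_trans (pow_le_pow_left₀ (norm_nonneg _) ?_ 4) hp8
    rw [norm_pow]; exact pow_le_of_le_one (norm_nonneg _) small.le hk
  have c1 := L4_const (p ^ 2) hp2 (pw 2 (by norm_num))
  have c7 := L4_const (p ^ 14) hp14 (pw 14 (by norm_num))
  have v1 := V_const p hp hp8
  have v7 := V_const (p ^ 7) (pow_ne_zero _ hp) (pw 7 (by norm_num))
  obtain ⟨K4, hK4⟩ := L4_main _ hq hq1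
  obtain ⟨K2, hK2⟩ := L2_main _ hq hq1
  have hO : ∀ x : ℂ, x ≠ 0 → tO (p ^ 2) x = p ^ 2 * x * th (p ^ 8) (p ^ 8 * x ^ 2) := fun x hx => by
    rw [tO_th _ _ hp2 hx]; ring_nf
  have hE : ∀ x : ℂ, tE (p ^ 2) x = th (p ^ 8) (x ^ 2) := fun x => by
    rw [tE_th]; ring_nf
  have hF : ∀ x : ℂ, tF (p ^ 2) x = th (p ^ 8) (-x ^ 2) := fun x => by
    rw [tF_th, ← pow_mul]
  have hO7 : tO (p ^ 14) 1 = p ^ 14 * th (p ^ 56) (p ^ 56) := by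
    rw [tO_th _ _ hp14 one_ne_zero]; ring_nf
  have hE7 : tE (p ^ 14) 1 = th (p ^ 56) 1 := by
    rw [tE_th]; ring_nf
  have hF7 : tF (p ^ 14) 1 = th (p ^ 56) (-1) := by
    rw [tF_th]; ring_nf
  have hE1 : tE (p ^ 2) 1 = th (p ^ 8) 1 := by rw [hE]; ring_nf
  have hF1 : tF (p ^ 2) 1 = th (p ^ 8) (-1) := by rw [hF]; ring_nf
  have hO1 : tO (p ^ 2) 1 = p ^ 2 * th (p ^ 8) (p ^ 8) := by rw [hO _ one_ne_zero]; ring_nf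
  rw [← pow_mul] at c1 c7 v7
  norm_num at c1 c7 v7
  have l1 := L2_V _ hq hq1
  have l7 := L2_V ((p ^ 8) ^ 7) (pow_ne_zero _ hq) (by rw [norm_pow]; exact pow_lt_one₀ (norm_nonneg _) hq1 (by norm_num))
  rw [v1] at l1
  rw [← pow_mul] at l7
  norm_num at l7
  rw [v7] at l7
  have hv : th (p ^ 8) (p ^ 8) ≠ 0 := fun h => hb (by rw [hO1, h, mul_zero])
  have hK4' : K4 = tE (p ^ 2) 1 * tF (p ^ 2) 1 := by
    have := hK4 (-1) (by simp)
    rw [neg_neg, c1.1, ← hE1, ← hF1] at this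
    apply mul_right_cancel₀ n0.1
    linear_combination -this
  have hK2' : 2 * p ^ 2 * K2 = tE (p ^ 2) 1 * tO (p ^ 2) 1 := by
    have := hK2 1 (by simp)
    rw [mul_one, l1, ← hE1] at this
    apply mul_right_cancel₀ hv
    rw [hO1]
    linear_combination -2 * p ^ 2 * this
  refine ⟨?_, ?_, ?_⟩
  · have s := sum7_sym ζ hζ (fun x => tO (p ^ 2) x / tE (p ^ 2) x) (fun x => by
      by_cases hx : x = 0
      · simp [hx]
      · simp only [tO_inv, tE_inv])
    have s2 := L2_sum7 ζ hζ (p ^ 8) hq hq1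
    have s3 : ∑ k ∈ Finset.range 7, K2 * (tO (p ^ 2) (ζ ^ k) / tE (p ^ 2) (ζ ^ k)) =
        p ^ 2 * ∑ k ∈ Finset.range 7, ζ ^ k * L2 (p ^ 8) ((ζ ^ k) ^ 2) := by
      rw [Finset.mul_sum]
      refine Finset.sum_congr rfl fun k _ => ?_
      have n := (ne (ζ ^ k) (hz k)).1
      have h := hK2 ((ζ ^ k) ^ 2) (by rw [norm_pow, hz, one_pow])
      rw [hO _ (pow_ne_zero _ h0), ← mul_div_assoc, div_eq_iff n, hE]
      linear_combination -p ^ 2 * ζ ^ k * h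
    rw [← Finset.mul_sum, s2, s, ← pow_mul] at s3
    norm_num at s3
    rw [← pow_mul, l7] at s3
    rw [hO7]
    have hd : tO (p ^ 2) 1 * tE (p ^ 2) 1 * (tO (p ^ 2) 1 / tE (p ^ 2) 1) = tO (p ^ 2) 1 ^ 2 := by
      field_simp [n0.1]
    linear_combination 2 * p ^ 2 * s3 - (tO (p ^ 2) 1 / tE (p ^ 2) 1 + 2 * (tO (p ^ 2) ζ / tE (p ^ 2) ζ + tO (p ^ 2) (ζ ^ 2) / tE (p ^ 2) (ζ ^ 2)
      + tO (p ^ 2) (ζ ^ 4) / tE (p ^ 2) (ζ ^ 4))) * hK2' - hd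
  · have s := sum7_sym ζ hζ (fun x => tF (p ^ 2) x / tE (p ^ 2) x) (fun x => by simp only [tF_inv, tE_inv])
    have s2 := L4_sum7 ζ hζ (p ^ 8) 1 hq hq1 (by simp)
    simp only [mul_one, one_pow] at s2
    rw [← sum7_sq ζ hζ (fun x => L4 (p ^ 8) x)] at s2
    have s3 : ∑ k ∈ Finset.range 7, K4 * (tF (p ^ 2) (ζ ^ k) / tE (p ^ 2) (ζ ^ k)) =
        ∑ k ∈ Finset.range 7, L4 (p ^ 8) ((ζ ^ k) ^ 2) := by
      refine Finset.sum_congr rfl fun k _ => ?_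
      have n := (ne (ζ ^ k) (hz k)).1
      have h := hK4 ((ζ ^ k) ^ 2) (by rw [norm_pow, hz, one_pow])
      rw [← mul_div_assoc, div_eq_iff n, hE, hF]
      linear_combination - h
    rw [← Finset.mul_sum, s2, s, ← pow_mul] at s3
    norm_num at s3
    rw [c7.2, hK4'] at s3
    rw [hF7]
    have hd : tF (p ^ 2) 1 * tE (p ^ 2) 1 * (tF (p ^ 2) 1 / tE (p ^ 2) 1) = tF (p ^ 2) 1 ^ 2 := by
      field_simp [n0.1]
    linear_combination s3 - hd
  · have s := sum7_sym ζ hζ (fun x => tE (p ^ 2) x / tF (p ^ 2) x) (fun x => by simp only [tF_inv, tE_inv])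
    have s2 := L4_sum7 ζ hζ (p ^ 8) (-1) hq hq1 (by simp)
    simp only [mul_neg, mul_one] at s2
    rw [← sum7_sq ζ hζ (fun x => L4 (p ^ 8) (-x))] at s2
    have s3 : ∑ k ∈ Finset.range 7, K4 * (tE (p ^ 2) (ζ ^ k) / tF (p ^ 2) (ζ ^ k)) =
        ∑ k ∈ Finset.range 7, L4 (p ^ 8) (-(ζ ^ k) ^ 2) := by
      refine Finset.sum_congr rfl fun k _ => ?_
      have n := (ne (ζ ^ k) (hz k)).2
      have h := hK4 (-(ζ ^ k) ^ 2) (by rw [norm_neg, norm_pow, hz, one_pow])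
      rw [← mul_div_assoc, div_eq_iff n, hE, hF]
      rw [neg_neg] at h
      linear_combination - h
    rw [← Finset.mul_sum, s2, s, ← pow_mul, show (-1 : ℂ) ^ 7 = -1 by norm_num] at s3
    norm_num at s3
    rw [c7.1, hK4'] at s3
    rw [hE7]
    have hd : tF (p ^ 2) 1 * tE (p ^ 2) 1 * (tE (p ^ 2) 1 / tF (p ^ 2) 1) = tE (p ^ 2) 1 ^ 2 := by
      field_simp [n0.2]
    linear_combination s3 - hd
end

section
open Filter Topology

theorem prod_tsum_pi (n : ℕ) : ∀ (f : Fin n → ℤ → ℂ), (∀ i, Summable fun m => ‖f i m‖) →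
    (Summable fun v : Fin n → ℤ => ‖∏ i, f i (v i)‖) ∧
    ∑' v : Fin n → ℤ, ∏ i, f i (v i) = ∏ i, ∑' m, f i m := by
  induction n with
  | zero =>
    intro f hf
    constructor
    · exact Summable.of_finite
    · simp
  | succ n ih =>
    intro f hf
    obtain ⟨h1, h2⟩ := ih (fun i => f i.succ) (fun i => hf _)
    have hs := summable_mul_of_summable_norm (hf 0) h1
    have hs' := (hf 0).mul_norm h1
    have ht := tsum_mul_tsum_of_summable_norm (hf 0) h1
    let e : ℤ × (Fin n → ℤ) ≃ (Fin (n + 1) → ℤ) := Fin.consEquiv (fun _ => ℤ)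
    have he : ∀ x : ℤ × (Fin n → ℤ), ∏ i, f i (e x i) = f 0 x.1 * ∏ i : Fin n, f i.succ (x.2 i) := by
      intro x
      rw [Fin.prod_univ_succ]
      simp [e, Fin.consEquiv]
    constructor
    · rw [← e.summable_iff]
      refine hs'.congr fun x => ?_
      simp only [Function.comp, he]
    · rw [← e.tsum_eq, Fin.prod_univ_succ, ← h2, ht]
      exact tsum_congr he

noncomputable def aC (q ζ : ℂ) (v : Fin 7 → ℤ) : ℂ := ∏ k : Fin 7, q ^ ((v k) ^ 2) * (ζ ^ (k : ℕ)) ^ (v k)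
def sC (v : Fin 7 → ℤ) : ℤ := ∑ k, v k
noncomputable def cC (q ζ : ℂ) (n : ℤ) : ℂ := ∑' v : Fin 7 → ℤ, if sC v = n then aC q ζ v else 0

theorem cC_shift (q ζ : ℂ) (hζ : IsPrimitiveRoot ζ 7) (hq : q ≠ 0) (n : ℤ) :
    cC q ζ (n + 7) = q ^ (2 * n + 7) * cC q ζ n := by
  have h0 : ζ ≠ 0 := hζ.ne_zero (by norm_num)
  unfold cC
  rw [← (Equiv.addRight (1 : Fin 7 → ℤ)).tsum_eq, ← tsum_mul_left]
  refine tsum_congr fun v => ?_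
  have hs : sC (v + 1) = sC v + 7 := by simp [sC, Finset.sum_add_distrib]
  simp only [Equiv.coe_addRight, hs, add_left_inj]
  split_ifs with h
  · unfold aC
    have e : ∀ k : Fin 7, q ^ (((v + 1) k) ^ 2) * (ζ ^ (k : ℕ)) ^ ((v + 1) k) =
        (q ^ (2 * v k + 1) * ζ ^ (k : ℕ)) * (q ^ ((v k) ^ 2) * (ζ ^ (k : ℕ)) ^ (v k)) := by
      intro k
      simp only [Pi.add_apply, Pi.one_apply]
      rw [zpow_add_one₀ (pow_ne_zero _ h0), show (v k + 1) ^ 2 = (2 * v k + 1) + (v k) ^ 2 by ring, zpow_add₀ hq]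
      ring
    rw [Finset.prod_congr rfl fun k _ => e k, Finset.prod_mul_distrib, Finset.prod_mul_distrib]
    have e2 : ∏ k : Fin 7, ζ ^ (k : ℕ) = 1 := by
      rw [Finset.prod_pow_eq_pow_sum]
      have : ∑ k : Fin 7, (k : ℕ) = 7 * 3 := by decide
      rw [this, pow_mul, hζ.pow_eq_one, one_pow]
    have e3 : ∏ k : Fin 7, q ^ (2 * v k + 1) = q ^ (2 * n + 7) := by
      rw [← h]
      unfold sC
      simp only [Fin.prod_univ_succ, Fin.sum_univ_succ, Finset.univ_eq_empty, Finset.prod_empty, mul_one, ← zpow_add₀ hq, Finset.sum_empty]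
      congr 1; ring
    rw [e2, e3]; ring
  · simp

theorem cC_rot (q ζ : ℂ) (hζ : IsPrimitiveRoot ζ 7) (n : ℤ) :
    cC q ζ n * ζ ^ n = cC q ζ n := by
  have h0 : ζ ≠ 0 := hζ.ne_zero (by norm_num)
  unfold cC
  rw [← tsum_mul_right, ← (Equiv.arrowCongr (Equiv.addRight (-1 : Fin 7)) (Equiv.refl ℤ)).tsum_eq]
  refine tsum_congr fun v => ?_
  have e0 : ∀ k, (Equiv.arrowCongr (Equiv.addRight (-1 : Fin 7)) (Equiv.refl ℤ)) v k = v (k + 1) := by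
    intro k; simp [Equiv.arrowCongr]
  have hs : sC ((Equiv.arrowCongr (Equiv.addRight (-1 : Fin 7)) (Equiv.refl ℤ)) v) = sC v := by
    unfold sC
    simp only [e0]
    exact Equiv.sum_comp (Equiv.addRight (1 : Fin 7)) v
  rw [hs]
  split_ifs with h
  · have : aC q ζ v = ∏ k : Fin 7, q ^ ((v (k + 1)) ^ 2) * (ζ ^ ((k + 1 : Fin 7) : ℕ)) ^ (v (k + 1)) :=
      (Equiv.prod_comp (Equiv.addRight (1 : Fin 7)) (fun k => q ^ ((v k) ^ 2) * (ζ ^ (k : ℕ)) ^ (v k))).symm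
    rw [this]
    unfold aC
    have e1 : ∀ k : Fin 7, ζ ^ ((k + 1 : Fin 7) : ℕ) = ζ ^ (k : ℕ) * ζ := by
      intro k
      rw [← pow_succ]
      by_cases hk : k = 6
      · subst hk; simpa using hζ.pow_eq_one.symm
      · congr 1; revert hk; revert k; decide
    have e2 : ζ ^ n = ∏ k : Fin 7, ζ ^ (v (k + 1)) := by
      rw [← h, ← hs]
      unfold sC
      simp only [e0, Fin.prod_univ_succ, Fin.sum_univ_succ, Finset.univ_eq_empty, Finset.prod_empty, mul_one, zpow_add₀ h0, Finset.sum_empty, zpow_zero]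
    rw [e2, ← Finset.prod_mul_distrib]
    refine Finset.prod_congr rfl fun k _ => ?_
    rw [e0, e1, mul_zpow]; ring
  · simp

theorem prod_th (q ζ X : ℂ) (hζ : IsPrimitiveRoot ζ 7) (hq : q ≠ 0) (hq1 : ‖q‖ < 1) (hX : X ≠ 0) :
    ∏ k : Fin 7, th q (ζ ^ (k : ℕ) * X) = cC q ζ 0 * th (q ^ 7) (X ^ 7) := by
  have h0 : ζ ≠ 0 := hζ.ne_zero (by norm_num)
  have hp := prod_tsum_pi 7 (fun k n => q ^ (n ^ 2) * (ζ ^ (k : ℕ) * X) ^ n)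
    (fun k => summable_theta_norm q _ hq hq1 (mul_ne_zero (pow_ne_zero _ h0) hX))
  unfold th
  rw [← hp.2]
  have e : ∀ v : Fin 7 → ℤ, ∏ i, q ^ ((v i) ^ 2) * (ζ ^ (i : ℕ) * X) ^ (v i) = aC q ζ v * X ^ (sC v) := by
    intro v
    have : X ^ (sC v) = ∏ k : Fin 7, X ^ (v k) := by
      unfold sC
      simp only [Fin.prod_univ_succ, Fin.sum_univ_succ, Finset.univ_eq_empty, Finset.prod_empty, mul_one, zpow_add₀ hX, Finset.sum_empty, zpow_zero]
    rw [this]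
    unfold aC
    rw [← Finset.prod_mul_distrib]
    refine Finset.prod_congr rfl fun k _ => ?_
    rw [mul_zpow]; ring
  have hs := hp.1.of_norm
  simp only [e] at hs ⊢
  have hf := hs.hasSum.tsum_fiberwise sC
  rw [← hf.tsum_eq]
  have e2 : ∀ n : ℤ, ∑' v : ↑(sC ⁻¹' {n}), aC q ζ v * X ^ (sC v) = cC q ζ n * X ^ n := by
    intro n
    unfold cC
    rw [tsum_subtype (sC ⁻¹' {n}) (fun v => aC q ζ v * X ^ (sC v)), ← tsum_mul_right]
    refine tsum_congr fun v => ?_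
    by_cases h : sC v = n
    · simp [Set.indicator, h]
    · simp [Set.indicator, h]
  simp only [e2]
  have hc7 : ∀ m : ℤ, cC q ζ (7 * m) = q ^ (7 * m ^ 2) * cC q ζ 0 := by
    intro m
    induction m with
    | zero => simp
    | succ m ih =>
      rw [show 7 * ((m : ℤ) + 1) = 7 * m + 7 by ring, cC_shift q ζ hζ hq, ih, ← mul_assoc, ← zpow_add₀ hq]
      congr 2; ring
    | pred m ih =>
      have := cC_shift q ζ hζ hq (7 * (-(m : ℤ) - 1))
      rw [show 7 * (-(m : ℤ) - 1) + 7 = 7 * -(m : ℤ) by ring, ih] at this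
      apply mul_left_cancel₀ (zpow_ne_zero (2 * (7 * (-(m : ℤ) - 1)) + 7) hq)
      rw [← this, ← mul_assoc, ← zpow_add₀ hq]
      congr 2; ring
  have inj : Function.Injective (fun m : ℤ => 7 * m) := fun a b h => by simpa using h
  rw [← inj.tsum_eq, ← tsum_mul_left]
  · refine tsum_congr fun m => ?_
    rw [hc7, ← zpow_natCast q 7, ← zpow_natCast X 7, ← zpow_mul, ← zpow_mul]
    push_cast
    ring
  · intro n hn
    by_contra hc
    apply hn
    have h1 : ζ ^ n ≠ 1 := fun h' => hc (by
      obtain ⟨m, hm⟩ := (hζ.zpow_eq_one_iff_dvd n).mp h'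
      exact ⟨m, by rw [hm]; push_cast; rfl⟩)
    have := cC_rot q ζ hζ n
    have h2 : cC q ζ n * (ζ ^ n - 1) = 0 := by linear_combination this
    beta_reduce
    rw [(mul_eq_zero.mp h2).resolve_right (sub_ne_zero.mpr h1), zero_mul]

theorem prod7_sym (ζ : ℂ) (hζ : IsPrimitiveRoot ζ 7) (F : ℂ → ℂ) (hF : ∀ x, F x⁻¹ = F x) :
    ∏ k : Fin 7, F (ζ ^ (k : ℕ)) = F 1 * (F ζ * F (ζ ^ 2) * F (ζ ^ 4)) ^ 2 := by
  have h0 : ζ ≠ 0 := hζ.ne_zero (by norm_num)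
  have h7 := hζ.pow_eq_one
  have h6 : F (ζ ^ 6) = F ζ := by rw [← hF ζ]; congr 1; field_simp; exact h7
  have h5 : F (ζ ^ 5) = F (ζ ^ 2) := by rw [← hF (ζ ^ 2)]; congr 1; field_simp; exact h7
  have h3 : F (ζ ^ 3) = F (ζ ^ 4) := by rw [← hF (ζ ^ 4)]; congr 1; field_simp; exact h7
  have e : ∏ k : Fin 7, F (ζ ^ (k : ℕ)) =
      F (ζ ^ 0) * F (ζ ^ 1) * F (ζ ^ 2) * F (ζ ^ 3) * F (ζ ^ 4) * F (ζ ^ 5) * F (ζ ^ 6) := by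
    rw [Fin.prod_univ_seven]; rfl
  rw [e, h6, h5, h3, pow_zero, pow_one]; ring

theorem prod_rel (p ζ : ℂ) (hζ : IsPrimitiveRoot ζ 7) (hp : p ≠ 0) (hp1 : ‖p‖ < 1) :
    ∃ C : ℂ, tE (p ^ 2) 1 * (tE (p ^ 2) ζ * tE (p ^ 2) (ζ ^ 2) * tE (p ^ 2) (ζ ^ 4)) ^ 2 = C * tE (p ^ 14) 1 ∧
      tF (p ^ 2) 1 * (tF (p ^ 2) ζ * tF (p ^ 2) (ζ ^ 2) * tF (p ^ 2) (ζ ^ 4)) ^ 2 = C * tF (p ^ 14) 1 ∧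
      tO (p ^ 2) 1 * (tO (p ^ 2) ζ * tO (p ^ 2) (ζ ^ 2) * tO (p ^ 2) (ζ ^ 4)) ^ 2 = C * tO (p ^ 14) 1 := by
  have h0 : ζ ≠ 0 := hζ.ne_zero (by norm_num)
  have hq : p ^ 8 ≠ 0 := pow_ne_zero _ hp
  have hq1 : ‖p ^ 8‖ < 1 := by rw [norm_pow]; exact pow_lt_one₀ (norm_nonneg _) hp1 (by norm_num)
  have hp2 : p ^ 2 ≠ 0 := pow_ne_zero _ hp
  have hp14 : p ^ 14 ≠ 0 := pow_ne_zero _ hp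
  have hζ2 : IsPrimitiveRoot (ζ ^ 2) 7 := hζ.pow_of_coprime 2 (by norm_num)
  have hO : ∀ x : ℂ, x ≠ 0 → tO (p ^ 2) x = p ^ 2 * x * th (p ^ 8) (p ^ 8 * x ^ 2) := fun x hx => by
    rw [tO_th _ _ hp2 hx]; ring_nf
  have hE : ∀ x : ℂ, tE (p ^ 2) x = th (p ^ 8) (x ^ 2) := fun x => by
    rw [tE_th]; ring_nf
  have hF : ∀ x : ℂ, tF (p ^ 2) x = th (p ^ 8) (-x ^ 2) := fun x => by
    rw [tF_th, ← pow_mul]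
  have hO7 : tO (p ^ 14) 1 = p ^ 14 * th ((p ^ 8) ^ 7) ((p ^ 8) ^ 7) := by
    rw [tO_th _ _ hp14 one_ne_zero]; ring_nf
  have hE7 : tE (p ^ 14) 1 = th ((p ^ 8) ^ 7) (1 ^ 7) := by
    rw [tE_th]; ring_nf
  have hF7 : tF (p ^ 14) 1 = th ((p ^ 8) ^ 7) ((-1) ^ 7) := by
    rw [tF_th]; ring_nf
  have hsw : ∀ k : ℕ, (ζ ^ 2) ^ k = (ζ ^ k) ^ 2 := fun k => by rw [← pow_mul, ← pow_mul, mul_comm]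
  refine ⟨cC (p ^ 8) (ζ ^ 2) 0, ?_, ?_, ?_⟩
  · rw [← prod7_sym ζ hζ (fun x => tE (p ^ 2) x) (tE_inv _), hE7, ← prod_th _ _ 1 hζ2 hq hq1 one_ne_zero]
    refine Finset.prod_congr rfl fun k _ => ?_
    rw [hE, hsw, mul_one]
  · rw [← prod7_sym ζ hζ (fun x => tF (p ^ 2) x) (tF_inv _), hF7, ← prod_th _ _ (-1) hζ2 hq hq1 (by norm_num)]
    refine Finset.prod_congr rfl fun k _ => ?_
    rw [hF, hsw, mul_neg_one]
  · rw [← prod7_sym ζ hζ (fun x => tO (p ^ 2) x) (tO_inv _), hO7, mul_left_comm, ← prod_th _ _ (p ^ 8) hζ2 hq hq1 hq]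
    have e2 : ∏ k : Fin 7, ζ ^ (k : ℕ) = 1 := by
      rw [Finset.prod_pow_eq_pow_sum]
      have : ∑ k : Fin 7, (k : ℕ) = 7 * 3 := by decide
      rw [this, pow_mul, hζ.pow_eq_one, one_pow]
    have e3 : p ^ 14 = ∏ k : Fin 7, (p ^ 2 * ζ ^ (k : ℕ)) := by
      rw [Finset.prod_mul_distrib, e2, Finset.prod_const, Finset.card_univ, Fintype.card_fin, ← pow_mul, mul_one]
    rw [e3, ← Finset.prod_mul_distrib]
    refine Finset.prod_congr rfl fun k _ => ?_
    rw [hO _ (pow_ne_zero _ h0), hsw, mul_comm (p ^ 8)]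
end

section
set_option maxHeartbeats 4000000 in
theorem NN_alg (l h be T p1 p2 p3 t br : ℝ) (hD : h^2 = 4-12*l+25*l^2-30*l^3+25*l^4-12*l^5+4*l^6)
    (h_be : be = ((4)*l^1 + (-14)*l^2 + (28)*l^3 + (-35)*l^4 + (28)*l^5 + (-14)*l^6 + (4)*l^7 + ((2)*l^1 + (-4)*l^2 + (4)*l^3 + (-2)*l^4) * h)) (h_T : T = ((3/7) + (-8/7)*l^1 + (6/7)*l^2 + (-4/7)*l^3 + ((2/7)) * h))
    (h_p1 : p1 = ((6)*l^1 + (-11)*l^2 + (14)*l^3 + (-10)*l^4 + (4)*l^5 + ((2)*l^1 + (-2)*l^2) * h))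
    (h_p2 : p2 = ((12)*l^2 + (-42)*l^3 + (81)*l^4 + (-94)*l^5 + (70)*l^6 + (-32)*l^7 + (8)*l^8 + ((6)*l^2 + (-12)*l^3 + (10)*l^4 + (-4)*l^5) * h)) (h_p3 : p3 = be * l^2) (h_t : t = 1 - p1)
    (h_br : br = ((-4)*l^1 + (18)*l^2 + (-20)*l^3 + (-44)*l^4 + (208)*l^5 + (-374)*l^6 + (408)*l^7 + (-288)*l^8 + (128)*l^9 + (-32)*l^10 + ((-2)*l^1 + (6)*l^2 + (2)*l^3 + (-34)*l^4 + (52)*l^5 + (-40)*l^6 + (16)*l^7) * h)) :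
    (7*(1-(1+2*l)*T)-4)*2*(p3^2+t*p3*p2+l^2*(p2^2-2*p1*p3)+t^2*p3*p1+t*l^2*(p1*p2-3*p3)+l^4*(p1^2-2*p2)+t^3*p3+t^2*l^2*p2+t*l^4*p1+l^6)
      = 8*(1-be)^2*l^2*br := by
  replace h_p3 : p3 = ((4)*l^3 + (-14)*l^4 + (28)*l^5 + (-35)*l^6 + (28)*l^7 + (-14)*l^8 + (4)*l^9 + ((2)*l^3 + (-4)*l^4 + (4)*l^5 + (-2)*l^6) * h) := by rw [h_p3, h_be]; ring
  replace h_t : t = ((1) + (-6)*l^1 + (11)*l^2 + (-14)*l^3 + (10)*l^4 + (-4)*l^5 + ((-2)*l^1 + (2)*l^2) * h) := by rw [h_t, h_p1]; ring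
  have h_p33 : p3 * p3 = ((32)*l^6 + (-224)*l^7 + (840)*l^8 + (-2128)*l^9 + (3976)*l^10 + (-5712)*l^11 + (6433)*l^12 + (-5712)*l^13 + (3976)*l^14 + (-2128)*l^15 + (840)*l^16 + (-224)*l^17 + (32)*l^18 + ((16)*l^6 + (-88)*l^7 + (256)*l^8 + (-492)*l^9 + (672)*l^10 + (-672)*l^11 + (492)*l^12 + (-256)*l^13 + (88)*l^14 + (-16)*l^15) * h) := by
    rw [h_p3]; linear_combination ((((2)*l^3 + (-4)*l^4 + (4)*l^5 + (-2)*l^6) * ((2)*l^3 + (-4)*l^4 + (4)*l^5 + (-2)*l^6)) : ℝ) * hD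
  have h_p32 : p3 * p2 = ((96)*l^5 + (-672)*l^6 + (2492)*l^7 + (-6202)*l^8 + (11326)*l^9 + (-15827)*l^10 + (17262)*l^11 + (-14784)*l^12 + (9888)*l^13 + (-5064)*l^14 + (1904)*l^15 + (-480)*l^16 + (64)*l^17 + ((48)*l^5 + (-264)*l^6 + (754)*l^7 + (-1406)*l^8 + (1848)*l^9 + (-1764)*l^10 + (1224)*l^11 + (-600)*l^12 + (192)*l^13 + (-32)*l^14) * h) := by
    rw [h_p3, h_p2]; linear_combination ((((2)*l^3 + (-4)*l^4 + (4)*l^5 + (-2)*l^6) * ((6)*l^2 + (-12)*l^3 + (10)*l^4 + (-4)*l^5)) : ℝ) * hD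
  have h_p22 : p2 * p2 = ((288)*l^4 + (-2016)*l^5 + (7392)*l^6 + (-18060)*l^7 + (32197)*l^8 + (-43700)*l^9 + (46092)*l^10 + (-38032)*l^11 + (24424)*l^12 + (-11968)*l^13 + (4288)*l^14 + (-1024)*l^15 + (128)*l^16 + ((144)*l^4 + (-792)*l^5 + (2220)*l^6 + (-4008)*l^7 + (5052)*l^8 + (-4592)*l^9 + (3016)*l^10 + (-1392)*l^11 + (416)*l^12 + (-64)*l^13) * h) := by
    rw [h_p2]; linear_combination ((((6)*l^2 + (-12)*l^3 + (10)*l^4 + (-4)*l^5) * ((6)*l^2 + (-12)*l^3 + (10)*l^4 + (-4)*l^5)) : ℝ) * hD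
  have h_p13 : p1 * p3 = ((40)*l^4 + (-224)*l^5 + (686)*l^6 + (-1414)*l^7 + (2121)*l^8 + (-2394)*l^9 + (2052)*l^10 + (-1320)*l^11 + (616)*l^12 + (-192)*l^13 + (32)*l^14 + ((20)*l^4 + (-82)*l^5 + (180)*l^6 + (-258)*l^7 + (252)*l^8 + (-168)*l^9 + (72)*l^10 + (-16)*l^11) * h) := by
    rw [h_p1, h_p3]; linear_combination ((((2)*l^1 + (-2)*l^2) * ((2)*l^3 + (-4)*l^4 + (4)*l^5 + (-2)*l^6)) : ℝ) * hD
  have h_p12 : p1 * p2 = ((120)*l^3 + (-672)*l^4 + (2024)*l^5 + (-4063)*l^6 + (5904)*l^7 + (-6416)*l^8 + (5264)*l^9 + (-3224)*l^10 + (1424)*l^11 + (-416)*l^12 + (64)*l^13 + ((60)*l^3 + (-246)*l^4 + (522)*l^5 + (-712)*l^6 + (656)*l^7 + (-408)*l^8 + (160)*l^9 + (-32)*l^10) * h) := by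
    rw [h_p1, h_p2]; linear_combination ((((2)*l^1 + (-2)*l^2) * ((6)*l^2 + (-12)*l^3 + (10)*l^4 + (-4)*l^5)) : ℝ) * hD
  have h_p11 : p1 * p1 = ((52)*l^2 + (-212)*l^3 + (501)*l^4 + (-796)*l^5 + (904)*l^6 + (-736)*l^7 + (424)*l^8 + (-160)*l^9 + (32)*l^10 + ((24)*l^2 + (-68)*l^3 + (100)*l^4 + (-96)*l^5 + (56)*l^6 + (-16)*l^7) * h) := by
    rw [h_p1]; linear_combination ((((2)*l^1 + (-2)*l^2) * ((2)*l^1 + (-2)*l^2)) : ℝ) * hD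
  have h_tt : t * t = ((1) + (-12)*l^1 + (74)*l^2 + (-240)*l^3 + (521)*l^4 + (-804)*l^5 + (904)*l^6 + (-736)*l^7 + (424)*l^8 + (-160)*l^9 + (32)*l^10 + ((-4)*l^1 + (28)*l^2 + (-68)*l^3 + (100)*l^4 + (-96)*l^5 + (56)*l^6 + (-16)*l^7) * h) := by
    rw [h_t]; linear_combination ((((-2)*l^1 + (2)*l^2) * ((-2)*l^1 + (2)*l^2)) : ℝ) * hD
  have h_tp32 : (p3 * p2) * t = ((96)*l^5 + (-1632)*l^6 + (11228)*l^7 + (-47922)*l^8 + (146510)*l^9 + (-343889)*l^10 + (644070)*l^11 + (-984669)*l^12 + (1245192)*l^13 + (-1311174)*l^14 + (1151216)*l^15 + (-839720)*l^16 + (504096)*l^17 + (-244832)*l^18 + (93440)*l^19 + (-26624)*l^20 + (5120)*l^21 + (-512)*l^22 + ((48)*l^5 + (-744)*l^6 + (4402)*l^7 + (-15834)*l^8 + (40142)*l^9 + (-76762)*l^10 + (114722)*l^11 + (-136474)*l^12 + (130148)*l^13 + (-99296)*l^14 + (59904)*l^15 + (-27872)*l^16 + (9536)*l^17 + (-2176)*l^18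 + (256)*l^19) * h) := by
    rw [h_p32, h_t]; linear_combination ((((48)*l^5 + (-264)*l^6 + (754)*l^7 + (-1406)*l^8 + (1848)*l^9 + (-1764)*l^10 + (1224)*l^11 + (-600)*l^12 + (192)*l^13 + (-32)*l^14) * ((-2)*l^1 + (2)*l^2)) : ℝ) * hD
  have h_tp13 : (p1 * p3) * t = ((40)*l^4 + (-624)*l^5 + (3766)*l^6 + (-14098)*l^7 + (37779)*l^8 + (-77490)*l^9 + (126099)*l^10 + (-166032)*l^11 + (178558)*l^12 + (-157108)*l^13 + (112464)*l^14 + (-64576)*l^15 + (28960)*l^16 + (-9664)*l^17 + (2176)*l^18 + (-256)*l^19 + ((20)*l^4 + (-282)*l^5 + (1420)*l^6 + (-4340)*l^7 + (9328)*l^8 + (-15008)*l^9 + (18622)*l^10 + (-18016)*l^11 + (13536)*l^12 + (-7744)*l^13 + (3232)*l^14 + (-896)*l^15 + (128)*l^16) * h) := by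
    rw [h_p13, h_t]; linear_combination ((((20)*l^4 + (-82)*l^5 + (180)*l^6 + (-258)*l^7 + (252)*l^8 + (-168)*l^9 + (72)*l^10 + (-16)*l^11) * ((-2)*l^1 + (2)*l^2)) : ℝ) * hD
  have h_tp12 : (p1 * p2) * t = ((120)*l^3 + (-1872)*l^4 + (11264)*l^5 + (-41767)*l^6 + (110358)*l^7 + (-222389)*l^8 + (354378)*l^9 + (-455510)*l^10 + (476816)*l^11 + (-407160)*l^12 + (282016)*l^13 + (-156192)*l^14 + (67328)*l^15 + (-21504)*l^16 + (4608)*l^17 + (-512)*l^18 + ((60)*l^3 + (-846)*l^4 + (4242)*l^5 + (-12782)*l^6 + (26888)*l^7 + (-42118)*l^8 + (50636)*l^9 + (-47232)*l^10 + (34048)*l^11 + (-18592)*l^12 + (7360)*l^13 + (-1920)*l^14 + (256)*l^15) * h) := by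
    rw [h_p12, h_t]; linear_combination ((((60)*l^3 + (-246)*l^4 + (522)*l^5 + (-712)*l^6 + (656)*l^7 + (-408)*l^8 + (160)*l^9 + (-32)*l^10) * ((-2)*l^1 + (2)*l^2)) : ℝ) * hD
  have h_ttp3 : (t * t) * p3 = ((4)*l^3 + (-94)*l^4 + (876)*l^5 + (-4487)*l^6 + (15540)*l^7 + (-39914)*l^8 + (79888)*l^9 + (-128151)*l^10 + (167352)*l^11 + (-179174)*l^12 + (157300)*l^13 + (-112496)*l^14 + (64576)*l^15 + (-28960)*l^16 + (9664)*l^17 + (-2176)*l^18 + (256)*l^19 + ((2)*l^3 + (-44)*l^4 + (368)*l^5 + (-1602)*l^6 + (4598)*l^7 + (-9580)*l^8 + (15176)*l^9 + (-18694)*l^10 + (18032)*l^11 + (-13536)*l^12 + (7744)*l^13 + (-3232)*l^14 + (896)*l^15 + (-128)*l^16) * h) := by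
    rw [h_tt, h_p3]; linear_combination ((((-4)*l^1 + (28)*l^2 + (-68)*l^3 + (100)*l^4 + (-96)*l^5 + (56)*l^6 + (-16)*l^7) * ((2)*l^3 + (-4)*l^4 + (4)*l^5 + (-2)*l^6)) : ℝ) * hD
  have h_ttp2 : (t * t) * p2 = ((12)*l^2 + (-282)*l^3 + (2625)*l^4 + (-13382)*l^5 + (45900)*l^6 + (-116294)*l^7 + (228813)*l^8 + (-359642)*l^9 + (458734)*l^10 + (-478240)*l^11 + (407576)*l^12 + (-282080)*l^13 + (156192)*l^14 + (-67328)*l^15 + (21504)*l^16 + (-4608)*l^17 + (512)*l^18 + ((6)*l^2 + (-132)*l^3 + (1102)*l^4 + (-4768)*l^5 + (13494)*l^6 + (-27544)*l^7 + (42526)*l^8 + (-50796)*l^9 + (47264)*l^10 + (-34048)*l^11 + (18592)*l^12 + (-7360)*l^13 + (1920)*l^14 + (-256)*l^15) * h) := by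
    rw [h_tt, h_p2]; linear_combination ((((-4)*l^1 + (28)*l^2 + (-68)*l^3 + (100)*l^4 + (-96)*l^5 + (56)*l^6 + (-16)*l^7) * ((6)*l^2 + (-12)*l^3 + (10)*l^4 + (-4)*l^5)) : ℝ) * hD
  have h_tp1 : p1 * t = ((6)*l^1 + (-63)*l^2 + (226)*l^3 + (-511)*l^4 + (800)*l^5 + (-904)*l^6 + (736)*l^7 + (-424)*l^8 + (160)*l^9 + (-32)*l^10 + ((2)*l^1 + (-26)*l^2 + (68)*l^3 + (-100)*l^4 + (96)*l^5 + (-56)*l^6 + (16)*l^7) * h) := by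
    rw [h_p1, h_t]; linear_combination ((((2)*l^1 + (-2)*l^2) * ((-2)*l^1 + (2)*l^2)) : ℝ) * hD
  have h_tp3 : p3 * t = ((4)*l^3 + (-54)*l^4 + (252)*l^5 + (-721)*l^6 + (1442)*l^7 + (-2135)*l^8 + (2398)*l^9 + (-2052)*l^10 + (1320)*l^11 + (-616)*l^12 + (192)*l^13 + (-32)*l^14 + ((2)*l^3 + (-24)*l^4 + (86)*l^5 + (-182)*l^6 + (258)*l^7 + (-252)*l^8 + (168)*l^9 + (-72)*l^10 + (16)*l^11) * h) := by
    rw [h_p3, h_t]; linear_combination ((((2)*l^3 + (-4)*l^4 + (4)*l^5 + (-2)*l^6) * ((-2)*l^1 + (2)*l^2)) : ℝ) * hD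
  have h_ttp13 : (p1 * p3 * t) * t = ((40)*l^4 + (-1024)*l^5 + (10846)*l^6 + (-65982)*l^7 + (276157)*l^8 + (-870170)*l^9 + (2172556)*l^10 + (-4434578)*l^11 + (7549249)*l^12 + (-10854854)*l^13 + (13282748)*l^14 + (-13881392)*l^15 + (12390016)*l^16 + (-9412384)*l^17 + (6040768)*l^18 + (-3234560)*l^19 + (1416576)*l^20 + (-491520)*l^21 + (128000)*l^22 + (-22528)*l^23 + (2048)*l^24 + ((20)*l^4 + (-482)*l^5 + (4660)*l^6 + (-25022)*l^7 + (90864)*l^8 + (-245250)*l^9 + (517904)*l^10 + (-881686)*l^11 + (1231488)*l^12 + (-1424416)*l^13 + (1368400)*l^14 + (-1088768)*l^15 + (710976)*l^16 + (-374528)*l^17 + (154496)*l^18 + (-47360)*l^19 + (9728)*l^20 + (-1024)*l^21) * h) := by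
    rw [h_tp13, h_t]; linear_combination ((((20)*l^4 + (-282)*l^5 + (1420)*l^6 + (-4340)*l^7 + (9328)*l^8 + (-15008)*l^9 + (18622)*l^10 + (-18016)*l^11 + (13536)*l^12 + (-7744)*l^13 + (3232)*l^14 + (-896)*l^15 + (128)*l^16) * ((-2)*l^1 + (2)*l^2)) : ℝ) * hD
  have h_tttp3 : (t * t * p3) * t = ((4)*l^3 + (-134)*l^4 + (1900)*l^5 + (-15333)*l^6 + (81522)*l^7 + (-316071)*l^8 + (950058)*l^9 + (-2300707)*l^10 + (4601930)*l^11 + (-7728423)*l^12 + (11012154)*l^13 + (-13395244)*l^14 + (13945968)*l^15 + (-12418976)*l^16 + (9422048)*l^17 + (-6042944)*l^18 + (3234816)*l^19 + (-1416576)*l^20 + (491520)*l^21 + (-128000)*l^22 + (22528)*l^23 + (-2048)*l^24 + ((2)*l^3 + (-64)*l^4 + (850)*l^5 + (-6262)*l^6 + (29620)*l^7 + (-100444)*l^8 + (260426)*l^9 + (-536598)*l^10 + (899718)*l^11 + (-1245024)*l^12 + (1432160)*l^13 + (-1371632)*l^14 + (1089664)*l^15 + (-711104)*l^16 + (374528)*l^17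 + (-154496)*l^18 + (47360)*l^19 + (-9728)*l^20 + (1024)*l^21) * h) := by
    rw [h_ttp3, h_t]; linear_combination ((((2)*l^3 + (-44)*l^4 + (368)*l^5 + (-1602)*l^6 + (4598)*l^7 + (-9580)*l^8 + (15176)*l^9 + (-18694)*l^10 + (18032)*l^11 + (-13536)*l^12 + (7744)*l^13 + (-3232)*l^14 + (896)*l^15 + (-128)*l^16) * ((-2)*l^1 + (2)*l^2)) : ℝ) * hD
  have h_NN : p3^2+t*p3*p2+l^2*(p2^2-2*p1*p3)+t^2*p3*p1+t*l^2*(p1*p2-3*p3)+l^4*(p1^2-2*p2)+t^3*p3+t^2*l^2*p2+t*l^4*p1+l^6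
      = ((4)*l^3 + (-82)*l^4 + (804)*l^5 + (-4998)*l^6 + (22200)*l^7 + (-74852)*l^8 + (198968)*l^9 + (-427420)*l^10 + (754404)*l^11 + (-1106058)*l^12 + (1356004)*l^13 + (-1394238)*l^14 + (1201440)*l^15 + (-863520)*l^16 + (512512)*l^17 + (-246848)*l^18 + (93696)*l^19 + (-26624)*l^20 + (5120)*l^21 + (-512)*l^22 + ((2)*l^3 + (-38)*l^4 + (340)*l^5 + (-1912)*l^6 + (7524)*l^7 + (-22060)*l^8 + (49912)*l^9 + (-89072)*l^10 + (127162)*l^11 + (-146398)*l^12 + (136228)*l^13 + (-102024)*l^14 + (60720)*l^15 + (-28000)*l^16 + (9536)*l^17 + (-2176)*l^18 + (256)*l^19) * h) := by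
    linear_combination h_p33 + h_tp32 + l^2 * h_p22 - 2 * l^2 * h_p13 + h_ttp13 + l^2 * h_tp12 - 3 * l^2 * h_tp3 + l^4 * h_p11 - 2 * l^4 * h_p2 + h_tttp3 + l^2 * h_ttp2 + l^4 * h_tp1
  have h_ob : (1 - be) ^ 2 = ((1) + (-8)*l^1 + (60)*l^2 + (-280)*l^3 + (910)*l^4 + (-2184)*l^5 + (4004)*l^6 + (-5720)*l^7 + (6433)*l^8 + (-5712)*l^9 + (3976)*l^10 + (-2128)*l^11 + (840)*l^12 + (-224)*l^13 + (32)*l^14 + ((-4)*l^1 + (24)*l^2 + (-96)*l^3 + (260)*l^4 + (-492)*l^5 + (672)*l^6 + (-672)*l^7 + (492)*l^8 + (-256)*l^9 + (88)*l^10 + (-16)*l^11) * h) := by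
    rw [h_be]; linear_combination ((((2)*l^1 + (-4)*l^2 + (4)*l^3 + (-2)*l^4) ^ 2 : ℝ)) * hD
  rw [h_NN, h_ob, h_br, h_T]
  linear_combination ((2 * ((-2) + (-4)*l^1) * ((2)*l^3 + (-38)*l^4 + (340)*l^5 + (-1912)*l^6 + (7524)*l^7 + (-22060)*l^8 + (49912)*l^9 + (-89072)*l^10 + (127162)*l^11 + (-146398)*l^12 + (136228)*l^13 + (-102024)*l^14 + (60720)*l^15 + (-28000)*l^16 + (9536)*l^17 + (-2176)*l^18 + (256)*l^19) - 8 * l^2 * ((-4)*l^1 + (24)*l^2 + (-96)*l^3 + (260)*l^4 + (-492)*l^5 + (672)*l^6 + (-672)*l^7 + (492)*l^8 + (-256)*l^9 + (88)*l^10 + (-16)*l^11) * ((-2)*l^1 + (6)*l^2 + (2)*l^3 + (-34)*l^4 + (52)*l^5 + (-40)*l^6 + (16)*l^7)) : ℝ) * hD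
end

section
noncomputable def cof (l h T v : ℝ) : ℝ :=
  (49/4) * (1 - l*(7*T+1)/2) * (T - (3-8*l+6*l^2-4*l^3-2*h)/7)
  + (343/64) * (7*T^2-1+2*T*(l^4-(1-l)^4)+4*T*(2*l-1)) * (T - (3-8*l+6*l^2-4*l^3-2*h)/7)
  + (49/4) * (l^2-v^2) * (T + (3-8*l+6*l^2-4*l^3+2*h)/7) + (-7*l*(1-l/2)-7*l^4/2+7*l^5)

theorem core_alg (l h T u v d d' R1 R2 R4 S1 S2 S4 : ℝ)
    (hD : h^2 = 4-12*l+25*l^2-30*l^3+25*l^4-12*l^5+4*l^6)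
    (hbe : u^2 = (4*l-14*l^2+28*l^3-35*l^4+28*l^5-14*l^6+4*l^7) + (2*l-4*l^2+4*l^3-2*l^4)*h) (hbp : v^2 = (4*l-14*l^2+28*l^3-35*l^4+28*l^5-14*l^6+4*l^7) - (2*l-4*l^2+4*l^3-2*l^4)*h)
    (huv : u*v = l^4) (hdd : d*d' = (1-l)^4) (hu : u^2+d^2=1) (hv : v^2+d'^2=1)
    (e1R : R1+R2+R4 = -(7*v*T+u)/2) (e3R : R1*R2*R4 = u*l)
    (e1S : S1+S2+S4 = (7*d'*T-d)/2) (e2S : S1*S2+S2*S4+S4*S1 = (1-l)*(7*T-1)/2)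
    (e3S : S1*S2*S4 = d*(1-l)) (q1 : S1^2+R1^2=1) (q2 : S2^2+R2^2=1) (q4 : S4^2+R4^2=1)
    (hc : cof l h T v ≠ 0) :
    (7*(1-(1+2*l)*T)-4) * ((R1^4+(1-(R1^2+R2^2+R4^2))*R1^2+l^2)*(R2^4+(1-(R1^2+R2^2+R4^2))*R2^2+l^2)
      *(R4^4+(1-(R1^2+R2^2+R4^2))*R4^2+l^2)) =
    8*d^4*l^2*(u*(R1+R2+R4) - u*(R1+R2+R4)*(R1*R2+R2*R4+R4*R1) + 3*u*(R1*R2*R4) + l*(R1*R2+R2*R4+R4*R1)) := by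
  obtain ⟨ε, hε⟩ : ∃ ε, ε = R1*R2+R2*R4+R4*R1 := ⟨_, rfl⟩
  have X4 : (R1+R2+R4)^2 = (49*v^2*T^2+14*l^4*T+u^2)/4 := by
    rw [e1R]; linear_combination (7/2)*T*huv
  have Y4 : (S1+S2+S4)^2 = (49*d'^2*T^2-14*(1-l)^4*T+d^2)/4 := by
    rw [e1S]; linear_combination -(7/2)*T*hdd
  have E3 : 2*ε = (7/4)*(7*T^2-1+2*T*(l^4-(1-l)^4)+4*T*(2*l-1)) - l*(7*T+1) := by
    rw [hε]
    linear_combination X4 + Y4 - q1 - q2 - q4 - 2*e2S + (1/4)*hu + (49/4)*T^2*hv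
  have P1 : R1^2+R2^2+R4^2 = (49*v^2*T^2+14*l^4*T+u^2)/4 - 2*ε := by
    rw [hε, ← X4]; ring
  have P2 : R1^2*R2^2+R2^2*R4^2+R4^2*R1^2 = ε^2 + l*(7*l^4*T+u^2) := by
    rw [hε]
    linear_combination -2*(R1+R2+R4)*e3R - 2*u*l*e1R + 7*l*T*huv
  have P3 : R1^2*R2^2*R4^2 = u^2*l^2 := by
    linear_combination (R1*R2*R4+u*l)*e3R
  have pr : (1-R1^2)*(1-R2^2)*(1-R4^2) = d^2*(1-l)^2 := by
    have z1 : 1-R1^2=S1^2 := by linarith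
    have z2 : 1-R2^2=S2^2 := by linarith
    have z4 : 1-R4^2=S4^2 := by linarith
    rw [z1, z2, z4]
    linear_combination (S1*S2*S4+d*(1-l))*e3S
  have prod3 : (1+ε)^2 - (49*v^2*T^2+14*l^4*T+u^2)/4 + l*(7*l^4*T+u^2) - u^2*l^2 - (1-u^2)*(1-l)^2 = 0 := by
    linear_combination pr + P1 - P2 + P3 + (1-l)^2*hu
  have eε : ε = -l*(7*T+1)/2 + (7/8)*(7*T^2-1+2*T*(l^4-(1-l)^4)+4*T*(2*l-1)) := by linear_combination E3/2
  have fac : (T - ((3-8*l+6*l^2-4*l^3)+2*h)/7) * cof l h T v = 0 := by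
    unfold cof
    rw [eε, hbe, hbp] at prod3
    rw [hbp]
    have hg : 7*T^2-1+2*T*(l^4-(1-l)^4)+4*T*(2*l-1) = 7*(T-((3-8*l+6*l^2-4*l^3)+2*h)/7)*(T-((3-8*l+6*l^2-4*l^3)-2*h)/7) := by
      linear_combination (4/7)*hD
    linear_combination prod3 - ((2*l-4*l^2+4*l^3-2*l^4)*h-(4*l-14*l^2+28*l^3-35*l^4+28*l^5-14*l^6+4*l^7)+(3-8*l+6*l^2-4*l^3)*(2*l-4*l^2+4*l^3-2*l^4)+l^2)*hD - ((49/64)*(7*T^2-1+2*T*(l^4-(1-l)^4)+4*T*(2*l-1)) + (7/4)*(1-l*(7*T+1)/2))*hg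
  have hT : T = ((3-8*l+6*l^2-4*l^3)+2*h)/7 := by
    have := (mul_eq_zero.mp fac).resolve_right hc
    linear_combination this
  have hg0 : 7*T^2-1+2*T*(l^4-(1-l)^4)+4*T*(2*l-1) = 0 := by
    rw [hT]; linear_combination (4/7)*hD
  have eε2 : ε = ((-2)*l^1 + (4)*l^2 + (-3)*l^3 + (2)*l^4 + ((-1)*l^1) * h) := by
    rw [eε, hg0, hT]; ring
  have rp1 : R1^2+R2^2+R4^2 = ((6)*l^1 + (-11)*l^2 + (14)*l^3 + (-10)*l^4 + (4)*l^5 + ((2)*l^1 + (-2)*l^2) * h) := by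
    rw [P1, eε2, hbe, hbp, hT]
    linear_combination (-(2*l-4*l^2+4*l^3-2*l^4)*h+(4*l-14*l^2+28*l^3-35*l^4+28*l^5-14*l^6+4*l^7)-(3-8*l+6*l^2-4*l^3)*(2*l-4*l^2+4*l^3-2*l^4))*hD
  have rp2 : R1^2*R2^2+R2^2*R4^2+R4^2*R1^2 = ((12)*l^2 + (-42)*l^3 + (81)*l^4 + (-94)*l^5 + (70)*l^6 + (-32)*l^7 + (8)*l^8 + ((6)*l^2 + (-12)*l^3 + (10)*l^4 + (-4)*l^5) * h) := by
    rw [P2, eε2, hbe, hT]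
    linear_combination l^2*hD
  have rbr : 2*(u*(R1+R2+R4) - u*(R1+R2+R4)*ε + 3*u*(R1*R2*R4) + l*ε) = ((-4)*l^1 + (18)*l^2 + (-20)*l^3 + (-44)*l^4 + (208)*l^5 + (-374)*l^6 + (408)*l^7 + (-288)*l^8 + (128)*l^9 + (-32)*l^10 + ((-2)*l^1 + (6)*l^2 + (2)*l^3 + (-34)*l^4 + (52)*l^5 + (-40)*l^6 + (16)*l^7) * h) := by
    have k1 : 2*u*(R1+R2+R4) = -((4)*l^1 + (-14)*l^2 + (28)*l^3 + (-32)*l^4 + (20)*l^5 + (-8)*l^6 + ((2)*l^1 + (-4)*l^2 + (4)*l^3) * h) := by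
      rw [e1R]
      rw [hT] 
      linear_combination -((3-8*l+6*l^2-4*l^3)+2*h)*huv - hbe
    rw [e3R]
    have : 2*(u*(R1+R2+R4) - u*(R1+R2+R4)*ε + 3*u*(u*l) + l*ε) = 2*u*(R1+R2+R4)*(1-ε) + 6*u^2*l+2*l*ε := by ring
    rw [this, k1, hbe, eε2]
    linear_combination (-((2)*l^1 + (-4)*l^2 + (4)*l^3)*l)*hD
  have key := NN_alg l h (u^2) T (R1^2+R2^2+R4^2) (R1^2*R2^2+R2^2*R4^2+R4^2*R1^2) (R1^2*R2^2*R4^2) (1-(R1^2+R2^2+R4^2)) _ hD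
    (by rw [hbe]; ring) (by rw [hT]; ring) rp1 rp2 P3 rfl rbr
  have hd4 : (1-u^2)^2 = d^4 := by rw [← hu]; ring
  rw [hd4] at key
  rw [← hε]
  linear_combination key/2
end

section
set_option maxHeartbeats 4000000 in
theorem norm_lem (x1 x2 x4 w1 w2 w4 y1 y2 y4 a2 a3 a4 A2 A3 A4 l : ℝ)
    (hx1 : 0 < x1) (hx2 : 0 < x2) (hx4 : 0 < x4) (hy1 : 0 < y1) (hy2 : 0 < y2) (hy4 : 0 < y4)
    (ha2 : 0 < a2) (ha3 : 0 < a3) (ha4 : 0 < a4) (hA2 : 0 < A2) (hA3 : 0 < A3) (hA4 : 0 < A4)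
    (hlt : A2 * a3 < a2 * A3)
    (hl : l = a2*(w1*w2*w4)/(a3*(x1*x2*x4)))
    (c1 : a3^4 = a2^4 + a4^4) (C1 : A3^4 = A2^4 + A4^4)
    (q1 : a3^2*x1^2 = a4^2*y1^2 + a2^2*w1^2)
    (q2 : a3^2*x2^2 = a4^2*y2^2 + a2^2*w2^2)
    (q4 : a3^2*x4^2 = a4^2*y4^2 + a2^2*w4^2)
    (s1 : a4^4*x1*x2 = a3^2*x2^2*x4^2 - a2^2*(x2^2*w4^2+w2^2*x4^2) + a3^2*w2^2*w4^2)
    (s2 : a4^4*x2*x4 = a3^2*x4^2*x1^2 - a2^2*(x4^2*w1^2+w4^2*x1^2) + a3^2*w4^2*w1^2)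
    (s4 : a4^4*x4*x1 = a3^2*x1^2*x2^2 - a2^2*(x1^2*w2^2+w1^2*x2^2) + a3^2*w1^2*w2^2)
    (r4 : a3*(x1*x2*x4) = a4*(y1*y2*y4) + a2*(w1*w2*w4))
    (r5 : a4*(y1*y2*y4)^2*A3 = a3*(x1*x2*x4)^2*A4)
    (r5' : a2*(w1*w2*w4)^2*A3 = a3*(x1*x2*x4)^2*A2)
    (t1 : 2*a2*a3*(w1/x1+w2/x2+w4/x4) = -(7*A2^2+a2^2))
    (t2 : 2*a3*a4*(y1/x1+y2/x2+y4/x4) = 7*A4^2-a4^2)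
    (t3 : 2*a3*a4*(x1/y1+x2/y2+x4/y4) = 7*A3^2-a3^2)
    (hc : cof l (Real.sqrt (4-12*l+25*l^2-30*l^3+25*l^4-12*l^5+4*l^6)) (A3^2/a3^2) (A2^2/A3^2) ≠ 0) :
    0 < l ∧ l^2*(a3*A3) = a2*A2 ∧
    (3*a3^2-7*(1+2*l)*A3^2)*(a2*a3) = 8*(w1*x1^2*x2+w2*x2^2*x4+w4*x4^2*x1) := by
  have l2 : l^2 = a2*A2/(a3*A3) := by
    rw [hl]; field_simp; linear_combination r5'
  have ml : 1 - l = a4*(y1*y2*y4)/(a3*(x1*x2*x4)) := by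
    rw [hl]; field_simp; linear_combination r4
  have ml2 : (1-l)^2 = a4*A4/(a3*A3) := by
    rw [ml]; field_simp; linear_combination r5
  have ml0 : 0 < 1 - l := by rw [ml]; positivity
  obtain ⟨u, hu⟩ : ∃ u, u = a2^2/a3^2 := ⟨_, rfl⟩
  obtain ⟨v, hv⟩ : ∃ u, u = A2^2/A3^2 := ⟨_, rfl⟩
  obtain ⟨d, hd⟩ : ∃ u, u = a4^2/a3^2 := ⟨_, rfl⟩
  obtain ⟨d', hd'⟩ : ∃ u, u = A4^2/A3^2 := ⟨_, rfl⟩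
  obtain ⟨T, hT⟩ : ∃ u, u = A3^2/a3^2 := ⟨_, rfl⟩
  have u0 : 0 < u := by rw [hu]; positivity
  have v0 : 0 < v := by rw [hv]; positivity
  have huv : u*v = l^4 := by
    rw [show l^4 = (l^2)^2 by ring, l2, hu, hv]; field_simp
  have hdd : d*d' = (1-l)^4 := by
    rw [show (1-l)^4 = ((1-l)^2)^2 by ring, ml2, hd, hd']; field_simp
  have hud : u^2+d^2 = 1 := by
    rw [hu, hd]; field_simp; linear_combination -c1
  have hvd : v^2+d'^2 = 1 := by
    rw [hv, hd']; field_simp; linear_combination -C1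
  have hvu : v < u := by
    rw [hu, hv, div_lt_div_iff₀ (by positivity) (by positivity)]
    have := pow_lt_pow_left₀ hlt (by positivity) (n := 2) (by norm_num)
    rw [mul_pow, mul_pow] at this
    linarith
  have hB : u^2+v^2 = 1 + l^8 - (1-l)^8 := by
    have h1 : u^2*v^2 = l^8 := by linear_combination (u*v+l^4)*huv
    have h2 : d^2*d'^2 = (1-l)^8 := by linear_combination (d*d'+(1-l)^4)*hdd
    linear_combination h1 - h2 + d'^2*hud + (1-u^2)*hvd
  have l0 : 0 < l := by
    by_contra hneg
    push Not at hneg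
    obtain ⟨m, rfl⟩ : ∃ m, l = -m := ⟨-l, by ring⟩
    have m0 : 0 ≤ m := by linarith
    have : 0 < u^2+v^2 := by positivity
    have e : (1 - -m)^8 = 1 + m^8 + (8*m+28*m^2+56*m^3+70*m^4+56*m^5+28*m^6+8*m^7) := by ring
    have : 0 ≤ 8*m+28*m^2+56*m^3+70*m^4+56*m^5+28*m^6+8*m^7 := by positivity
    have e2 : (-m)^8 = m^8 := by ring
    linarith
  have L2 : l^2*(a3*A3) = a2*A2 := by rw [l2]; field_simp
  refine ⟨l0, L2, ?_⟩
  obtain ⟨D, hD⟩ : ∃ D, D = 4-12*l+25*l^2-30*l^3+25*l^4-12*l^5+4*l^6 := ⟨_, rfl⟩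
  obtain ⟨g, hg⟩ : ∃ g, g = 2*l-4*l^2+4*l^3-2*l^4 := ⟨_, rfl⟩
  have g0 : 0 < g := by
    have : g = 2*(l*(1-l))*((1-l)+l^2) := by rw [hg]; ring
    rw [this]; positivity
  have hgD : (2*g)^2*D = (u^2-v^2)^2 := by
    have h1 : u^2*v^2 = l^8 := by linear_combination (u*v+l^4)*huv
    have : (u^2-v^2)^2 = (u^2+v^2)^2-4*(u^2*v^2) := by ring
    rw [this, hB, h1, hg, hD]; ring
  have D0 : 0 ≤ D := by
    by_contra hn
    push Not at hn
    have h3 := mul_neg_of_pos_of_neg (show 0 < (2*g)^2 by positivity) hn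
    rw [hgD] at h3
    exact absurd (sq_nonneg _) (not_le.mpr h3)
  rw [← hD] at hc
  obtain ⟨h, hh⟩ : ∃ h, h = Real.sqrt D := ⟨_, rfl⟩
  have h2 : h^2 = D := by rw [hh]; exact Real.sq_sqrt D0
  have h0 : 0 ≤ h := by rw [hh]; exact Real.sqrt_nonneg _
  have hgh : 2*g*h = u^2-v^2 := by
    have p1 : 0 ≤ u^2-v^2 := sub_nonneg.mpr (pow_le_pow_left₀ v0.le hvu.le 2)
    have p2 : 0 ≤ 2*g*h := by positivity
    refine (pow_left_inj₀ p2 p1 (n := 2) (by norm_num)).mp ?_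
    rw [← hgD, ← h2]; ring
  rw [← hh, ← hT, ← hv] at hc
  obtain ⟨R1, hR1⟩ : ∃ R, R = a2*w1/(a3*x1) := ⟨_, rfl⟩
  obtain ⟨R2, hR2⟩ : ∃ R, R = a2*w2/(a3*x2) := ⟨_, rfl⟩
  obtain ⟨R4, hR4⟩ : ∃ R, R = a2*w4/(a3*x4) := ⟨_, rfl⟩
  have e1R : R1+R2+R4 = -(7*v*T+u)/2 := by
    have : R1+R2+R4 = (2*a2*a3*(w1/x1+w2/x2+w4/x4))/(2*a3^2) := by
      rw [hR1,hR2,hR4]; field_simp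
    rw [this, t1, hv, hT, hu]; field_simp
  have e3R : R1*R2*R4 = u*l := by
    rw [hR1,hR2,hR4,hu,hl]; field_simp
  have qq1 : (a4*y1/(a3*x1))^2+R1^2 = 1 := by
    rw [hR1]; field_simp; linear_combination -q1
  have qq2 : (a4*y2/(a3*x2))^2+R2^2 = 1 := by
    rw [hR2]; field_simp; linear_combination -q2
  have qq4 : (a4*y4/(a3*x4))^2+R4^2 = 1 := by
    rw [hR4]; field_simp; linear_combination -q4
  have e3S : (a4*y1/(a3*x1))*(a4*y2/(a3*x2))*(a4*y4/(a3*x4)) = d*(1-l) := by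
    rw [hd, ml]; field_simp
  have e1S : (a4*y1/(a3*x1))+(a4*y2/(a3*x2))+(a4*y4/(a3*x4)) = (7*d'*T-d)/2 := by
    have : (a4*y1/(a3*x1))+(a4*y2/(a3*x2))+(a4*y4/(a3*x4)) = (2*a3*a4*(y1/x1+y2/x2+y4/x4))/(2*a3^2) := by
      field_simp
    rw [this, t2, hd', hT, hd]; field_simp
  have e2S : (a4*y1/(a3*x1))*(a4*y2/(a3*x2))+(a4*y2/(a3*x2))*(a4*y4/(a3*x4))+(a4*y4/(a3*x4))*(a4*y1/(a3*x1))
      = (1-l)*(7*T-1)/2 := by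
    have : (a4*y1/(a3*x1))*(a4*y2/(a3*x2))+(a4*y2/(a3*x2))*(a4*y4/(a3*x4))+(a4*y4/(a3*x4))*(a4*y1/(a3*x1))
      = (a4*(y1*y2*y4)/(a3*(x1*x2*x4))) * (2*a3*a4*(x1/y1+x2/y2+x4/y4)) / (2*a3^2) := by
      field_simp; ring
    rw [this, t3, ← ml, hT]; field_simp
  have core := core_alg l h T u v d d' R1 R2 R4 _ _ _ (by rw [h2, hD])
    (by rw [← hg]; linear_combination (1/2)*hB - hgh/2)
    (by rw [← hg]; linear_combination (1/2)*hB + hgh/2) huv hdd hud hvd e1R e3R e1S e2S e3S qq1 qq2 qq4 hc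
  have c0 : 0 < a3^2 := by positivity
  have hh3 : R1^2*R2^2*R4^2 = u^2*l^2 := by rw [← mul_pow, ← mul_pow, e3R, mul_pow]
  have fgen : ∀ (X1 X2 X4 W2 W4 r1 r2 r4 : ℝ), X2 ≠ 0 → X4 ≠ 0 → r2 = a2*W2/(a3*X2) → r4 = a2*W4/(a3*X4) →
      r1^2*r2^2*r4^2 = u^2*l^2 →
      a4^4*X1*X2 = a3^2*X2^2*X4^2 - a2^2*(X2^2*W4^2+W2^2*X4^2) + a3^2*W2^2*W4^2 →
      r1^4+(1-(r1^2+r2^2+r4^2))*r1^2+l^2 = a4^4*X1*r1^2/(a3^2*(X2*X4^2)) := by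
    intro X1 X2 X4 W2 W4 r1 r2 r4 h2 h4 e2 e4 e3 es
    have k : a4^4*X1/(a3^2*(X2*X4^2)) = 1 - (r2^2+r4^2) + r2^2*r4^2/u^2 := by
      have : a4^4*X1/(a3^2*(X2*X4^2)) = a4^4*X1*X2/(a3^2*(X2^2*X4^2)) := by field_simp
      rw [this, es, e2, e4, hu]; field_simp; ring
    have k2 : a4^4*X1*r1^2/(a3^2*(X2*X4^2)) = r1^2*(a4^4*X1/(a3^2*(X2*X4^2))) := by ring
    have k3 : l^2 = r1^2*(r2^2*r4^2/u^2) := by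
      rw [← mul_div_assoc, ← mul_assoc, e3]; field_simp
    rw [k2, k, k3]; ring
  have f1 := fgen x1 x2 x4 w2 w4 R1 R2 R4 hx2.ne' hx4.ne' hR2 hR4 hh3 s1
  have f2 := fgen x2 x4 x1 w4 w1 R2 R4 R1 hx4.ne' hx1.ne' hR4 hR1 (by linarith) s2
  have f4 := fgen x4 x1 x2 w1 w2 R4 R1 R2 hx1.ne' hx2.ne' hR1 hR2 (by linarith) s4
  rw [show R2^2+R4^2+R1^2 = R1^2+R2^2+R4^2 by ring] at f2
  rw [show R4^2+R1^2+R2^2 = R1^2+R2^2+R4^2 by ring] at f4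
  have hNN : a4^4*x1*R1^2/(a3^2*(x2*x4^2)) * (a4^4*x2*R2^2/(a3^2*(x4*x1^2))) * (a4^4*x4*R4^2/(a3^2*(x1*x2^2)))
      = a4^12*(u^2*l^2)/(a3^6*(x1*x2*x4)^2) := by
    rw [← hh3]; field_simp
  rw [f1, f2, f4, hNN] at core
  have w1e : w1 = R1*a3*x1/a2 := by rw [hR1]; field_simp
  have w2e : w2 = R2*a3*x2/a2 := by rw [hR2]; field_simp
  have w4e : w4 = R4*a3*x4/a2 := by rw [hR4]; field_simp
  have hS : (w1*x1^2*x2+w2*x2^2*x4+w4*x4^2*x1)*a4^4 = (x1*x2*x4)^2*(a3^5/a2^3)*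
     (u*(R1+R2+R4) - u*(R1+R2+R4)*(R1*R2+R2*R4+R4*R1) + 3*u*(R1*R2*R4) + l*(R1*R2+R2*R4+R4*R1)) := by
    have : (w1*x1^2*x2+w2*x2^2*x4+w4*x4^2*x1)*a4^4 = w1*x1*(a4^4*x1*x2)+w2*x2*(a4^4*x2*x4)+w4*x4*(a4^4*x4*x1) := by ring
    rw [this, s1, s2, s4]
    have lu : l = R1*R2*R4/u := by rw [e3R]; field_simp
    rw [lu, w1e, w2e, w4e, hu]; field_simp; ring
  generalize (u*(R1+R2+R4) - u*(R1+R2+R4)*(R1*R2+R2*R4+R4*R1) + 3*u*(R1*R2*R4) + l*(R1*R2+R2*R4+R4*R1)) = br at core hS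
  generalize (w1*x1^2*x2+w2*x2^2*x4+w4*x4^2*x1) = S at hS ⊢
  have hbr : br = S*a4^4*a2^3/((x1*x2*x4)^2*a3^5) := by rw [hS]; field_simp
  rw [hbr, hT, hd, hu] at core
  have hQ : 0 < x1*x2*x4 := by positivity
  generalize x1*x2*x4 = Q at core hQ
  field_simp at core
  linear_combination core
end

section
open Filter Topology

theorem conj_tsum' (f : ℤ → ℂ) : (starRingEnd ℂ) (∑' n, f n) = ∑' n, (starRingEnd ℂ) (f n) :=
  Complex.conjCLE.map_tsum

theorem conj_tm (r : ℝ) (z : ℂ) (hz : ‖z‖ = 1) (m : ℤ) : (starRingEnd ℂ) (tm r z m) = tm r z⁻¹ m := by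
  unfold tm
  rw [map_mul, map_zpow₀, map_zpow₀, Complex.conj_ofReal, Complex.inv_eq_conj hz]

theorem tE_re (r : ℝ) (z : ℂ) (hz : ‖z‖ = 1) : tE r z = ((tE r z).re : ℂ) := by
  refine (Complex.conj_eq_iff_re.mp ?_).symm
  rw [← tE_inv (r : ℂ) z]
  conv_lhs => rw [tE_inv]
  unfold tE
  rw [conj_tsum']
  exact tsum_congr fun n => conj_tm r z hz _

theorem tO_re (r : ℝ) (z : ℂ) (hz : ‖z‖ = 1) : tO r z = ((tO r z).re : ℂ) := by
  refine (Complex.conj_eq_iff_re.mp ?_).symm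
  rw [← tO_inv (r : ℂ) z]
  conv_lhs => rw [tO_inv]
  unfold tO
  rw [conj_tsum']
  exact tsum_congr fun n => conj_tm r z hz _

theorem tF_re (r : ℝ) (z : ℂ) (hz : ‖z‖ = 1) : tF r z = ((tF r z).re : ℂ) := by
  refine (Complex.conj_eq_iff_re.mp ?_).symm
  rw [← tF_inv (r : ℂ) z]
  conv_lhs => rw [tF_inv]
  unfold tF
  rw [conj_tsum']
  refine tsum_congr fun n => ?_
  rw [map_mul, conj_tm r z hz _]
  simp

theorem tri (r x y A B : ℂ) (hr : r ≠ 0) (hr1 : ‖r‖ < 1) (hx : x ≠ 0) (hy : y ≠ 0)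
    (hA : x * y = A ∨ x * y = A⁻¹) (hB : x / y = B ∨ x / y = B⁻¹) :
    tE r x * tE r y = tE (r^2) A * tE (r^2) B + tO (r^2) A * tO (r^2) B ∧
    tF r x * tF r y = tE (r^2) A * tE (r^2) B - tO (r^2) A * tO (r^2) B ∧
    tO r x * tO r y = tO (r^2) A * tE (r^2) B + tE (r^2) A * tO (r^2) B := by
  have e1 : tE (r^2) (x*y) = tE (r^2) A ∧ tO (r^2) (x*y) = tO (r^2) A := by
    rcases hA with h | h <;> rw [h] <;> simp [tE_inv, tO_inv]
  have e2 : tE (r^2) (x/y) = tE (r^2) B ∧ tO (r^2) (x/y) = tO (r^2) B := by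
    rcases hB with h | h <;> rw [h] <;> simp [tE_inv, tO_inv]
  rw [P33 hr hr1 hx hy, P44 hr hr1 hx hy, P22 hr hr1 hx hy, e1.1, e1.2, e2.1, e2.2]
  exact ⟨rfl, rfl, rfl⟩

theorem tE_bd (r : ℝ) (hr : 0 < r) (hr1 : r^4 ≤ 1/64) (z : ℂ) (hz : ‖z‖ = 1) :
    |(tE r z).re - 1| ≤ 3*r^4 ∧ |(tF r z).re - 1| ≤ 3*r^4 := by
  have n : ‖(r:ℂ)^4‖ = r^4 := by rw [norm_pow, Complex.norm_real, Real.norm_of_nonneg hr.le]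
  have b : 2 * (1 * r^4 / (1-r^4)) ≤ 3 * r^4 := by
    have : 1 * r^4/(1-r^4) ≤ r^4 * (64/63) := by
      rw [div_le_iff₀ (by linarith)]
      nlinarith [pow_pos hr 4]
    linarith [pow_pos hr 4]
  have gen : ∀ X : ℂ, ‖X‖ = 1 → |(th ((r:ℂ)^4) X).re - 1| ≤ 3 * r^4 := by
    intro X hX
    have := th_near ((r:ℂ)^4) X (by rw [n]; linarith) hX
    rw [n] at this
    refine le_trans ?_ (this.trans b)
    have h2 := Complex.abs_re_le_norm (th ((r:ℂ)^4) X - 1)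
    simpa using h2
  rw [tE_th, tF_th]
  exact ⟨gen _ (by simp [hz]), gen _ (by simp [hz])⟩

noncomputable def sO (r : ℝ) : ℝ := ∑' n : ℤ, r^((2*n+1)^2)

theorem sO_eq (r : ℝ) : tO r 1 = (sO r : ℂ) := by
  unfold tO sO tm
  rw [Complex.ofReal_tsum]
  refine tsum_congr fun n => ?_
  simp

theorem sO_summable (r : ℝ) (hr : 0 < r) (hr1 : r < 1) : Summable (fun n : ℤ => r^((2*n+1)^2)) := by
  have := tmO_summable_norm (r := (r:ℂ)) (x := 1) (by exact_mod_cast hr.ne') (by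
    rw [Complex.norm_real, Real.norm_of_nonneg hr.le]; exact hr1) one_ne_zero
  refine this.congr fun n => ?_
  simp [tm, abs_of_pos hr]

theorem sO_pos (r : ℝ) (hr : 0 < r) (hr1 : r < 1) : 0 < sO r :=
  (sO_summable r hr hr1).tsum_pos (fun n => by positivity) 0 (by positivity)

theorem sO_le (r : ℝ) (hr : 0 < r) (hr1 : r ≤ 1/2) : sO r ≤ 2 * sO (1/2) * r := by
  unfold sO
  rw [mul_assoc, mul_comm _ r, ← mul_assoc, mul_comm 2 r, ← tsum_mul_left]
  refine (sO_summable r hr (by linarith)).tsum_le_tsum ?_ ((sO_summable (1/2) (by norm_num) (by norm_num)).mul_left _)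
  intro n
  obtain ⟨k, hk⟩ : ∃ k : ℕ, (2*n+1)^2 = ((k+1 : ℕ):ℤ) := by
    refine ⟨((2*n+1)^2-1).toNat, ?_⟩
    have : 0 < (2*n+1)^2 := by
      have : 2*n+1 ≠ 0 := by omega
      positivity
    push_cast
    rw [Int.toNat_of_nonneg (by omega)]; ring
  rw [hk, zpow_natCast, zpow_natCast, pow_succ, pow_succ]
  have := pow_le_pow_left₀ hr.le hr1 k
  nlinarith

theorem sO_seven (r : ℝ) (hr : 0 < r) (hr1 : r < 1) : sO (r^7) ≤ r^6 * sO r := by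
  unfold sO
  rw [← tsum_mul_left]
  refine (sO_summable _ (by positivity) (pow_lt_one₀ hr.le hr1 (by norm_num))).tsum_le_tsum ?_ ((sO_summable r hr hr1).mul_left _)
  intro n
  have h1 : 1 ≤ (2*n+1)^2 := by
    have : 2*n+1 ≠ 0 := by omega
    have : 0 < (2*n+1)^2 := by positivity
    omega
  have : (r^7)^((2*n+1)^2) = r^(6*(2*n+1)^2) * r^((2*n+1)^2) := by
    rw [← zpow_natCast, ← zpow_mul, ← zpow_add₀ hr.ne']; congr 1; push_cast; ring
  rw [this]
  have h2 : r^(6*(2*n+1)^2) ≤ r^(6:ℤ) := zpow_le_zpow_right_of_le_one₀ hr hr1.le (by linarith)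
  have h3 : r^(6:ℤ) = r^6 := by norm_cast
  rw [h3] at h2
  exact mul_le_mul_of_nonneg_right h2 (by positivity)
end

section
open Filter Topology

set_option maxHeartbeats 2000000 in
theorem rels (p : ℝ) (ζ : ℂ) (hζ : IsPrimitiveRoot ζ 7) (hp : 0 < p) (hp8 : p^4 ≤ 1/8)
    (x1 x2 x4 w1 w2 w4 y1 y2 y4 a2 a3 a4 A2 A3 A4 l : ℝ)
    (hx1 : tE ((p:ℂ)^2) ζ = x1) (hx2 : tE ((p:ℂ)^2) (ζ^2) = x2) (hx4 : tE ((p:ℂ)^2) (ζ^4) = x4)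
    (hw1 : tO ((p:ℂ)^2) ζ = w1) (hw2 : tO ((p:ℂ)^2) (ζ^2) = w2) (hw4 : tO ((p:ℂ)^2) (ζ^4) = w4)
    (hy1 : tF ((p:ℂ)^2) ζ = y1) (hy2 : tF ((p:ℂ)^2) (ζ^2) = y2) (hy4 : tF ((p:ℂ)^2) (ζ^4) = y4)
    (ha2 : tO ((p:ℂ)^2) 1 = a2) (ha3 : tE ((p:ℂ)^2) 1 = a3) (ha4 : tF ((p:ℂ)^2) 1 = a4)
    (hA2 : tO ((p:ℂ)^14) 1 = A2) (hA3 : tE ((p:ℂ)^14) 1 = A3) (hA4 : tF ((p:ℂ)^14) 1 = A4)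
    (hl : l = a2*(w1*w2*w4)/(a3*(x1*x2*x4)))
    (hc : cof l (Real.sqrt (4-12*l+25*l^2-30*l^3+25*l^4-12*l^5+4*l^6)) (A3^2/a3^2) (A2^2/A3^2) ≠ 0) :
    0 < l ∧ l^2*(a3*A3) = a2*A2 ∧
    (3*a3^2-7*(1+2*l)*A3^2)*(a2*a3) = 8*(w1*x1^2*x2+w2*x2^2*x4+w4*x4^2*x1) := by
  have hp1 : p < 1 := by
    by_contra h
    push Not at h
    have := one_le_pow₀ h (n := 4)
    linarith
  have hz1 : ‖ζ‖ = 1 := by simpa using zeta_norm ζ hζ 1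
  have hz2 := zeta_norm ζ hζ 2
  have hz4 := zeta_norm ζ hζ 4
  have z0 : ζ ≠ 0 := by rintro rfl; simp at hz1
  have z7 : ζ^7 = 1 := hζ.pow_eq_one
  have pc : (p:ℂ) ≠ 0 := by exact_mod_cast hp.ne'
  have pn : ‖(p:ℂ)‖ = p := by rw [Complex.norm_real, Real.norm_of_nonneg hp.le]
  have b2 : (p^2)^4 ≤ 1/64 := by
    have : (p^2)^4 = p^4*p^4 := by ring
    rw [this]; nlinarith [pow_pos hp 4]
  have b14 : (p^14)^4 ≤ 1/64 := by
    have : (p^14)^4 = (p^2)^4*p^48 := by ring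
    rw [this]
    have h1 : p^48 ≤ 1 := pow_le_one₀ hp.le hp1.le
    have h2 : 0 ≤ (p^2)^4 := by positivity
    nlinarith
  have E2 : ∀ z : ℂ, ‖z‖ = 1 → ∀ x : ℝ, tE ((p:ℂ)^2) z = x → |x - 1| ≤ 3/64 := by
    intro z hz x hx
    have := (tE_bd (p^2) (by positivity) b2 z hz).1
    push_cast at this
    rw [hx, Complex.ofReal_re] at this
    linarith
  have F2 : ∀ z : ℂ, ‖z‖ = 1 → ∀ x : ℝ, tF ((p:ℂ)^2) z = x → |x - 1| ≤ 3/64 := by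
    intro z hz x hx
    have := (tE_bd (p^2) (by positivity) b2 z hz).2
    push_cast at this
    rw [hx, Complex.ofReal_re] at this
    linarith
  have E14 : |A3 - 1| ≤ 3/64 := by
    have := (tE_bd (p^14) (by positivity) b14 1 (by simp)).1
    push_cast at this
    rw [hA3, Complex.ofReal_re] at this
    linarith
  have F14 : |A4 - 1| ≤ 3/64 := by
    have := (tE_bd (p^14) (by positivity) b14 1 (by simp)).2
    push_cast at this
    rw [hA4, Complex.ofReal_re] at this
    linarith
  have pos : ∀ x : ℝ, |x-1| ≤ 3/64 → 0 < x := fun x hx => by linarith [(abs_le.mp hx).1]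
  have sa2 : a2 = sO (p^2) := by
    have := sO_eq (p^2)
    push_cast at this
    rw [ha2] at this
    exact_mod_cast this
  have sA2 : A2 = sO ((p^2)^7) := by
    have := sO_eq ((p^2)^7)
    push_cast at this
    rw [← pow_mul, hA2] at this
    exact_mod_cast this
  have pa2 : 0 < a2 := by
    rw [sa2]; exact sO_pos _ (by positivity) (pow_lt_one₀ hp.le hp1 (by norm_num))
  have pA2 : 0 < A2 := by
    rw [sA2]; exact sO_pos _ (by positivity) (pow_lt_one₀ (by positivity) (pow_lt_one₀ hp.le hp1 (by norm_num)) (by norm_num))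
  have ea3 := E2 1 (by simp) a3 ha3
  have ex1 := E2 ζ hz1 x1 hx1
  have ex2 := E2 _ hz2 x2 hx2
  have ex4 := E2 _ hz4 x4 hx4
  have ey1 := F2 ζ hz1 y1 hy1
  have ey2 := F2 _ hz2 y2 hy2
  have ey4 := F2 _ hz4 y4 hy4
  have ea4 := F2 1 (by simp) a4 ha4
  have pa3 := pos _ ea3
  have pA3 := pos _ E14
  have hlt : A2 * a3 < a2 * A3 := by
    have h1 : A2 ≤ (p^2)^6 * a2 := by
      rw [sA2, sa2]; exact sO_seven _ (by positivity) (pow_lt_one₀ hp.le hp1 (by norm_num))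
    have h2 : (p^2)^6 ≤ 1/8 := by
      have e : (p^2)^6 = p^4*p^8 := by ring
      have : p^8 ≤ 1 := pow_le_one₀ hp.le hp1.le
      rw [e]; nlinarith [pow_pos hp 4, pow_pos hp 8]
    have h3 : A2 ≤ 1/8*a2 := h1.trans (mul_le_mul_of_nonneg_right h2 pa2.le)
    calc A2 * a3 ≤ 1/8*a2*a3 := mul_le_mul_of_nonneg_right h3 pa3.le
      _ = a2 * (a3/8) := by ring
      _ < a2 * A3 := mul_lt_mul_of_pos_left (by linarith [(abs_le.mp ea3).2, (abs_le.mp E14).1]) pa2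
  have r0 : (p:ℂ)^2 ≠ 0 := pow_ne_zero _ pc
  have r1 : ‖(p:ℂ)^2‖ < 1 := by rw [norm_pow, pn]; exact pow_lt_one₀ hp.le hp1 (by norm_num)
  have tr := fun x y A B => tri ((p:ℂ)^2) x y A B r0 r1
  have n1 : (1:ℂ) ≠ 0 := one_ne_zero
  have n2 : ζ^2 ≠ 0 := pow_ne_zero _ z0
  have n4 : ζ^4 ≠ 0 := pow_ne_zero _ z0
  have t00 := tr 1 1 1 1 n1 n1 (by simp) (by simp)
  have t11 := tr ζ ζ (ζ^2) 1 z0 z0 (by left; ring) (by left; field_simp)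
  have t22 := tr (ζ^2) (ζ^2) (ζ^4) 1 n2 n2 (by left; ring) (by left; field_simp)
  have t44 := tr (ζ^4) (ζ^4) ζ 1 n4 n4 (by left; linear_combination ζ*z7) (by left; field_simp)
  have t10 := tr ζ 1 ζ ζ z0 n1 (by simp) (by simp)
  have t24 := tr (ζ^2) (ζ^4) ζ (ζ^2) n2 n4 (by right; field_simp; linear_combination z7) (by right; field_simp)
  have t12 := tr ζ (ζ^2) (ζ^4) ζ z0 n2 (by right; field_simp; linear_combination z7) (by right; field_simp)
  have t41 := tr (ζ^4) ζ (ζ^2) (ζ^4) n4 z0 (by right; field_simp; linear_combination z7) (by right; field_simp; linear_combination z7)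
  have R8 : ((p:ℂ)^14)≠0 := pow_ne_zero _ pc
  have R81 : ‖(p:ℂ)^14‖ < 1 := by rw [norm_pow, pn]; exact pow_lt_one₀ hp.le hp1 (by norm_num)
  have T00 := tri ((p:ℂ)^14) 1 1 1 1 R8 R81 n1 n1 (by simp) (by simp)
  have tor := torsion (p:ℂ) ζ hζ pc (by rw [pn]; exact hp8) (by rw [ha2]; exact_mod_cast pa2.ne')
  obtain ⟨C, pr1, pr2, pr3⟩ := prod_rel (p:ℂ) ζ hζ pc (by rw [pn]; exact hp1)
  rw [hx1, hx2, hx4, ha3, hA3] at pr1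
  rw [hy1, hy2, hy4, ha4, hA4] at pr2
  rw [hw1, hw2, hw4, ha2, hA2] at pr3
  rw [hx1, hx2, hx4, hw1, hw2, hw4, hy1, hy2, hy4, ha2, ha3, ha4, hA2, hA3, hA4] at tor
  rw [ha2, ha3, ha4] at t00
  rw [hA2, hA3, hA4] at T00
  rw [hx1, hy1, hw1] at t11
  rw [hx2, hy2, hw2] at t22
  rw [hx4, hy4, hw4] at t44
  rw [hx1, hy1, hw1, ha2, ha3, ha4] at t10
  rw [hx2, hx4, hy2, hy4, hw2, hw4] at t24
  rw [hx1, hx2, hy1, hy2, hw1, hw2] at t12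
  rw [hx1, hx4, hy1, hy4, hw1, hw4] at t41
  clear hx1 hx2 hx4 hy1 hy2 hy4 hw1 hw2 hw4
  obtain ⟨tor1, tor2, tor3⟩ := tor
  have s1c : (a4:ℂ)^4*x1*x2 = a3^2*x2^2*x4^2 - a2^2*(x2^2*w4^2+w2^2*x4^2) + a3^2*w2^2*w4^2 := by
    have : ((a4:ℂ)*a4)^2*(x1*x2) = a3*a3*(x2*x2)*(x4*x4) - a2*a2*((x2*x2)*(w4*w4)+(w2*w2)*(x4*x4)) + a3*a3*(w2*w2)*(w4*w4) := by
      rw [t00.1, t00.2.1, t00.2.2, t22.1, t22.2.2, t44.1, t44.2.2, t12.1]; ring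
    linear_combination this
  have s2c : (a4:ℂ)^4*x2*x4 = a3^2*x4^2*x1^2 - a2^2*(x4^2*w1^2+w4^2*x1^2) + a3^2*w4^2*w1^2 := by
    have : ((a4:ℂ)*a4)^2*(x2*x4) = a3*a3*(x4*x4)*(x1*x1) - a2*a2*((x4*x4)*(w1*w1)+(w4*w4)*(x1*x1)) + a3*a3*(w4*w4)*(w1*w1) := by
      rw [t00.1, t00.2.1, t00.2.2, t44.1, t44.2.2, t11.1, t11.2.2, t24.1]; ring
    linear_combination this
  have s4c : (a4:ℂ)^4*x4*x1 = a3^2*x1^2*x2^2 - a2^2*(x1^2*w2^2+w1^2*x2^2) + a3^2*w1^2*w2^2 := by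
    have : ((a4:ℂ)*a4)^2*(x4*x1) = a3*a3*(x1*x1)*(x2*x2) - a2*a2*((x1*x1)*(w2*w2)+(w1*w1)*(x2*x2)) + a3*a3*(w1*w1)*(w2*w2) := by
      rw [t00.1, t00.2.1, t00.2.2, t11.1, t11.2.2, t22.1, t22.2.2, t41.1]; ring
    linear_combination this
  have q1c : (a3:ℂ)^2*x1^2 = a4^2*y1^2 + a2^2*w1^2 := by
    have : (a3:ℂ)*a3*(x1*x1) = a4*a4*(y1*y1) + a2*a2*(w1*w1) := by
      rw [t00.1, t00.2.1, t00.2.2, t11.1, t11.2.1, t11.2.2]; ring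
    linear_combination this
  have q2c : (a3:ℂ)^2*x2^2 = a4^2*y2^2 + a2^2*w2^2 := by
    have : (a3:ℂ)*a3*(x2*x2) = a4*a4*(y2*y2) + a2*a2*(w2*w2) := by
      rw [t00.1, t00.2.1, t00.2.2, t22.1, t22.2.1, t22.2.2]; ring
    linear_combination this
  have q4c : (a3:ℂ)^2*x4^2 = a4^2*y4^2 + a2^2*w4^2 := by
    have : (a3:ℂ)*a3*(x4*x4) = a4*a4*(y4*y4) + a2*a2*(w4*w4) := by
      rw [t00.1, t00.2.1, t00.2.2, t44.1, t44.2.1, t44.2.2]; ring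
    linear_combination this
  have c1c : (a3:ℂ)^4 = a2^4+a4^4 := by
    have : ((a3:ℂ)*a3)^2 = (a2*a2)^2 + (a4*a4)^2 := by
      rw [t00.1, t00.2.1, t00.2.2]; ring
    linear_combination this
  have C1c : (A3:ℂ)^4 = A2^4+A4^4 := by
    have : ((A3:ℂ)*A3)^2 = (A2*A2)^2 + (A4*A4)^2 := by
      rw [T00.1, T00.2.1, T00.2.2]; ring
    linear_combination this
  have r4c : (a3:ℂ)*(x1*x2*x4) = a4*(y1*y2*y4) + a2*(w1*w2*w4) := by
    have : ((x1:ℂ)*a3)*(x2*x4) = (y1*a4)*(y2*y4) + (w1*a2)*(w2*w4) := by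
      rw [t10.1, t10.2.1, t10.2.2, t24.1, t24.2.1, t24.2.2]; ring
    linear_combination this
  have r5c : (a4:ℂ)*(y1*y2*y4)^2*A3 = a3*(x1*x2*x4)^2*A4 := by
    rw [pr1, pr2]; ring
  have r5c' : (a2:ℂ)*(w1*w2*w4)^2*A3 = a3*(x1*x2*x4)^2*A2 := by
    rw [pr1, pr3]; ring
  exact norm_lem x1 x2 x4 w1 w2 w4 y1 y2 y4 a2 a3 a4 A2 A3 A4 l (pos _ ex1) (pos _ ex2) (pos _ ex4)
    (pos _ ey1) (pos _ ey2) (pos _ ey4) pa2 pa3 (pos _ ea4) pA2 pA3 (pos _ F14) hlt hl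
    (by exact_mod_cast c1c) (by exact_mod_cast C1c) (by exact_mod_cast q1c) (by exact_mod_cast q2c)
    (by exact_mod_cast q4c) (by exact_mod_cast s1c) (by exact_mod_cast s2c) (by exact_mod_cast s4c)
    (by exact_mod_cast r4c) (by exact_mod_cast r5c) (by exact_mod_cast r5c')
    (by exact_mod_cast tor1) (by exact_mod_cast tor2) (by exact_mod_cast tor3) hc
end

section
open Filter Topology

theorem tO_bd (r : ℝ) (hr : 0 < r) (hr1 : r < 1) (z : ℂ) (hz : ‖z‖ = 1) : |(tO r z).re| ≤ sO r := by
  refine (Complex.abs_re_le_norm _).trans ?_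
  unfold tO sO
  have z0 : z ≠ 0 := by rintro rfl; simp at hz
  have e : ∀ n : ℤ, ‖tm r z (2*n+1)‖ = r^((2*n+1)^2) := by
    intro n; simp [tm, hz, abs_of_pos hr]
  refine (norm_tsum_le_tsum_norm (tmO_summable_norm (by exact_mod_cast hr.ne') (by
    rw [Complex.norm_real, Real.norm_of_nonneg hr.le]; exact hr1) z0)).trans_eq ?_
  exact tsum_congr e

theorem ev_small (ε : ℝ) (hε : 0 < ε) : ∀ᶠ p : ℝ in 𝓝[>] 0, 0 < p ∧ p < ε :=
  Ioo_mem_nhdsGT hε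

theorem tE_lim (k : ℕ) (hk : k ≠ 0) (z : ℂ) (hz : ‖z‖ = 1) :
    Tendsto (fun p : ℝ => (tE ((p:ℂ)^k) z).re) (𝓝[>] 0) (𝓝 1) := by
  have h0 : Tendsto (fun p : ℝ => 3*(p^k)^4) (𝓝[>] 0) (𝓝 0) := by
    have : Continuous (fun p : ℝ => 3*(p^k)^4) := by fun_prop
    have := (this.tendsto 0).mono_left (nhdsWithin_le_nhds (s := Set.Ioi 0))
    simpa [hk] using this
  rw [tendsto_iff_norm_sub_tendsto_zero]
  refine squeeze_zero' (Eventually.of_forall fun _ => norm_nonneg _) ?_ h0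
  filter_upwards [ev_small (1/4) (by norm_num)] with p hp
  have h1 : p^k ≤ p := by simpa using pow_le_pow_of_le_one hp.1.le (by linarith) (Nat.one_le_iff_ne_zero.mpr hk)
  have h2 : (p^k)^4 ≤ 1/64 := by
    have h3 : p^k ≤ 1/4 := by linarith
    exact (pow_le_pow_left₀ (pow_nonneg hp.1.le _) h3 4).trans (by norm_num)
  have := (tE_bd (p^k) (pow_pos hp.1 _) h2 z hz).1
  push_cast at this
  exact this

theorem tO_lim (k : ℕ) (hk : k ≠ 0) (z : ℂ) (hz : ‖z‖ = 1) :
    Tendsto (fun p : ℝ => (tO ((p:ℂ)^k) z).re) (𝓝[>] 0) (𝓝 0) := by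
  have h0 : Tendsto (fun p : ℝ => 2*sO (1/2)*p^k) (𝓝[>] 0) (𝓝 0) := by
    have : Continuous (fun p : ℝ => 2*sO (1/2)*p^k) := by fun_prop
    have := (this.tendsto 0).mono_left (nhdsWithin_le_nhds (s := Set.Ioi 0))
    simpa [hk] using this
  refine squeeze_zero_norm' ?_ h0
  filter_upwards [ev_small (1/4) (by norm_num)] with p hp
  have h1 : p^k ≤ p := by simpa using pow_le_pow_of_le_one hp.1.le (by linarith) (Nat.one_le_iff_ne_zero.mpr hk)
  have := tO_bd (p^k) (pow_pos hp.1 _) (by linarith) z hz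
  push_cast at this
  exact this.trans (sO_le _ (pow_pos hp.1 _) (by linarith))

noncomputable def lam (ζ : ℂ) (p : ℝ) : ℝ :=
  (tO ((p:ℂ)^2) 1).re * ((tO ((p:ℂ)^2) ζ).re * (tO ((p:ℂ)^2) (ζ^2)).re * (tO ((p:ℂ)^2) (ζ^4)).re) /
  ((tE ((p:ℂ)^2) 1).re * ((tE ((p:ℂ)^2) ζ).re * (tE ((p:ℂ)^2) (ζ^2)).re * (tE ((p:ℂ)^2) (ζ^4)).re))

theorem cof_ev (ζ : ℂ) (hζ : IsPrimitiveRoot ζ 7) : ∀ᶠ p : ℝ in 𝓝[>] 0,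
    cof (lam ζ p) (Real.sqrt (4-12*lam ζ p+25*lam ζ p^2-30*lam ζ p^3+25*lam ζ p^4-12*lam ζ p^5+4*lam ζ p^6))
      ((tE ((p:ℂ)^14) 1).re^2/(tE ((p:ℂ)^2) 1).re^2) ((tO ((p:ℂ)^14) 1).re^2/(tE ((p:ℂ)^14) 1).re^2) ≠ 0 := by
  have hz1 : ‖ζ‖ = 1 := by simpa using zeta_norm ζ hζ 1
  have hz2 := zeta_norm ζ hζ 2
  have hz4 := zeta_norm ζ hζ 4
  have hl : Tendsto (lam ζ) (𝓝[>] 0) (𝓝 0) := by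
    have := ((tO_lim 2 (by norm_num) 1 (by simp)).mul (((tO_lim 2 (by norm_num) ζ hz1).mul
      (tO_lim 2 (by norm_num) _ hz2)).mul (tO_lim 2 (by norm_num) _ hz4))).div
      ((tE_lim 2 (by norm_num) 1 (by simp)).mul (((tE_lim 2 (by norm_num) ζ hz1).mul
      (tE_lim 2 (by norm_num) _ hz2)).mul (tE_lim 2 (by norm_num) _ hz4))) (by norm_num)
    norm_num at this
    exact this
  have hT := ((tE_lim 14 (by norm_num) 1 (by simp)).pow 2).div ((tE_lim 2 (by norm_num) 1 (by simp)).pow 2) (by norm_num)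
  have hv := ((tO_lim 14 (by norm_num) 1 (by simp)).pow 2).div ((tE_lim 14 (by norm_num) 1 (by simp)).pow 2) (by norm_num)
  have hs : Continuous (fun l : ℝ => Real.sqrt (4-12*l+25*l^2-30*l^3+25*l^4-12*l^5+4*l^6)) := by fun_prop
  have hh := (hs.tendsto 0).comp hl
  have hcc : Continuous (fun q : ℝ×ℝ×ℝ×ℝ => cof q.1 q.2.1 q.2.2.1 q.2.2.2) := by unfold cof; fun_prop
  have := (hcc.tendsto _).comp (hl.prodMk_nhds (hh.prodMk_nhds (hT.prodMk_nhds hv)))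
  have h4 : Real.sqrt 4 = 2 := by rw [show (4:ℝ) = 2^2 by norm_num]; exact Real.sqrt_sq (by norm_num)
  exact this.eventually_ne (by simp [cof, h4]; norm_num)

theorem gen_id (ζ : ℂ) (hζ : IsPrimitiveRoot ζ 7) : ∀ᶠ p : ℝ in 𝓝[>] 0,
    tO (p:ℂ) 1 * tE ((p:ℂ)^2) 1 ^ 2 = tO (p:ℂ) 1 * tE ((p:ℂ)^14) 1 ^2
      + 2 * tO ((p:ℂ)^2) 1 * tO ((p:ℂ)^7) 1 * tE ((p:ℂ)^14) 1
      + (4/7) * ∑ k ∈ Finset.range 7, tO (p:ℂ) (ζ^k) * tE ((p:ℂ)^2) (ζ^k) * tE ((p:ℂ)^2) ((ζ^k)^2) := by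
  have hz1 : ‖ζ‖ = 1 := by simpa using zeta_norm ζ hζ 1
  have hz2 := zeta_norm ζ hζ 2
  have hz4 := zeta_norm ζ hζ 4
  have z0 : ζ ≠ 0 := by rintro rfl; simp at hz1
  have z7 : ζ^7 = 1 := hζ.pow_eq_one
  filter_upwards [ev_small (1/4) (by norm_num), cof_ev ζ hζ] with p hp hc
  have E := fun (k : ℕ) (z : ℂ) (hz : ‖z‖ = 1) => tE_re (p^k) z hz
  have O := fun (k : ℕ) (z : ℂ) (hz : ‖z‖ = 1) => tO_re (p^k) z hz
  have F := fun (k : ℕ) (z : ℂ) (hz : ‖z‖ = 1) => tF_re (p^k) z hz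
  push_cast at E O F
  have p4 : p^4 ≤ 1/8 := (pow_le_pow_left₀ hp.1.le hp.2.le 4).trans (by norm_num)
  obtain ⟨l0, l2, main⟩ := rels p ζ hζ hp.1 p4 _ _ _ _ _ _ _ _ _ _ _ _ _ _ _ (lam ζ p)
    (E 2 ζ hz1) (E 2 _ hz2) (E 2 _ hz4) (O 2 ζ hz1) (O 2 _ hz2) (O 2 _ hz4) (F 2 ζ hz1) (F 2 _ hz2) (F 2 _ hz4)
    (O 2 1 (by simp)) (E 2 1 (by simp)) (F 2 1 (by simp)) (O 14 1 (by simp)) (E 14 1 (by simp)) (F 14 1 (by simp))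
    rfl hc
  have l2c := congrArg (fun t : ℝ => (t:ℂ)) l2
  have mainc := congrArg (fun t : ℝ => (t:ℂ)) main
  push_cast at l2c mainc
  simp only [← E 2 ζ hz1, ← E 2 _ hz2, ← E 2 _ hz4, ← O 2 ζ hz1, ← O 2 _ hz2, ← O 2 _ hz4, ← O 2 1 (by simp),
    ← E 2 1 (by simp), ← O 14 1 (by simp), ← E 14 1 (by simp)] at l2c mainc
  have pc : (p:ℂ) ≠ 0 := by exact_mod_cast hp.1.ne'
  have pn : ‖(p:ℂ)‖ = p := by rw [Complex.norm_real, Real.norm_of_nonneg hp.1.le]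
  have p1 : p < 1 := by linarith
  have dup : ∀ z : ℂ, z ≠ 0 → tO (p:ℂ) z * tO (p:ℂ) 1 = 2 * tO ((p:ℂ)^2) z * tE ((p:ℂ)^2) z := by
    intro z hz
    rw [P22 pc (by rw [pn]; exact p1) hz one_ne_zero, mul_one, div_one]; ring
  have B0 := dup 1 one_ne_zero
  have B7 : tO ((p:ℂ)^7) 1 * tO ((p:ℂ)^7) 1 = 2 * tO ((p:ℂ)^14) 1 * tE ((p:ℂ)^14) 1 := by
    rw [P22 (pow_ne_zero _ pc) (by rw [norm_pow, pn]; exact pow_lt_one₀ hp.1.le p1 (by norm_num)) one_ne_zero one_ne_zero,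
      mul_one, div_one, ← pow_mul]; ring
  have cross : tO ((p:ℂ)^7) 1 * tO (p:ℂ) 1 = 2 * lam ζ p * tE ((p:ℂ)^2) 1 * tE ((p:ℂ)^14) 1 := by
    have h7 := sO_eq (p^7)
    have h1 := sO_eq p
    push_cast at h7
    have sq : (tO ((p:ℂ)^7) 1 * tO (p:ℂ) 1)^2 = (2 * lam ζ p * tE ((p:ℂ)^2) 1 * tE ((p:ℂ)^14) 1)^2 := by
      linear_combination (tO (p:ℂ) 1 * tO (p:ℂ) 1) * B7 + (2 * tO ((p:ℂ)^14) 1 * tE ((p:ℂ)^14) 1) * B0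
        - 4 * tE ((p:ℂ)^2) 1 * tE ((p:ℂ)^14) 1 * l2c
    have pE : ∀ k : ℕ, k ≠ 0 → 0 < (tE ((p:ℂ)^k) 1).re := by
      intro k hk
      have h1 : p^k ≤ p := by simpa using pow_le_pow_of_le_one hp.1.le (by linarith) (Nat.one_le_iff_ne_zero.mpr hk)
      have h2 : (p^k)^4 ≤ 1/64 := by
        have h3 : p^k ≤ 1/4 := by linarith
        exact (pow_le_pow_left₀ (pow_nonneg hp.1.le _) h3 4).trans (by norm_num)
      have := (tE_bd (p^k) (pow_pos hp.1 _) h2 1 (by simp)).1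
      push_cast at this
      linarith [(abs_le.mp this).1]
    have e2 := pE 2 (by norm_num)
    have e14 := pE 14 (by norm_num)
    rw [h7, h1, E 2 1 (by simp), E 14 1 (by simp)] at sq ⊢
    generalize (tE ((p:ℂ)^2) 1).re = x at *
    generalize (tE ((p:ℂ)^14) 1).re = y at *
    have q1 : 0 < sO p := sO_pos _ hp.1 p1
    have q2 : 0 < sO (p^7) := sO_pos _ (pow_pos hp.1 _) (pow_lt_one₀ hp.1.le p1 (by norm_num))
    have sqr : (sO (p^7) * sO p)^2 = (2 * lam ζ p * x * y)^2 := by exact_mod_cast sq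
    have := (pow_left_inj₀ (by positivity) (by positivity) (n := 2) (by norm_num)).mp sqr
    exact_mod_cast this
  have B0ne : tO (p:ℂ) 1 ≠ 0 := by
    rw [sO_eq]; exact_mod_cast (sO_pos _ hp.1 p1).ne'
  have sum := sum7_sym ζ hζ (fun z => tO (p:ℂ) z * tE ((p:ℂ)^2) z * tE ((p:ℂ)^2) (z^2)) (fun z => by
    simp only [inv_pow, tO_inv, tE_inv])
  rw [sum, one_pow, ← pow_mul, ← pow_mul, show ζ^(4*2) = ζ by linear_combination ζ*z7]
  have d1 := dup ζ z0
  have d2 := dup (ζ^2) (pow_ne_zero _ z0)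
  have d4 := dup (ζ^4) (pow_ne_zero _ z0)
  norm_num only
  refine mul_right_cancel₀ B0ne ?_
  generalize tO (p:ℂ) 1 = b0 at *
  generalize tO (p:ℂ) ζ = b1 at *
  generalize tO (p:ℂ) (ζ^2) = b2 at *
  generalize tO (p:ℂ) (ζ^4) = b4 at *
  generalize tO ((p:ℂ)^7) 1 = b7 at *
  generalize tE ((p:ℂ)^2) 1 = a3 at *
  generalize tO ((p:ℂ)^2) 1 = a2 at *
  generalize tE ((p:ℂ)^2) ζ = x1 at *
  generalize tO ((p:ℂ)^2) ζ = w1 at *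
  generalize tE ((p:ℂ)^2) (ζ^2) = x2 at *
  generalize tO ((p:ℂ)^2) (ζ^2) = w2 at *
  generalize tE ((p:ℂ)^2) (ζ^4) = x4 at *
  generalize tO ((p:ℂ)^2) (ζ^4) = w4 at *
  generalize tE ((p:ℂ)^14) 1 = A3 at *
  generalize (lam ζ p : ℂ) = l at *
  linear_combination (a3^2-A3^2-(4/7)*a3*a3)*B0 - 2*a2*A3*cross - (8/7)*(x1*x2*d1+x2*x4*d2+x4*x1*d4) + (2/7)*mainc
end

section
open Filter Topology

theorem triple (f g h : ℤ → ℂ) (hf : Summable fun n => ‖f n‖) (hg : Summable fun n => ‖g n‖) (hh : Summable fun n => ‖h n‖) :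
    (Summable fun t : ℤ × ℤ × ℤ => ‖f t.1 * g t.2.1 * h t.2.2‖) ∧
    (∑' n, f n) * (∑' n, g n) * (∑' n, h n) = ∑' t : ℤ × ℤ × ℤ, f t.1 * g t.2.1 * h t.2.2 := by
  have h1 : Summable fun t : ℤ × ℤ => ‖g t.1 * h t.2‖ := summable_mul_of_summable_norm hg hh |>.norm
  have h2 := summable_mul_of_summable_norm hf h1 |>.norm
  constructor
  · refine h2.congr fun t => ?_
    rw [mul_assoc]
  · rw [mul_assoc, tsum_mul_tsum_of_summable_norm hg hh, tsum_mul_tsum_of_summable_norm hf h1]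
    refine tsum_congr fun t => ?_
    rw [mul_assoc]

theorem fiber {α : Type*} (f : α → ℕ) (p : ℝ) (hs : Summable fun a => p^(f a)) :
    HasSum (fun M : ℕ => (Nat.card {a // f a = M} : ℝ) * p^M) (∑' a, p^(f a)) := by
  have h := hs.hasSum
  rw [← (Equiv.sigmaFiberEquiv f).hasSum_iff] at h
  have h2 := h.sigma (g := fun M => (Nat.card {a // f a = M} : ℝ) * p^M) (fun M => ?_)
  · exact h2
  · have e : (fun c : {a // f a = M} => ((fun a => p^(f a)) ∘ (Equiv.sigmaFiberEquiv f)) ⟨M, c⟩) = fun _ => p^M := by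
      funext c
      simp only [Function.comp_apply, Equiv.sigmaFiberEquiv_apply]
      rw [c.2]
    have hsum : Summable (fun c : {a // f a = M} => ((fun a => p^(f a)) ∘ (Equiv.sigmaFiberEquiv f)) ⟨M, c⟩) :=
      h.summable.sigma_factor M
    have := hsum.hasSum
    convert this using 1
    rw [e, tsum_const, nsmul_eq_mul]

theorem coef_zero (c : ℕ → ℝ) (p0 : ℝ) (hp0 : 0 < p0) (hs : Summable fun n => |c n| * p0^n)
    (hz : ∀ᶠ p : ℝ in 𝓝[>] 0, HasSum (fun n => c n * p^n) 0) : ∀ n, c n = 0 := by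
  intro n
  induction n using Nat.strong_induction_on with
  | _ n ih =>
    have hs' : Summable fun j => |c (j + n + 1)| * p0^(j+n+1) := by
      have := (summable_nat_add_iff (n+1)).mpr hs
      exact this
    obtain ⟨K, hK⟩ : ∃ K, K = (∑' j, |c (j + n + 1)| * p0^(j+n+1)) / p0^(n+1) := ⟨_, rfl⟩
    have hb : ∀ᶠ p : ℝ in 𝓝[>] 0, |c n| ≤ p * K := by
      filter_upwards [hz, ev_small p0 hp0] with p h hp
      have h1 : HasSum (fun j => c (j + (n+1)) * p^(j+(n+1))) (0 - ∑ i ∈ Finset.range (n+1), c i * p^i) :=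
        (hasSum_nat_add_iff' (n+1)).mpr h
      have h2 : ∑ i ∈ Finset.range (n+1), c i * p^i = c n * p^n := by
        rw [Finset.sum_range_succ, Finset.sum_eq_zero, zero_add]
        intro i hi
        rw [ih i (Finset.mem_range.mp hi), zero_mul]
      rw [h2, zero_sub] at h1
      have hle : ∀ j, ‖c (j + (n+1)) * p^(j+(n+1))‖ ≤ (p/p0)^(n+1) * (|c (j + n + 1)| * p0^(j+n+1)) := by
        intro j
        rw [norm_mul, norm_pow, Real.norm_eq_abs, Real.norm_of_nonneg hp.1.le, ← add_assoc]
        have h3 : p^j ≤ p0^j := pow_le_pow_left₀ hp.1.le hp.2.le j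
        have h4 : (p/p0)^(n+1) * (|c (j + n + 1)| * p0^(j+n+1)) = |c (j+n+1)| * (p^(n+1) * p0^j) := by
          rw [div_pow, add_assoc, pow_add p0 j (n+1)]; field_simp
        rw [h4, add_assoc j n 1, pow_add p j (n+1), mul_comm (p^j)]
        have := pow_pos hp.1 (n+1)
        gcongr
      have h5 := tsum_of_norm_bounded (hs'.mul_left ((p/p0)^(n+1))).hasSum hle
      rw [h1.tsum_eq, tsum_mul_left, norm_neg, norm_mul, norm_pow, Real.norm_eq_abs, Real.norm_of_nonneg hp.1.le] at h5
      have h6 : (p/p0)^(n+1) * ∑' j, |c (j + n + 1)| * p0^(j+n+1) = (p * K) * p^n := by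
        rw [hK, div_pow, pow_succ p]; field_simp
      rw [h6] at h5
      exact le_of_mul_le_mul_right h5 (pow_pos hp.1 n)
    have ht : Tendsto (fun p : ℝ => p * K) (𝓝[>] 0) (𝓝 0) := by
      have : Continuous (fun p : ℝ => p * K) := by fun_prop
      have := (this.tendsto 0).mono_left (nhdsWithin_le_nhds (s := Set.Ioi 0))
      simpa using this
    have := ge_of_tendsto ht hb
    exact abs_nonpos_iff.mp this

abbrev Z3 := ℤ × ℤ × ℤ
def f1 (t : Z3) : ℕ := ((2*t.1+1)^2+8*t.2.1^2+8*t.2.2^2).toNat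
def f2 (t : Z3) : ℕ := ((2*t.1+1)^2+56*t.2.1^2+56*t.2.2^2).toNat
def f3 (t : Z3) : ℕ := (2*(2*t.1+1)^2+7*(2*t.2.1+1)^2+56*t.2.2^2).toNat
abbrev Z4 := {t : Z3 // (7:ℤ) ∣ (2*t.1+1) + 2*t.2.1 + 4*t.2.2}
def f4 (t : Z4) : ℕ := f1 t.1

theorem toN (p : ℂ) (k : ℤ) (hk : 0 ≤ k) : p^(k.toNat) = p^k := by
  rw [← zpow_natCast, Int.toNat_of_nonneg hk]

theorem tmE1 (p z : ℂ) (k : ℕ) (n : ℤ) : tm (p^k) z n = p^(k*n^2) * z^n := by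
  unfold tm; rw [← zpow_natCast, ← zpow_mul]

section
variable (p : ℝ) (hp : 0 < p) (hp1 : p < 1)

theorem pk (k : ℕ) (hk : k ≠ 0) (hp : 0 < p) (hp1 : p < 1) : (p:ℂ)^k ≠ 0 ∧ ‖(p:ℂ)^k‖ < 1 := by
  constructor
  · exact pow_ne_zero _ (by exact_mod_cast hp.ne')
  · rw [norm_pow, Complex.norm_real, Real.norm_of_nonneg hp.le]; exact pow_lt_one₀ hp.le hp1 hk

theorem toReal {α : Type*} (f : α → ℕ) (hs : Summable fun a => ‖(p:ℂ)^(f a)‖) (hp : 0 < p) :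
    (Summable fun a => p^(f a)) ∧ ∑' a, (p:ℂ)^(f a) = ((∑' a, p^(f a) : ℝ) : ℂ) := by
  constructor
  · refine hs.congr fun a => ?_
    rw [norm_pow, Complex.norm_real, Real.norm_of_nonneg hp.le]
  · push_cast; rfl

theorem g1 (hp : 0 < p) (hp1 : p < 1) : (Summable fun a => p^(f1 a)) ∧ 
    tO (p:ℂ) 1 * tE ((p:ℂ)^2) 1 ^ 2 = ((∑' a, p^(f1 a) : ℝ) : ℂ) := by
  have k1 := pk p 1 (by norm_num) hp hp1
  have k2 := pk p 2 (by norm_num) hp hp1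
  have pc : (p:ℂ) ≠ 0 := by exact_mod_cast hp.ne'
  obtain ⟨h1, h2⟩ := triple _ _ _ (tmO_summable_norm k1.1 k1.2 one_ne_zero) (tmE_summable_norm k2.1 k2.2 one_ne_zero)
    (tmE_summable_norm k2.1 k2.2 one_ne_zero)
  have e : ∀ t : Z3, tm ((p:ℂ)^1) 1 (2*t.1+1) * tm ((p:ℂ)^2) 1 (2*t.2.1) * tm ((p:ℂ)^2) 1 (2*t.2.2) = (p:ℂ)^(f1 t) := by
    intro t
    rw [f1, toN _ _ (by positivity), tmE1, tmE1, tmE1, one_zpow, one_zpow, one_zpow, mul_one, mul_one, mul_one,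
      ← zpow_add₀ pc, ← zpow_add₀ pc]
    congr 1; push_cast; ring
  simp only [e] at h1 h2
  have := toReal p f1 h1 hp
  refine ⟨this.1, ?_⟩
  rw [← this.2, ← h2, pow_one]
  unfold tE tO; ring

theorem g2' (hp : 0 < p) (hp1 : p < 1) : (Summable fun a => p^(f2 a)) ∧ 
    tO (p:ℂ) 1 * tE ((p:ℂ)^14) 1 ^ 2 = ((∑' a, p^(f2 a) : ℝ) : ℂ) := by
  have k1 := pk p 1 (by norm_num) hp hp1
  have k2 := pk p 14 (by norm_num) hp hp1
  have pc : (p:ℂ) ≠ 0 := by exact_mod_cast hp.ne'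
  obtain ⟨h1, h2⟩ := triple _ _ _ (tmO_summable_norm k1.1 k1.2 one_ne_zero) (tmE_summable_norm k2.1 k2.2 one_ne_zero)
    (tmE_summable_norm k2.1 k2.2 one_ne_zero)
  have e : ∀ t : Z3, tm ((p:ℂ)^1) 1 (2*t.1+1) * tm ((p:ℂ)^14) 1 (2*t.2.1) * tm ((p:ℂ)^14) 1 (2*t.2.2) = (p:ℂ)^(f2 t) := by
    intro t
    rw [f2, toN _ _ (by positivity), tmE1, tmE1, tmE1, one_zpow, one_zpow, one_zpow, mul_one, mul_one, mul_one,
      ← zpow_add₀ pc, ← zpow_add₀ pc]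
    congr 1; push_cast; ring
  simp only [e] at h1 h2
  have := toReal p f2 h1 hp
  refine ⟨this.1, ?_⟩
  rw [← this.2, ← h2, pow_one]
  unfold tE tO; ring

theorem g3 (hp : 0 < p) (hp1 : p < 1) : (Summable fun a => p^(f3 a)) ∧ 
    tO ((p:ℂ)^2) 1 * tO ((p:ℂ)^7) 1 * tE ((p:ℂ)^14) 1 = ((∑' a, p^(f3 a) : ℝ) : ℂ) := by
  have k1 := pk p 2 (by norm_num) hp hp1
  have k2 := pk p 7 (by norm_num) hp hp1
  have k3 := pk p 14 (by norm_num) hp hp1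
  have pc : (p:ℂ) ≠ 0 := by exact_mod_cast hp.ne'
  obtain ⟨h1, h2⟩ := triple _ _ _ (tmO_summable_norm k1.1 k1.2 one_ne_zero) (tmO_summable_norm k2.1 k2.2 one_ne_zero)
    (tmE_summable_norm k3.1 k3.2 one_ne_zero)
  have e : ∀ t : Z3, tm ((p:ℂ)^2) 1 (2*t.1+1) * tm ((p:ℂ)^7) 1 (2*t.2.1+1) * tm ((p:ℂ)^14) 1 (2*t.2.2) = (p:ℂ)^(f3 t) := by
    intro t
    rw [f3, toN _ _ (by positivity), tmE1, tmE1, tmE1, one_zpow, one_zpow, one_zpow, mul_one, mul_one, mul_one,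
      ← zpow_add₀ pc, ← zpow_add₀ pc]
    congr 1; push_cast; ring
  simp only [e] at h1 h2
  have := toReal p f3 h1 hp
  refine ⟨this.1, ?_⟩
  rw [← this.2, ← h2]
  rfl

theorem g4' (ζ : ℂ) (hζ : IsPrimitiveRoot ζ 7) (hp : 0 < p) (hp1 : p < 1) : (Summable fun a => p^(f4 a)) ∧ 
    ∑ k ∈ Finset.range 7, tO (p:ℂ) (ζ^k) * tE ((p:ℂ)^2) (ζ^k) * tE ((p:ℂ)^2) ((ζ^k)^2) = 7 * ((∑' a, p^(f4 a) : ℝ) : ℂ) := by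
  have k1 := pk p 1 (by norm_num) hp hp1
  have k2 := pk p 2 (by norm_num) hp hp1
  have pc : (p:ℂ) ≠ 0 := by exact_mod_cast hp.ne'
  have zk : ∀ k : ℕ, ζ^k ≠ 0 := fun k => pow_ne_zero _ (hζ.ne_zero (by norm_num))
  have hs1 := (g1 p hp hp1).1
  have hs4 : Summable fun a => p^(f4 a) := hs1.comp_injective Subtype.val_injective
  refine ⟨hs4, ?_⟩
  have e : ∀ (k : ℕ) (t : Z3), tm ((p:ℂ)^1) (ζ^k) (2*t.1+1) * tm ((p:ℂ)^2) (ζ^k) (2*t.2.1) * tm ((p:ℂ)^2) ((ζ^k)^2) (2*t.2.2)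
      = (p:ℂ)^(f1 t) * (ζ^k)^((2*t.1+1) + 2*t.2.1 + 4*t.2.2) := by
    intro k t
    rw [f1, toN _ _ (by positivity), tmE1, tmE1, tmE1, zpow_add₀ (zk k) (2*t.1+1+2*t.2.1) (4*t.2.2), zpow_add₀ (zk k) (2*t.1+1) (2*t.2.1)]
    have e1 : ((ζ^k)^2)^(2*t.2.2) = (ζ^k)^(4*t.2.2) := by
      rw [← zpow_natCast (ζ^k) 2, ← zpow_mul]; congr 1; push_cast; ring
    have e2 : (p:ℂ)^((2*t.1+1)^2+8*t.2.1^2+8*t.2.2^2) = (p:ℂ)^(((1:ℕ):ℤ)*(2*t.1+1)^2) * (p:ℂ)^(((2:ℕ):ℤ)*(2*t.2.1)^2) * (p:ℂ)^(((2:ℕ):ℤ)*(2*t.2.2)^2) := by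
      rw [← zpow_add₀ pc, ← zpow_add₀ pc]; congr 1; push_cast; ring
    rw [e1, e2]; ring
  have h : ∀ k : ℕ, Summable (fun t : Z3 => (p:ℂ)^(f1 t) * (ζ^k)^((2*t.1+1) + 2*t.2.1 + 4*t.2.2)) ∧
      tO (p:ℂ) (ζ^k) * tE ((p:ℂ)^2) (ζ^k) * tE ((p:ℂ)^2) ((ζ^k)^2) = ∑' t : Z3, (p:ℂ)^(f1 t) * (ζ^k)^((2*t.1+1) + 2*t.2.1 + 4*t.2.2) := by
    intro k
    obtain ⟨h1, h2⟩ := triple _ _ _ (tmO_summable_norm k1.1 k1.2 (zk k)) (tmE_summable_norm k2.1 k2.2 (zk k))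
      (tmE_summable_norm k2.1 k2.2 (pow_ne_zero 2 (zk k)))
    simp only [e] at h1 h2
    refine ⟨h1.of_norm, ?_⟩
    rw [← h2, pow_one]
    rfl
  rw [Finset.sum_congr rfl (fun k _ => (h k).2), ← Summable.tsum_finsetSum (fun k _ => (h k).1)]
  have e3 : ∀ t : Z3, ∑ k ∈ Finset.range 7, (p:ℂ)^(f1 t) * (ζ^k)^((2*t.1+1) + 2*t.2.1 + 4*t.2.2) =
      7 * Set.indicator {t : Z3 | (7:ℤ) ∣ (2*t.1+1) + 2*t.2.1 + 4*t.2.2} (fun t => (p:ℂ)^(f1 t)) t := by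
    intro t
    rw [← Finset.mul_sum, root_sum ζ hζ, Set.indicator_apply]
    simp only [Set.mem_ofPred_eq]
    split_ifs <;> ring
  simp only [e3]
  rw [tsum_mul_left, ← tsum_subtype]
  push_cast
  rfl
end

theorem cards : ∀ M : ℕ, Nat.card {a // f1 a = M} = Nat.card {a // f2 a = M} + 2 * Nat.card {a // f3 a = M} + 4 * Nat.card {a // f4 a = M} := by
  intro M
  obtain ⟨ζ, hζ⟩ : ∃ ζ : ℂ, IsPrimitiveRoot ζ 7 := ⟨_, Complex.isPrimitiveRoot_exp 7 (by norm_num)⟩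
  have key := coef_zero (fun M => (Nat.card {a // f1 a = M} : ℝ) - (Nat.card {a // f2 a = M} + 2 * Nat.card {a // f3 a = M} + 4 * Nat.card {a // f4 a = M}))
    (1/2) (by norm_num) ?_ ?_ M
  · have : (Nat.card {a // f1 a = M} : ℝ) = (Nat.card {a // f2 a = M} + 2 * Nat.card {a // f3 a = M} + 4 * Nat.card {a // f4 a = M}) := by linarith
    exact_mod_cast this
  · have q := fun (p : ℝ) (hp : 0 < p) (hp1 : p < 1) => fiber f1 p (g1 p hp hp1).1
    have s1 := (fiber f1 (1/2) (g1 (1/2) (by norm_num) (by norm_num)).1).summable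
    have s2 := (fiber f2 (1/2) (g2' (1/2) (by norm_num) (by norm_num)).1).summable
    have s3 := (fiber f3 (1/2) (g3 (1/2) (by norm_num) (by norm_num)).1).summable
    have s4 := (fiber f4 (1/2) (g4' (1/2) ζ hζ (by norm_num) (by norm_num)).1).summable
    refine (s1.sub ((s2.add (s3.mul_left 2)).add (s4.mul_left 4))).norm.congr fun n => ?_
    have hpos : (0:ℝ) < (1/2)^n := by positivity
    conv_rhs => rw [← abs_of_pos hpos, ← abs_mul]
    rw [Real.norm_eq_abs]; congr 1; ring
  · filter_upwards [gen_id ζ hζ, ev_small 1 one_pos] with p h hp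
    have G1 := g1 p hp.1 hp.2
    have G2 := g2' p hp.1 hp.2
    have G3 := g3 p hp.1 hp.2
    have G4 := g4' p ζ hζ hp.1 hp.2
    rw [G1.2, G2.2, G4.2, mul_assoc, mul_assoc, ← mul_assoc _ _ (tE _ _), G3.2] at h
    have hr : ∑' a, p^(f1 a) = ∑' a, p^(f2 a) + 2 * ∑' a, p^(f3 a) + 4 * ∑' a, p^(f4 a) := by
      have : ((∑' a, p^(f1 a) : ℝ) : ℂ) = ((∑' a, p^(f2 a) + 2 * ∑' a, p^(f3 a) + 4 * ∑' a, p^(f4 a) : ℝ) : ℂ) := by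
        rw [h]; simp only [Complex.ofReal_add, Complex.ofReal_mul]; push_cast; ring
      exact_mod_cast this
    have := (fiber f1 p G1.1).sub (((fiber f2 p G2.1).add ((fiber f3 p G3.1).mul_left 2)).add ((fiber f4 p G4.1).mul_left 4))
    rw [hr, sub_self] at this
    exact this.congr_fun (fun x => by ring)
end

theorem card_of {α : Type*} (f : α → ℕ) (N : ℕ) (s : Set Z3) (g : α → Z3) (hg : Function.Injective g)
    (h1 : ∀ a, f a = N ↔ g a ∈ s) (h2 : ∀ t ∈ s, ∃ a, g a = t) : s.ncard = Nat.card {a // f a = N} := by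
  rw [← Nat.card_coe_set_eq]
  symm
  refine Nat.card_eq_of_bijective (fun a : {a // f a = N} => (⟨g a.1, (h1 _).mp a.2⟩ : s)) ⟨?_, ?_⟩
  · intro a b h
    exact Subtype.ext (hg (Subtype.ext_iff.mp h))
  · rintro ⟨t, ht⟩
    obtain ⟨a, rfl⟩ := h2 t ht
    exact ⟨⟨a, (h1 a).mpr ht⟩, rfl⟩

theorem sq8 (x : ℤ) : (x % 2 = 1 ∧ x^2 % 8 = 1) ∨ (x % 4 = 0 ∧ x^2 % 8 = 0) ∨ (x % 4 = 2 ∧ x^2 % 8 = 4) := by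
  have h : x % 8 = 0 ∨ x % 8 = 1 ∨ x % 8 = 2 ∨ x % 8 = 3 ∨ x % 8 = 4 ∨ x % 8 = 5 ∨ x % 8 = 6 ∨ x % 8 = 7 := by omega
  have e : x^2 % 8 = ((x%8)*(x%8)) % 8 := by rw [pow_two]; exact Int.mul_emod x x 8
  generalize x^2 = X at *
  rcases h with h | h | h | h | h | h | h | h <;> rw [h] at e <;> omega

theorem toNat_iff (k : ℤ) (hk : 0 ≤ k) (N : ℕ) : k.toNat = N ↔ (N:ℤ) = k := by omega

theorem rep1 (N : ℕ) (h8 : (N:ℤ) % 8 = 1) : rep 1 8 8 0 0 0 N = Nat.card {a // f1 a = N} := by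
  refine card_of f1 N _ (fun t => (2*t.1+1, t.2.1, t.2.2)) ?_ ?_ ?_
  · rintro ⟨a, b, c⟩ ⟨a', b', c'⟩ h
    simp only [Prod.mk.injEq] at h ⊢
    omega
  · rintro ⟨a, b, c⟩
    rw [f1, toNat_iff _ (by positivity)]
    simp only [Set.mem_ofPred_eq]
    constructor <;> intro h <;> linear_combination h
  · rintro ⟨x, y, z⟩ h
    simp only [Set.mem_ofPred_eq] at h
    have hx := sq8 x
    ring_nf at h
    generalize y^2 = Y at *
    generalize z^2 = Z at *
    generalize x^2 = X at *
    exact ⟨((x-1)/2, y, z), by simp only [Prod.mk.injEq, and_true]; omega⟩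

theorem rep2 (N : ℕ) (h8 : (N:ℤ) % 8 = 1) : rep 1 14 14 0 0 0 N = Nat.card {a // f2 a = N} := by
  refine card_of f2 N _ (fun t => (2*t.1+1, 2*t.2.1, 2*t.2.2)) ?_ ?_ ?_
  · rintro ⟨a, b, c⟩ ⟨a', b', c'⟩ h
    simp only [Prod.mk.injEq] at h ⊢
    omega
  · rintro ⟨a, b, c⟩
    rw [f2, toNat_iff _ (by positivity)]
    simp only [Set.mem_ofPred_eq]
    constructor <;> intro h <;> linear_combination h
  · rintro ⟨x, y, z⟩ h
    simp only [Set.mem_ofPred_eq] at h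
    have hx := sq8 x
    have hy := sq8 y
    have hz := sq8 z
    ring_nf at h
    generalize y^2 = Y at *
    generalize z^2 = Z at *
    generalize x^2 = X at *
    exact ⟨((x-1)/2, y/2, z/2), by simp only [Prod.mk.injEq]; omega⟩

theorem rep3 (N : ℕ) (h8 : (N:ℤ) % 8 = 1) : rep 2 7 14 0 0 0 N = Nat.card {a // f3 a = N} := by
  refine card_of f3 N _ (fun t => (2*t.1+1, 2*t.2.1+1, 2*t.2.2)) ?_ ?_ ?_
  · rintro ⟨a, b, c⟩ ⟨a', b', c'⟩ h
    simp only [Prod.mk.injEq] at h ⊢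
    omega
  · rintro ⟨a, b, c⟩
    rw [f3, toNat_iff _ (by positivity)]
    simp only [Set.mem_ofPred_eq]
    constructor <;> intro h <;> linear_combination h
  · rintro ⟨x, y, z⟩ h
    simp only [Set.mem_ofPred_eq] at h
    have hx := sq8 x
    have hy := sq8 y
    have hz := sq8 z
    ring_nf at h
    generalize y^2 = Y at *
    generalize z^2 = Z at *
    generalize x^2 = X at *
    exact ⟨((x-1)/2, (y-1)/2, z/2), by simp only [Prod.mk.injEq]; omega⟩

def bk (a : Z4) : ℤ := -((2*a.1.1+1) + 2*a.1.2.1 + 4*a.1.2.2)/7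

theorem bk_spec (a : Z4) : 7 * bk a = -((2*a.1.1+1) + 2*a.1.2.1 + 4*a.1.2.2) := by
  have := a.2
  unfold bk
  omega

def bg (a : Z4) : Z3 :=
  ((2*a.1.1+1) + 2 * bk a + 2 * (bk a + a.1.2.2), 2 * (bk a + a.1.2.2), bk a)

theorem rep4 (N : ℕ) (h8 : (N:ℤ) % 8 = 1) : rep 3 5 14 0 0 2 N = Nat.card {a // f4 a = N} := by
  refine card_of f4 N _ bg ?_ ?_ ?_
  · intro a b h
    have ha := bk_spec a
    have hb := bk_spec b
    simp only [bg, Prod.mk.injEq] at h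
    refine Subtype.ext (Prod.ext ?_ (Prod.ext ?_ ?_)) <;> omega
  · intro a
    have ha := bk_spec a
    rw [f4, f1, toNat_iff _ (by positivity)]
    simp only [bg, Set.mem_ofPred_eq]
    generalize bk a = z at *
    obtain ⟨⟨n, u, v⟩, hd⟩ := a
    simp only at ha ⊢
    obtain rfl : u = -n - 2*v - 3*z - (z+1)/2 := by omega
    obtain ⟨k, rfl⟩ : ∃ k, z = 2*k+1 := ⟨(z-1)/2, by omega⟩
    have e : (2*k+1+1)/2 = k+1 := by omega
    rw [e]
    constructor <;> intro h <;> linear_combination h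
  · rintro ⟨x, y, z⟩ h
    simp only [Set.mem_ofPred_eq] at h
    have hx := sq8 x
    have hy := sq8 y
    have hz := sq8 z
    have hs := sq8 (x+y)
    have h' : (N:ℤ) = 2*x^2+4*y^2+(x+y)^2+14*z^2 := by linear_combination h
    clear h
    generalize (x+y)^2 = S at *
    generalize y^2 = Y at *
    generalize z^2 = Z at *
    generalize x^2 = X at *
    have px : x % 2 = 1 := by omega
    have py : y % 2 = 0 := by omega
    have pz : z % 2 = 1 := by omega
    refine ⟨⟨((x - 2*z - y - 1)/2, -((x+z)/2+y/2), y/2 - z), ?_⟩, ?_⟩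
    · refine ⟨-z, ?_⟩
      simp only
      omega
    · have := bk_spec ⟨((x - 2*z - y - 1)/2, -((x+z)/2+y/2), y/2 - z), ⟨-z, by simp only; omega⟩⟩
      simp only [bg, Prod.mk.injEq]
      simp only at this
      omega

theorem thm_1_2_first (M : ℤ) (hM : 0 < M) (h8 : M % 8 = 1) :
    rep 1 8 8 0 0 0 M =
      rep 1 14 14 0 0 0 M + 2 * rep 2 7 14 0 0 0 M + 4 * rep 3 5 14 0 0 2 M := by
  obtain ⟨N, rfl⟩ := Int.eq_ofNat_of_zero_le hM.le
  rw [rep1 N h8, rep2 N h8, rep3 N h8, rep4 N h8]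
  exact cards N
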